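/- Let (R,m) be an analytically unramified unmixed Noetherian local ring of positive dimension. Then ē_1(I) ≥ 0 for every m-primary ideal I. -/

import Mathlib

open Finset IsLocalRing

/-- The length of an `R`-module `M`: the Krull dimension of its lattice of submodules,
i.e. the supremum of the lengths of chains of submodules of `M`. -/
noncomputable def moduleLength (R M : Type*) [CommRing R] [AddCommGroup M] [Module R M] :
    WithBot ℕ∞ :=
  Order.krullDim (Submodule R M)

/-- A local Noetherian ring is Cohen-Macaulay if its depth equals its Krull dimension,
equivalently, if it admits a regular sequence in the maximal ideal whose length is the
Krull dimension. -/
def IsCohenMacaulayLocalRing (R : Type*) [CommRing R] [IsLocalRing R] : Prop :=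
  ∃ rs : List R, (∀ x ∈ rs, x ∈ maximalIdeal R) ∧
    RingTheory.Sequence.IsRegular R rs ∧ (rs.length : WithBot ℕ∞) = ringKrullDim R

/-- `e 0, …, e d` are the Hilbert coefficients of an ideal `I` in a ring of dimension `d`:
for all large `n`, `λ(R ⧸ I^(n+1)) = ∑_{i=0}^{d} (-1)^i (e i) C(n+d-i, d-i)`. -/
def HasHilbertCoeffs {R : Type*} [CommRing R] (I : Ideal R) (d : ℕ) (e : ℕ → ℤ) : Prop :=
  ∃ N : ℕ, ∀ n ≥ N, ∃ l : ℕ,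
    moduleLength R (R ⧸ I ^ (n + 1)) = (l : WithBot ℕ∞) ∧
    (l : ℤ) = ∑ i ∈ Finset.range (d + 1), (-1 : ℤ) ^ i * e i * ((n + d - i).choose (d - i))

/-- The set of elements integral over an ideal `I`: all `y` satisfying an equation
`y^m + a₁ y^(m-1) + ⋯ + a_m = 0` with `a_j ∈ I^j`. -/
def integralOverIdeal {R : Type*} [CommRing R] (I : Ideal R) : Set R :=
  {y | ∃ m : ℕ, 0 < m ∧ ∃ a : ℕ → R, (∀ j, 1 ≤ j → j ≤ m → a j ∈ I ^ j) ∧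
    y ^ m + ∑ j ∈ Finset.Icc 1 m, a j * y ^ (m - j) = 0}

/-- The integral closure of an ideal `I`, as an ideal (the set of elements integral over
`I` is an ideal, so it coincides with the ideal it generates). -/
noncomputable def idealIntegralClosure {R : Type*} [CommRing R] (I : Ideal R) : Ideal R :=
  Ideal.span (integralOverIdeal I)

/-- `ebar 0, …, ebar d` are the normal Hilbert coefficients of `I`: for all large `n`,
`λ(R ⧸ closure(I^(n+1))) = ∑_{i=0}^{d} (-1)^i (ebar i) C(n+d-i, d-i)`. -/
def HasNormalHilbertCoeffs {R : Type*} [CommRing R] (I : Ideal R) (d : ℕ) (ebar : ℕ → ℤ) :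
    Prop :=
  ∃ N : ℕ, ∀ n ≥ N, ∃ l : ℕ,
    moduleLength R (R ⧸ idealIntegralClosure (I ^ (n + 1))) = (l : WithBot ℕ∞) ∧
    (l : ℤ) = ∑ i ∈ Finset.range (d + 1), (-1 : ℤ) ^ i * ebar i * ((n + d - i).choose (d - i))

/-- A Noetherian local ring `R` is unmixed if `dim(R̂/p) = dim R̂` for every associated
prime `p` of the `m`-adic completion `R̂` of `R`. -/
def IsUnmixedLocalRing (R : Type*) [CommRing R] [IsLocalRing R] : Prop :=
  ∀ p ∈ associatedPrimes (AdicCompletion (maximalIdeal R) R)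
      (AdicCompletion (maximalIdeal R) R),
    ringKrullDim (AdicCompletion (maximalIdeal R) R ⧸ p) =
      ringKrullDim (AdicCompletion (maximalIdeal R) R)

section Lengths

variable {A : Type*} [CommRing A]

/-- The colength of an ideal. -/
noncomputable def colength (J : Ideal A) : ℕ∞ := Module.length A (A ⧸ J)

/-- The ideal of all `a` with `a * y ∈ J`. -/
def colonElem (J : Ideal A) (y : A) : Ideal A := Submodule.comap (LinearMap.toSpanSingleton A A y) J

theorem mem_colonElem {J : Ideal A} {y a : A} : a ∈ colonElem J y ↔ a * y ∈ J := by
  simp [colonElem]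

theorem colength_anti {J K : Ideal A} (h : J ≤ K) : colength K ≤ colength J :=
  Module.length_le_of_surjective (Submodule.factor h) (Submodule.factor_surjective h)

theorem colength_top : colength (⊤ : Ideal A) = 0 := by
  rw [colength, Module.length_eq_zero_iff]
  exact Ideal.Quotient.subsingleton_iff.2 rfl

theorem colength_maximal (P : Ideal A) [hP : P.IsMaximal] : colength P = 1 := by
  rw [colength, Module.length_eq_one_iff]
  exact isSimpleModule_iff_isCoatom.2 (Ideal.isMaximal_def.1 hP)

theorem one_le_colength {J : Ideal A} (h : J ≠ ⊤) : 1 ≤ colength J := by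
  rw [Order.one_le_iff_ne_zero]
  intro h0
  rw [colength, Module.length_eq_zero_iff, Ideal.Quotient.subsingleton_iff] at h0
  exact h h0

theorem colength_eq_sup_add_colon (J : Ideal A) (y : A) :
    colength J = colength (J ⊔ Ideal.span {y}) + colength (colonElem J y) := by
  have hle : colonElem J y ≤ Submodule.comap (LinearMap.toSpanSingleton A A y) J := fun _ h => h
  rw [add_comm]
  refine Module.length_eq_add_of_exact
    (Submodule.mapQ (colonElem J y) J (LinearMap.toSpanSingleton A A y) hle)
    (Submodule.factor (le_sup_left : J ≤ J ⊔ Ideal.span {y})) ?_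
    (Submodule.factor_surjective _) ?_
  · rw [← LinearMap.ker_eq_bot, eq_bot_iff]
    intro z hz
    obtain ⟨z, rfl⟩ := Submodule.mkQ_surjective _ z
    rw [LinearMap.mem_ker, Submodule.mkQ_apply, Submodule.mapQ_apply,
      Submodule.Quotient.mk_eq_zero] at hz
    rw [Submodule.mem_bot, Submodule.mkQ_apply, Submodule.Quotient.mk_eq_zero]
    exact hz
  · intro z
    obtain ⟨z, rfl⟩ := Submodule.mkQ_surjective _ z
    constructor
    · intro h
      have : z ∈ J ⊔ Ideal.span {y} := by
        rw [Submodule.mkQ_apply] at h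
        exact (Submodule.Quotient.mk_eq_zero _).1 h
      obtain ⟨j, hj, w, hw, rfl⟩ := Submodule.mem_sup.1 this
      obtain ⟨a, rfl⟩ := Ideal.mem_span_singleton'.1 hw
      refine ⟨Submodule.mkQ _ a, ?_⟩
      rw [Submodule.mkQ_apply, Submodule.mapQ_apply, Submodule.mkQ_apply, Submodule.Quotient.eq]
      simpa using hj
    · rintro ⟨a, ha⟩
      obtain ⟨a, rfl⟩ := Submodule.mkQ_surjective _ a
      rw [← ha, Submodule.mkQ_apply, Submodule.mapQ_apply]
      refine (Submodule.Quotient.mk_eq_zero _).2 ?_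
      exact Ideal.mem_sup_right (Ideal.mul_mem_left _ _ (Ideal.mem_span_singleton_self y))

variable {ι κ : Type*} [DecidableEq ι] [LinearOrder κ]

theorem sup_span_insert (J : Ideal A) (r : ι → A) (i : ι) (S : Finset ι) :
    J ⊔ Ideal.span (r '' (insert i S : Finset ι)) =
      (J ⊔ Ideal.span (r '' S)) ⊔ Ideal.span {r i} := by
  rw [Finset.coe_insert, Set.image_insert_eq, Ideal.span_insert, sup_comm (Ideal.span {r i}),
    sup_assoc]

theorem sum_colength_le (S : Finset ι) (key : ι → κ) (J : Ideal A) (r : ι → A) (c : ι → Ideal A)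
    (h : ∀ i ∈ S, ∀ a, a * r i ∈ J ⊔ Ideal.span (r '' {j | j ∈ S ∧ j ≠ i ∧ key i ≤ key j}) →
      a ∈ c i) :
    ∑ i ∈ S, colength (c i) + colength (J ⊔ Ideal.span (r '' S)) ≤ colength J := by
  induction S using Finset.induction_on_min_value key with
  | empty => simp
  | insert i S hi hmin ih =>
    rw [Finset.sum_insert hi, sup_span_insert]
    have h1 := colength_eq_sup_add_colon (J ⊔ Ideal.span (r '' S)) (r i)
    have h2 : colength (c i) ≤ colength (colonElem (J ⊔ Ideal.span (r '' S)) (r i)) := by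
      refine colength_anti fun a ha => h i (by simp) a ?_
      refine sup_le_sup_left (Ideal.span_mono (Set.image_mono ?_)) J (mem_colonElem.1 ha)
      intro j hj
      exact ⟨by simp [Finset.mem_coe.1 hj], fun h => hi (h ▸ hj), hmin j hj⟩
    have h3 := ih fun i' hi' a ha => by
      refine h i' (by simp [hi']) a
        (sup_le_sup_left (Ideal.span_mono (Set.image_mono ?_)) J ha)
      exact fun j hj => ⟨by simp [hj.1], hj.2⟩
    calc _ ≤ colength (colonElem (J ⊔ Ideal.span (r '' S)) (r i)) + ∑ i ∈ S, colength (c i)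
          + colength (J ⊔ Ideal.span (r '' S) ⊔ Ideal.span {r i}) := by gcongr
      _ = ∑ i ∈ S, colength (c i) + colength (J ⊔ Ideal.span (r '' S)) := by rw [h1]; ring
      _ ≤ _ := h3

theorem colength_le_sum (S : Finset ι) (key : ι → κ) (J : Ideal A) (r : ι → A) (c : ι → Ideal A)
    (h : ∀ i ∈ S, ∀ a ∈ c i, a * r i ∈ J ⊔ Ideal.span (r '' {j | j ∈ S ∧ key i < key j})) :
    colength J ≤ ∑ i ∈ S, colength (c i) + colength (J ⊔ Ideal.span (r '' S)) := by
  induction S using Finset.induction_on_min_value key with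
  | empty => simp
  | insert i S hi hmin ih =>
    rw [Finset.sum_insert hi, sup_span_insert]
    have h1 := colength_eq_sup_add_colon (J ⊔ Ideal.span (r '' S)) (r i)
    have h2 : colength (colonElem (J ⊔ Ideal.span (r '' S)) (r i)) ≤ colength (c i) := by
      refine colength_anti fun a ha => mem_colonElem.2 ?_
      refine sup_le_sup_left (Ideal.span_mono (Set.image_mono ?_)) J (h i (by simp) a ha)
      rintro j ⟨hj, hlt⟩
      rcases Finset.mem_insert.1 hj with rfl | hj
      · exact absurd hlt (lt_irrefl _)
      · exact hj
    have h3 := ih fun i' hi' a ha => by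
      refine sup_le_sup_left (Ideal.span_mono (Set.image_mono ?_)) J (h i' (by simp [hi']) a ha)
      rintro j ⟨hj, hlt⟩
      rcases Finset.mem_insert.1 hj with rfl | hj
      · exact absurd (hlt.trans_le (hmin i' hi')) (lt_irrefl _)
      · exact ⟨hj, hlt⟩
    calc _ ≤ _ := h3
      _ = ∑ i ∈ S, colength (c i) + (colength (J ⊔ Ideal.span (r '' S) ⊔ Ideal.span {r i}) +
          colength (colonElem (J ⊔ Ideal.span (r '' S)) (r i))) := by rw [h1]
      _ ≤ ∑ i ∈ S, colength (c i) + (colength (J ⊔ Ideal.span (r '' S) ⊔ Ideal.span {r i}) +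
          colength (c i)) := by gcongr
      _ = _ := by ring

end Lengths

section Weights

variable {A : Type*} [CommRing A] {d : ℕ}

/-- The monomial with exponent `μ` in the elements `x`. -/
def mon (x : Fin d → A) (μ : Fin d → ℕ) : A := ∏ i, x i ^ μ i

theorem mon_add (x : Fin d → A) (μ ν : Fin d → ℕ) : mon x (μ + ν) = mon x μ * mon x ν := by
  simp [mon, pow_add, Finset.prod_mul_distrib]

@[simp] theorem mon_zero (x : Fin d → A) : mon x 0 = 1 := by simp [mon]

theorem mon_single (x : Fin d → A) (i : Fin d) : mon x (Pi.single i 1) = x i := by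
  rw [mon, Finset.prod_eq_single i] <;> simp +contextual

theorem mon_smul (x : Fin d → A) (s : ℕ) (μ : Fin d → ℕ) : mon x (s • μ) = mon x μ ^ s := by
  simp [mon, ← Finset.prod_pow, pow_mul, mul_comm s]

/-- The weight of an exponent. -/
noncomputable def wt (lam : Fin d → ℝ) (μ : Fin d → ℕ) : ℝ := ∑ i, lam i * μ i

theorem wt_add (lam : Fin d → ℝ) (μ ν : Fin d → ℕ) : wt lam (μ + ν) = wt lam μ + wt lam ν := by
  simp [wt, mul_add, Finset.sum_add_distrib]

@[simp] theorem wt_zero (lam : Fin d → ℝ) : wt lam 0 = 0 := by simp [wt]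

theorem wt_smul (lam : Fin d → ℝ) (s : ℕ) (μ : Fin d → ℕ) : wt lam (s • μ) = s * wt lam μ := by
  simp only [wt, Finset.mul_sum, Pi.smul_apply, smul_eq_mul, Nat.cast_mul]
  exact Finset.sum_congr rfl fun i _ => by ring

theorem wt_single (lam : Fin d → ℝ) (i : Fin d) : wt lam (Pi.single i 1) = lam i := by
  rw [wt, Finset.sum_eq_single i] <;> simp +contextual

theorem wt_nonneg {lam : Fin d → ℝ} (h : ∀ i, 0 ≤ lam i) (μ : Fin d → ℕ) : 0 ≤ wt lam μ :=
  Finset.sum_nonneg fun i _ => mul_nonneg (h i) (Nat.cast_nonneg _)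

theorem sum_le_wt {lam : Fin d → ℝ} (h : ∀ i, 1 ≤ lam i) (μ : Fin d → ℕ) :
    ((∑ i, μ i : ℕ) : ℝ) ≤ wt lam μ := by
  push_cast
  refine Finset.sum_le_sum fun i _ => ?_
  nlinarith [h i, (Nat.cast_nonneg (μ i) : (0 : ℝ) ≤ μ i)]

theorem wt_le_mul_sum {lam : Fin d → ℝ} {L : ℝ} (h : ∀ i, lam i ≤ L) (μ : Fin d → ℕ) :
    wt lam μ ≤ L * (∑ i, μ i : ℕ) := by
  push_cast
  rw [Finset.mul_sum]
  exact Finset.sum_le_sum fun i _ => mul_le_mul_of_nonneg_right (h i) (Nat.cast_nonneg _)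

theorem le_wt {lam : Fin d → ℝ} (h : ∀ i, 1 ≤ lam i) (μ : Fin d → ℕ) (i : Fin d) :
    (μ i : ℝ) ≤ wt lam μ := by
  refine le_trans ?_ (sum_le_wt h μ)
  exact_mod_cast Finset.single_le_sum (f := μ) (fun _ _ => Nat.zero_le _) (Finset.mem_univ i)

/-- The weight is injective on integral exponents. -/
def WtIndep (lam : Fin d → ℝ) : Prop :=
  ∀ γ : Fin d → ℤ, ∑ i, lam i * (γ i : ℝ) = 0 → γ = 0

theorem WtIndep.injective {lam : Fin d → ℝ} (h : WtIndep lam) : Function.Injective (wt lam) := by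
  intro μ ν hμ
  have := h (fun i => (μ i : ℤ) - ν i) (by
    simp only [wt] at hμ
    push_cast
    simp only [mul_sub, Finset.sum_sub_distrib]
    linarith)
  funext i
  have := congrFun this i
  simp only [Pi.zero_apply] at this
  omega

/-- Exponents of weight less than `t`. -/
noncomputable def wtLT (lam : Fin d → ℝ) (t : ℝ) : Finset (Fin d → ℕ) :=
  (Fintype.piFinset fun _ => Finset.range ⌈t⌉₊).filter fun μ => wt lam μ < t

theorem mem_wtLT {lam : Fin d → ℝ} (h : ∀ i, 1 ≤ lam i) {t : ℝ} {μ : Fin d → ℕ} :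
    μ ∈ wtLT lam t ↔ wt lam μ < t := by
  simp only [wtLT, Finset.mem_filter, Fintype.mem_piFinset, Finset.mem_range, and_iff_right_iff_imp]
  intro ht i
  exact Nat.lt_ceil.2 ((le_wt h μ i).trans_lt ht)

theorem card_sum_le (d n : ℕ) (S : Finset (Fin d → ℕ)) (hS : ∀ μ, μ ∈ S ↔ ∑ i, μ i ≤ n) :
    S.card = (n + d).choose d := by
  have h1 := Finset.card_finsuppAntidiag_nat_eq_choose (s := (Finset.univ : Finset (Fin (d + 1)))) n
  rw [Finset.card_univ, Fintype.card_fin] at h1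
  have h2 : d + 1 + n - 1 = n + d := by omega
  rw [h2, Nat.choose_symm_add] at h1
  rw [← h1]
  refine Finset.card_bij (fun μ _ => Finsupp.equivFunOnFinite.symm
    (Fin.cons (n - ∑ i, μ i) μ : Fin (d + 1) → ℕ)) ?_ ?_ ?_
  · intro μ hμ
    have := (hS μ).1 hμ
    simp [Finset.mem_finsuppAntidiag, Fin.sum_univ_succ]
    omega
  · intro μ _ ν _ h
    have := Finsupp.equivFunOnFinite.symm.injective h
    exact (Fin.cons_injective2 this).2
  · intro f hf
    simp only [Finset.mem_finsuppAntidiag] at hf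
    have h3 := hf.1
    rw [Fin.sum_univ_succ] at h3
    refine ⟨fun i => f i.succ, (hS _).2 (by omega), ?_⟩
    ext i
    refine Fin.cases ?_ ?_ i
    · simp; omega
    · intro j; simp

theorem pow_le_factorial_mul_choose (d n : ℕ) : (n + 1) ^ d ≤ d.factorial * (n + d).choose d := by
  rw [← Nat.ascFactorial_eq_factorial_mul_choose]
  exact Nat.pow_succ_le_ascFactorial (n + 1) d

theorem card_wtLT_le {lam : Fin d → ℝ} (h : ∀ i, 1 ≤ lam i) (n : ℕ) :
    (wtLT lam n).card ≤ (n + d - 1).choose d := by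
  rcases n with _ | n
  · have : wtLT lam ((0 : ℕ) : ℝ) = ∅ := by
      ext μ
      rw [mem_wtLT h]
      have := wt_nonneg (fun i => zero_le_one.trans (h i)) μ
      simp
      exact this
    rw [this]; simp
  · let S : Finset (Fin d → ℕ) := (Fintype.piFinset fun _ => Finset.range (n + 1)).filter
      fun μ => ∑ i, μ i ≤ n
    have hS : ∀ μ, μ ∈ S ↔ ∑ i, μ i ≤ n := by
      intro μ
      simp only [S, Finset.mem_filter, Fintype.mem_piFinset, Finset.mem_range,
        and_iff_right_iff_imp]
      intro hμ i
      have := Finset.single_le_sum (f := μ) (fun _ _ => Nat.zero_le _) (Finset.mem_univ i)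
      omega
    have := card_sum_le d n S hS
    rw [show n + 1 + d - 1 = n + d by omega, ← this]
    refine Finset.card_le_card fun μ hμ => ?_
    rw [mem_wtLT h] at hμ
    rw [hS]
    have h2 := (sum_le_wt h μ).trans_lt hμ
    have : ∑ i, μ i < n + 1 := by exact_mod_cast h2
    omega

theorem le_card_wtLT {lam : Fin d → ℝ} (h : ∀ i, 1 ≤ lam i) {L : ℝ} (hL : 0 < L)
    (hlam : ∀ i, lam i ≤ L) {t : ℝ} (ht : 0 < t) :
    (t / L) ^ d ≤ d.factorial * (wtLT lam t).card := by
  have hpos : 0 < t / L := div_pos ht hL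
  have hc : 0 < ⌈t / L⌉₊ := Nat.ceil_pos.2 hpos
  obtain ⟨n, hn⟩ : ∃ n, ⌈t / L⌉₊ = n + 1 := ⟨_, (Nat.succ_pred_eq_of_pos hc).symm⟩
  let S : Finset (Fin d → ℕ) := (Fintype.piFinset fun _ => Finset.range (n + 1)).filter
    fun μ => ∑ i, μ i ≤ n
  have hS : ∀ μ, μ ∈ S ↔ ∑ i, μ i ≤ n := by
    intro μ
    simp only [S, Finset.mem_filter, Fintype.mem_piFinset, Finset.mem_range,
      and_iff_right_iff_imp]
    intro hμ i
    have := Finset.single_le_sum (f := μ) (fun _ _ => Nat.zero_le _) (Finset.mem_univ i)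
    omega
  have h1 := card_sum_le d n S hS
  have h2 := pow_le_factorial_mul_choose d n
  rw [← h1] at h2
  have h3 : S.card ≤ (wtLT lam t).card := by
    refine Finset.card_le_card fun μ hμ => ?_
    rw [hS] at hμ
    rw [mem_wtLT h]
    have h4 : ((∑ i, μ i : ℕ) : ℝ) < t / L := Nat.lt_ceil.1 (by omega)
    calc wt lam μ ≤ L * (∑ i, μ i : ℕ) := wt_le_mul_sum hlam μ
      _ < L * (t / L) := by gcongr
      _ = t := by field_simp
  calc (t / L) ^ d ≤ ((n + 1 : ℕ) : ℝ) ^ d := by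
        gcongr
        rw [← hn]
        exact Nat.le_ceil _
    _ ≤ ((d.factorial * S.card : ℕ) : ℝ) := by exact_mod_cast h2
    _ ≤ ((d.factorial * (wtLT lam t).card : ℕ) : ℝ) := by
        exact_mod_cast Nat.mul_le_mul_left _ h3
    _ = _ := by push_cast; ring

theorem card_pi_ite (i : Fin d) (a b : ℕ) :
    (Fintype.piFinset fun j => Finset.range (if j = i then a else b)).card = a * b ^ (d - 1) := by
  classical
  rw [Fintype.card_piFinset]
  simp only [Finset.card_range]
  rw [← Finset.mul_prod_erase _ _ (Finset.mem_univ i)]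
  simp only [if_true]
  congr 1
  rw [Finset.prod_congr rfl (g := fun _ => b)]
  · simp [Finset.card_erase_of_mem]
  · intro j hj
    rw [if_neg (Finset.ne_of_mem_erase hj)]

open Classical in
theorem card_wtLT_not_le {lam : Fin d → ℝ} (h : ∀ i, 1 ≤ lam i) (μ₀ : Fin d → ℕ) (n : ℕ) :
    ((wtLT lam n).filter fun μ => ¬ μ₀ ≤ μ).card ≤ (∑ i, μ₀ i) * n ^ (d - 1) := by
  classical
  calc _ ≤ (Finset.univ.biUnion fun i => Fintype.piFinset fun j =>
        Finset.range (if j = i then μ₀ i else n)).card := by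
        refine Finset.card_le_card fun μ hμ => ?_
        rw [Finset.mem_filter, mem_wtLT h, Pi.le_def, not_forall] at hμ
        obtain ⟨h1, i, hi⟩ := hμ
        simp only [Finset.mem_biUnion, Finset.mem_univ, true_and, Fintype.mem_piFinset,
          Finset.mem_range]
        refine ⟨i, fun j => ?_⟩
        split_ifs with hj
        · subst hj; omega
        · exact_mod_cast (le_wt h μ j).trans_lt h1
    _ ≤ ∑ i, (Fintype.piFinset fun j => Finset.range (if j = i then μ₀ i else n)).card :=
        Finset.card_biUnion_le
    _ = _ := by
        rw [Finset.sum_mul]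
        exact Finset.sum_congr rfl fun i _ => card_pi_ite i _ _

end Weights

theorem exists_sum_of_mem_span_image {A ι : Type*} [CommRing A] {r : ι → A} {S : Finset ι}
    {y : A} (hy : y ∈ Ideal.span (r '' S)) : ∃ b : ι → A, ∑ j ∈ S, b j * r j = y := by
  classical
  obtain ⟨b, rfl⟩ := (Submodule.mem_span_image_finset_iff_exists_fun A).1 hy
  refine ⟨fun j => if h : j ∈ S then b ⟨j, h⟩ else 0, ?_⟩
  rw [← Finset.sum_coe_sort]
  exact Finset.sum_congr rfl fun j _ => by simp

/-- A multiplicative decreasing filtration by ideals indexed by the real numbers. -/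
structure MulFilt (A : Type*) [CommRing A] where
  /-- The ideals of the filtration. -/
  toFun : ℝ → Ideal A
  anti : Antitone toFun
  mul : ∀ {s t : ℝ} {a b : A}, a ∈ toFun s → b ∈ toFun t → a * b ∈ toFun (s + t)
  top : ∀ {t : ℝ}, t ≤ 0 → toFun t = ⊤

namespace MulFilt

variable {A : Type*} [CommRing A] {d : ℕ}

instance : CoeFun (MulFilt A) fun _ => ℝ → Ideal A := ⟨toFun⟩

theorem mem_of_nonpos (G : MulFilt A) {t : ℝ} (ht : t ≤ 0) (a : A) : a ∈ G t := by
  rw [G.top ht]; trivial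

theorem mem_of_le (G : MulFilt A) {s t : ℝ} (h : s ≤ t) {a : A} (ha : a ∈ G t) : a ∈ G s :=
  G.anti h ha

theorem pow_mem (G : MulFilt A) {t : ℝ} {a : A} (ha : a ∈ G t) (s : ℕ) : a ^ s ∈ G (s * t) := by
  induction s with
  | zero => exact G.mem_of_nonpos (by simp) _
  | succ s ih =>
    rw [pow_succ]
    convert G.mul ih ha using 2
    push_cast; ring

/-- The elements of value greater than `t`. -/
def gt (G : MulFilt A) (t : ℝ) : Ideal A where
  carrier := {f | ∃ t' > t, f ∈ G t'}
  zero_mem' := ⟨t + 1, by simp, zero_mem _⟩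
  add_mem' := by
    rintro a b ⟨s, hs, ha⟩ ⟨s', hs', hb⟩
    exact ⟨min s s', lt_min hs hs', add_mem (G.mem_of_le (min_le_left _ _) ha)
      (G.mem_of_le (min_le_right _ _) hb)⟩
  smul_mem' := by
    rintro c a ⟨s, hs, ha⟩
    exact ⟨s, hs, Ideal.mul_mem_left _ _ ha⟩

theorem le_gt (G : MulFilt A) {s t : ℝ} (h : s < t) : G t ≤ G.gt s := fun _ hf => ⟨t, h, hf⟩

theorem mul_mem_gt (G : MulFilt A) {s t : ℝ} {a b : A} (ha : a ∈ G s) (hb : b ∈ G.gt t) :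
    a * b ∈ G.gt (s + t) := by
  obtain ⟨t', ht, hb⟩ := hb
  exact ⟨s + t', by linarith, G.mul ha hb⟩

theorem gt_mul_mem (G : MulFilt A) {s t : ℝ} {a b : A} (ha : a ∈ G.gt s) (hb : b ∈ G t) :
    a * b ∈ G.gt (s + t) := by
  obtain ⟨t', ht, ha⟩ := ha
  exact ⟨t' + t, by linarith, G.mul ha hb⟩

/-- Left continuity of a filtration. -/
def LeftCont (G : MulFilt A) : Prop := ∀ (t : ℝ) (f : A), (∀ t' < t, f ∈ G t') → f ∈ G t

/-- The element `f` has value `τ`. -/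
def IsVal (G : MulFilt A) (f : A) (τ : ℝ) : Prop := f ∈ G τ ∧ f ∉ G.gt τ

theorem IsVal.le {G : MulFilt A} {f : A} {τ t : ℝ} (h : G.IsVal f τ) (ht : f ∈ G t) : t ≤ τ := by
  by_contra hlt
  exact h.2 ⟨t, not_le.1 hlt, ht⟩

theorem IsVal.nonneg {G : MulFilt A} {f : A} {τ : ℝ} (h : G.IsVal f τ) : 0 ≤ τ :=
  h.le (G.mem_of_nonpos le_rfl f)

theorem LeftCont.exists_isVal {G : MulFilt A} (hG : G.LeftCont) {f : A} {T : ℝ} (hf : f ∉ G T) :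
    ∃ τ < T, G.IsVal f τ := by
  have hbdd : BddAbove {t | f ∈ G t} := ⟨T, fun t ht => by
    by_contra hlt
    exact hf (G.mem_of_le (not_le.1 hlt).le ht)⟩
  have hmem : f ∈ G (sSup {t | f ∈ G t}) := by
    refine hG _ _ fun t' ht' => ?_
    obtain ⟨s, hs, hlt⟩ := exists_lt_of_lt_csSup ⟨0, G.mem_of_nonpos le_rfl f⟩ ht'
    exact G.mem_of_le hlt.le hs
  refine ⟨sSup {t | f ∈ G t}, ?_, hmem, ?_⟩
  · by_contra hlt
    exact hf (G.mem_of_le (not_lt.1 hlt) hmem)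
  · rintro ⟨t, ht, hft⟩
    exact absurd (le_csSup hbdd hft) (not_le.2 ht)

theorem sum_colength_le_of_gt {ι : Type*} [DecidableEq ι] (G : MulFilt A) (S : Finset ι)
    (r : ι → A) (t : ι → ℝ) (p : ι → ℕ) (c : ι → Ideal A) (n : ℝ) (hn : ∀ i ∈ S, t i < n)
    (hr : ∀ i ∈ S, r i ∈ G (t i))
    (h : ∀ i ∈ S, ∀ b : ι → A,
      ∑ j ∈ S with t j = t i ∧ p i ≤ p j, b j * r j ∈ G.gt (t i) → b i ∈ c i) :
    ∑ i ∈ S, colength (c i) ≤ colength (G n) := by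
  refine le_trans le_self_add (sum_colength_le S (fun i => toLex (t i, p i)) (G n) r c
    fun i hi a ha => ?_)
  obtain ⟨g, hg, y, hy, hay⟩ := Submodule.mem_sup.1 ha
  have hset : {j | j ∈ S ∧ j ≠ i ∧ toLex (t i, p i) ≤ toLex (t j, p j)} =
      ((S.filter fun j => j ≠ i ∧ toLex (t i, p i) ≤ toLex (t j, p j) : Finset ι) : Set ι) := by
    ext j; simp
  rw [hset] at hy
  obtain ⟨b, rfl⟩ := exists_sum_of_mem_span_image hy
  have := h i hi (fun j => if j = i then a else - b j) ?_
  · simpa using this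
  have e1 : S.filter (fun j => t j = t i ∧ p i ≤ p j) =
      insert i (S.filter fun j => j ≠ i ∧ t j = t i ∧ p i ≤ p j) := by
    ext j
    by_cases hj : j = i <;> simp [hj, hi]
  have e2 : S.filter (fun j => j ≠ i ∧ toLex (t i, p i) ≤ toLex (t j, p j)) =
      (S.filter fun j => j ≠ i ∧ t j = t i ∧ p i ≤ p j) ∪ (S.filter fun j => t i < t j) := by
    ext j
    simp only [Finset.mem_filter, Finset.mem_union, Prod.Lex.toLex_le_toLex]
    constructor
    · rintro ⟨h1, h2, h3 | h3⟩
      · exact Or.inr ⟨h1, h3⟩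
      · exact Or.inl ⟨h1, h2, h3.1.symm, h3.2⟩
    · rintro (⟨h1, h2, h3⟩ | ⟨h1, h3⟩)
      · exact ⟨h1, h2, Or.inr ⟨h3.1.symm, h3.2⟩⟩
      · exact ⟨h1, fun h => by subst h; exact lt_irrefl _ h3, Or.inl h3⟩
  have hdisj : Disjoint (S.filter fun j => j ≠ i ∧ t j = t i ∧ p i ≤ p j)
      (S.filter fun j => t i < t j) := by
    rw [Finset.disjoint_filter]
    rintro j _ ⟨_, h1, _⟩ h2
    exact h2.ne' h1
  rw [e2, Finset.sum_union hdisj] at hay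
  have e3 : ∑ j ∈ S with j ≠ i ∧ t j = t i ∧ p i ≤ p j, (if j = i then a else - b j) * r j =
      ∑ j ∈ S with j ≠ i ∧ t j = t i ∧ p i ≤ p j, -(b j * r j) := by
    refine Finset.sum_congr rfl fun j hj => ?_
    rw [Finset.mem_filter] at hj
    simp [hj.2.1]
  rw [e1, Finset.sum_insert (by simp), if_pos rfl, ← hay, e3, Finset.sum_neg_distrib]
  have : g + (∑ j ∈ S with j ≠ i ∧ t j = t i ∧ p i ≤ p j, b j * r j +
      ∑ j ∈ S with t i < t j, b j * r j) +
      -∑ j ∈ S with j ≠ i ∧ t j = t i ∧ p i ≤ p j, b j * r j =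
      g + ∑ j ∈ S with t i < t j, b j * r j := by
    ring
  rw [this]
  refine add_mem (G.le_gt (hn i hi) hg) (Submodule.sum_mem _ fun j hj => ?_)
  rw [Finset.mem_filter] at hj
  exact Ideal.mul_mem_left _ _ (G.le_gt hj.2 (hr j hj.1))

/-- The filtration by monomials of given weight. -/
def monFilt (x : Fin d → A) (lam : Fin d → ℝ) : MulFilt A where
  toFun t := Ideal.span {y | ∃ μ, t ≤ wt lam μ ∧ y = mon x μ}
  anti := by
    intro s t hst
    refine Ideal.span_mono ?_
    rintro y ⟨μ, h, rfl⟩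
    exact ⟨μ, hst.trans h, rfl⟩
  mul := by
    intro s t a b ha hb
    have := Ideal.mul_mem_mul ha hb
    rw [Ideal.span_mul_span'] at this
    refine Ideal.span_mono ?_ this
    rintro _ ⟨_, ⟨μ, h, rfl⟩, _, ⟨ν, h', rfl⟩, rfl⟩
    exact ⟨μ + ν, by rw [wt_add]; linarith, (mon_add _ _ _).symm⟩
  top := by
    intro t ht
    rw [Ideal.eq_top_iff_one]
    exact Ideal.subset_span ⟨0, by simpa using ht, by simp⟩

theorem mon_mem_monFilt (x : Fin d → A) (lam : Fin d → ℝ) {μ : Fin d → ℕ} {t : ℝ}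
    (h : t ≤ wt lam μ) : mon x μ ∈ monFilt x lam t := Ideal.subset_span ⟨μ, h, rfl⟩

/-- The filtration by powers of an ideal. -/
noncomputable def powFilt (I : Ideal A) : MulFilt A where
  toFun t := I ^ ⌈t⌉₊
  anti := fun _ _ h => Ideal.pow_le_pow_right (Nat.ceil_mono h)
  mul := by
    intro s t a b ha hb
    have := Ideal.mul_mem_mul ha hb
    rw [← pow_add] at this
    exact Ideal.pow_le_pow_right (Nat.ceil_add_le _ _) this
  top := by
    intro t ht
    rw [Nat.ceil_eq_zero.2 ht, pow_zero, Ideal.one_eq_top]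

theorem powFilt_natCast (I : Ideal A) (n : ℕ) : powFilt I n = I ^ n := by
  simp [powFilt]

/-- The filtration of asymptotic integral closures. -/
def W (G : MulFilt A) : MulFilt A where
  toFun t :=
    { carrier := {f | ∀ t' < t, ∃ k : ℝ, ∀ s : ℕ, f ^ s ∈ G (s * t' - k)}
      zero_mem' := by
        intro t' _
        refine ⟨0, fun s => ?_⟩
        rcases s with _ | s
        · exact G.mem_of_nonpos (by simp) _
        · simp
      add_mem' := by
        intro f g hf hg t' ht'
        obtain ⟨k, hk⟩ := hf t' ht'
        obtain ⟨l, hl⟩ := hg t' ht'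
        refine ⟨k + l, fun s => ?_⟩
        rw [add_pow]
        refine Submodule.sum_mem _ fun i hi => Ideal.mul_mem_right _ _ ?_
        rw [Finset.mem_range] at hi
        convert G.mul (hk i) (hl (s - i)) using 2
        rw [Nat.cast_sub (by omega)]
        ring
      smul_mem' := by
        intro c f hf t' ht'
        obtain ⟨k, hk⟩ := hf t' ht'
        refine ⟨k, fun s => ?_⟩
        rw [smul_eq_mul, mul_pow]
        exact Ideal.mul_mem_left _ _ (hk s) }
  anti := fun _ _ hst _ hf t' ht' => hf t' (ht'.trans_le hst)
  mul := by
    intro s t a b ha hb u hu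
    obtain ⟨k, hk⟩ := ha (s - (s + t - u) / 2) (by linarith)
    obtain ⟨l, hl⟩ := hb (t - (s + t - u) / 2) (by linarith)
    refine ⟨k + l, fun n => ?_⟩
    rw [mul_pow]
    convert G.mul (hk n) (hl n) using 2
    ring
  top := by
    intro t ht
    rw [eq_top_iff]
    intro f _ t' ht'
    exact ⟨0, fun s => G.mem_of_nonpos (by nlinarith [(Nat.cast_nonneg s : (0 : ℝ) ≤ s)]) _⟩

theorem mem_W {G : MulFilt A} {t : ℝ} {f : A} :
    f ∈ G.W t ↔ ∀ t' < t, ∃ k : ℝ, ∀ s : ℕ, f ^ s ∈ G (s * t' - k) := Iff.rfl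

theorem W_leftCont (G : MulFilt A) : G.W.LeftCont := by
  intro t f h t' ht'
  obtain ⟨u, h1, h2⟩ := exists_between ht'
  exact h u h2 t' h1

theorem le_W (G : MulFilt A) (t : ℝ) : G t ≤ G.W t := by
  intro f hf t' ht'
  refine ⟨0, fun s => G.mem_of_le ?_ (G.pow_mem hf s)⟩
  rw [sub_zero]
  gcongr

theorem mem_W_of_pow_mem (G : MulFilt A) {t : ℝ} {f : A} {s : ℕ} (hs : 0 < s)
    (h : f ^ s ∈ G.W (s * t)) : f ∈ G.W t := by
  intro t' ht'
  have hs' : (0 : ℝ) < s := by exact_mod_cast hs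
  obtain ⟨k, hk⟩ := h (s * t') (by gcongr)
  refine ⟨k + s * |t'|, fun n => ?_⟩
  have hn : n = s * (n / s) + n % s := (Nat.div_add_mod n s).symm
  have hmod : n % s < s := Nat.mod_lt _ hs
  have h1 : f ^ n ∈ G ((n / s : ℕ) * (s * t') - k) := by
    have h0 : f ^ n = (f ^ s) ^ (n / s) * f ^ (n % s) := by rw [← pow_mul, ← pow_add, ← hn]
    rw [h0]
    exact Ideal.mul_mem_right _ _ (hk _)
  refine G.mem_of_le ?_ h1
  have h2 : (n : ℝ) = s * (n / s : ℕ) + (n % s : ℕ) := by exact_mod_cast hn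
  have h3 : ((n % s : ℕ) : ℝ) * t' ≤ s * |t'| := by
    have : ((n % s : ℕ) : ℝ) ≤ s := by exact_mod_cast hmod.le
    calc ((n % s : ℕ) : ℝ) * t' ≤ ((n % s : ℕ) : ℝ) * |t'| := by
          gcongr; exact le_abs_self _
      _ ≤ s * |t'| := by gcongr
  calc (n : ℝ) * t' - (k + s * |t'|) =
      (n / s : ℕ) * (s * t') - k + ((n % s : ℕ) * t' - s * |t'|) := by rw [h2]; ring
    _ ≤ _ := by linarith

theorem W_le_W {F G : MulFilt A} {c k₀ : ℝ} (hc : 0 < c) (h : ∀ t, F t ≤ G (c * t - k₀)) (t : ℝ) :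
    F.W t ≤ G.W (c * t) := by
  intro f hf u hu
  obtain ⟨k, hk⟩ := hf (u / c) (by rw [div_lt_iff₀ hc]; linarith)
  refine ⟨c * k + k₀, fun s => ?_⟩
  convert h _ (hk s) using 2
  field_simp
  ring

/-- Multiplication by monomials strictly shifts the filtration. -/
structure Good (G : MulFilt A) (x : Fin d → A) (lam : Fin d → ℝ) : Prop where
  leftCont : G.LeftCont
  mon_mem : ∀ μ, mon x μ ∈ G (wt lam μ)
  cancel : ∀ {μ : Fin d → ℕ} {f : A} {t : ℝ}, mon x μ * f ∈ G (wt lam μ + t) → f ∈ G t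

theorem Good.cancel_gt {G : MulFilt A} {x : Fin d → A} {lam : Fin d → ℝ} (h : G.Good x lam)
    {μ : Fin d → ℕ} {f : A} {t : ℝ} (hf : mon x μ * f ∈ G.gt (wt lam μ + t)) : f ∈ G.gt t := by
  obtain ⟨t', ht, hf⟩ := hf
  refine ⟨t' - wt lam μ, by linarith, h.cancel (μ := μ) ?_⟩
  convert hf using 2; ring

end MulFilt

namespace MulFilt

variable {A : Type*} [CommRing A] {d : ℕ}

/-- The left continuous closure of a filtration. -/
def lc (G : MulFilt A) : MulFilt A where
  toFun t :=
    { carrier := {f | ∀ t' < t, f ∈ G t'}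
      zero_mem' := fun _ _ => zero_mem _
      add_mem' := fun ha hb t' h => add_mem (ha t' h) (hb t' h)
      smul_mem' := fun c _ ha t' h => Ideal.mul_mem_left _ c (ha t' h) }
  anti := fun _ _ hst _ hf t' ht' => hf t' (ht'.trans_le hst)
  mul := by
    intro s t a b ha hb u hu
    have := G.mul (ha (s - (s + t - u) / 2) (by linarith)) (hb (t - (s + t - u) / 2) (by linarith))
    convert this using 2
    ring
  top := by
    intro t ht
    rw [eq_top_iff]
    intro f _ t' ht'
    exact G.mem_of_nonpos (by linarith) _

theorem le_lc (G : MulFilt A) (t : ℝ) : G t ≤ G.lc t := fun _ hf _ h => G.mem_of_le h.le hf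

theorem lc_leftCont (G : MulFilt A) : G.lc.LeftCont := by
  intro t f h t' ht'
  obtain ⟨u, h1, h2⟩ := exists_between ht'
  exact h u h2 t' h1

theorem lc_gt (G : MulFilt A) (t : ℝ) : G.lc.gt t ≤ G.gt t := by
  rintro f ⟨t', ht', hf⟩
  obtain ⟨u, h1, h2⟩ := exists_between ht'
  exact ⟨u, h1, hf u h2⟩

/-- The saturation of the monomial filtration with respect to monomials. -/
def satFilt (x : Fin d → A) (lam : Fin d → ℝ) : MulFilt A where
  toFun t :=
    { carrier := {f | ∃ μ, mon x μ * f ∈ monFilt x lam (wt lam μ + t)}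
      zero_mem' := ⟨0, by simp⟩
      add_mem' := by
        rintro a b ⟨μ, ha⟩ ⟨ν, hb⟩
        refine ⟨μ + ν, ?_⟩
        have h1 := (monFilt x lam).mul (mon_mem_monFilt x lam (le_refl (wt lam ν))) ha
        have h2 := (monFilt x lam).mul (mon_mem_monFilt x lam (le_refl (wt lam μ))) hb
        rw [mon_add, wt_add, mul_add]
        refine add_mem ?_ ?_
        · convert h1 using 1
          all_goals first | ring1 | (congr 1; ring1)
        · convert h2 using 1
          all_goals first | ring1 | (congr 1; ring1)
      smul_mem' := by
        rintro c a ⟨μ, ha⟩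
        refine ⟨μ, ?_⟩
        rw [smul_eq_mul, mul_left_comm]
        exact Ideal.mul_mem_left _ _ ha }
  anti := by
    rintro s t hst f ⟨μ, hf⟩
    exact ⟨μ, (monFilt x lam).mem_of_le (by linarith) hf⟩
  mul := by
    rintro s t a b ⟨μ, ha⟩ ⟨ν, hb⟩
    refine ⟨μ + ν, ?_⟩
    convert (monFilt x lam).mul ha hb using 1
    all_goals simp only [mon_add, wt_add]; first | ring1 | (congr 1; ring1)
  top := by
    intro t ht
    rw [eq_top_iff]
    intro f _
    exact ⟨0, (monFilt x lam).mem_of_nonpos (by simpa using ht) _⟩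

theorem monFilt_le_satFilt (x : Fin d → A) (lam : Fin d → ℝ) (t : ℝ) :
    monFilt x lam t ≤ satFilt x lam t := fun f hf => ⟨0, by simpa using hf⟩

theorem good_lc_satFilt (x : Fin d → A) (lam : Fin d → ℝ) : (satFilt x lam).lc.Good x lam where
  leftCont := lc_leftCont _
  mon_mem μ := le_lc _ _ (monFilt_le_satFilt _ _ _ (mon_mem_monFilt x lam le_rfl))
  cancel := by
    intro μ f t hf t' ht'
    obtain ⟨ν, hν⟩ := hf (wt lam μ + t') (by linarith)
    refine ⟨ν + μ, ?_⟩
    convert hν using 1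
    all_goals simp only [mon_add, wt_add]; first | ring1 | (congr 1; ring1)

theorem monFilt_le_lc (x : Fin d → A) (lam : Fin d → ℝ) (t : ℝ) :
    monFilt x lam t ≤ (satFilt x lam).lc t :=
  (monFilt_le_satFilt x lam t).trans (le_lc _ _)

theorem gt_mono {F G : MulFilt A} (h : ∀ t, F t ≤ G t) (t : ℝ) : F.gt t ≤ G.gt t :=
  fun _ ⟨t', ht, hf⟩ => ⟨t', ht, h _ hf⟩

theorem exists_mon_mul_mem_of_fg (x : Fin d → A) (lam : Fin d → ℝ) {t : ℝ} {J : Ideal A}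
    (hJ : J.FG) (h : J ≤ (satFilt x lam).gt t) :
    ∃ μ₀, ∀ ν, μ₀ ≤ ν → ∀ a ∈ J, mon x ν * a ∈ (monFilt x lam).gt (wt lam ν + t) := by
  obtain ⟨S, rfl⟩ := hJ
  suffices H : ∃ μ₀, ∀ a ∈ S, mon x μ₀ * a ∈ (monFilt x lam).gt (wt lam μ₀ + t) by
    obtain ⟨μ₀, hμ₀⟩ := H
    refine ⟨μ₀, fun ν hν a ha => ?_⟩
    obtain ⟨κ, rfl⟩ := le_iff_exists_add.1 hν
    have key : ∀ a ∈ Ideal.span (S : Set A),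
        mon x μ₀ * a ∈ (monFilt x lam).gt (wt lam μ₀ + t) := by
      intro a ha
      have : Ideal.span (S : Set A) ≤ colonElem ((monFilt x lam).gt (wt lam μ₀ + t)) (mon x μ₀) := by
        rw [Ideal.span_le]
        intro b hb
        rw [SetLike.mem_coe, mem_colonElem, mul_comm]
        exact hμ₀ b hb
      have := this ha
      rwa [mem_colonElem, mul_comm] at this
    have := (monFilt x lam).mul_mem_gt (mon_mem_monFilt x lam (le_refl (wt lam κ))) (key a ha)
    convert this using 1
    all_goals simp only [mon_add, wt_add]; first | ring1 | (congr 1; ring1)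
  have hS : ∀ a ∈ S, a ∈ (satFilt x lam).gt t := fun a ha => h (Ideal.subset_span ha)
  clear h
  classical
  induction S using Finset.induction_on with
  | empty => exact ⟨0, by simp⟩
  | insert a S _ ih =>
    obtain ⟨μ, hμ⟩ := ih fun b hb => hS b (Finset.mem_insert_of_mem hb)
    obtain ⟨t', ht', ν, hν⟩ := hS a (Finset.mem_insert_self _ _)
    refine ⟨μ + ν, fun b hb => ?_⟩
    rcases Finset.mem_insert.1 hb with rfl | hb
    · have := (monFilt x lam).mul (mon_mem_monFilt x lam (le_refl (wt lam μ))) hν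
      refine ⟨wt lam (μ + ν) + t', by linarith, ?_⟩
      convert this using 1
      all_goals simp only [mon_add, wt_add]; first | ring1 | (congr 1; ring1)
    · have := (monFilt x lam).mul_mem_gt (mon_mem_monFilt x lam (le_refl (wt lam ν))) (hμ b hb)
      convert this using 1
      all_goals simp only [mon_add, wt_add]; first | ring1 | (congr 1; ring1)

theorem monFilt_gt_le (x : Fin d → A) {lam : Fin d → ℝ} (h1 : ∀ i, 1 ≤ lam i) (t n : ℝ) :
    (monFilt x lam).gt t ≤ monFilt x lam n ⊔
      Ideal.span (mon x '' {ν | ν ∈ wtLT lam n ∧ t < wt lam ν}) := by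
  rintro f ⟨t', ht', hf⟩
  revert f
  change monFilt x lam t' ≤ _
  refine Ideal.span_le.2 ?_
  rintro _ ⟨μ, hμ, rfl⟩
  rcases lt_or_ge (wt lam μ) n with hn | hn
  · exact Ideal.mem_sup_right (Ideal.subset_span ⟨μ, ⟨(mem_wtLT h1).2 hn, ht'.trans_le hμ⟩, rfl⟩)
  · exact Ideal.mem_sup_left (mon_mem_monFilt x lam hn)

theorem span_range_mul_mon (x : Fin d → A) {lam : Fin d → ℝ} (h1 : ∀ i, 1 ≤ lam i)
    {a : A} (ha : a ∈ Ideal.span (Set.range x)) (ν : Fin d → ℕ) :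
    mon x ν * a ∈ (monFilt x lam).gt (wt lam ν) := by
  refine ⟨wt lam ν + 1, by linarith, (monFilt x lam).mul (mon_mem_monFilt x lam le_rfl) ?_⟩
  revert a
  change Ideal.span (Set.range x) ≤ _
  rw [Ideal.span_le]
  rintro _ ⟨i, rfl⟩
  rw [← mon_single x i]
  exact mon_mem_monFilt x lam (by rw [wt_single]; exact h1 i)

theorem exists_colength_monFilt_le [IsNoetherianRing A] (x : Fin d → A) {lam : Fin d → ℝ}
    (h1 : ∀ i, 1 ≤ lam i) (hQ : colength (Ideal.span (Set.range x)) ≠ ⊤) :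
    ∃ B : ℕ, ∀ n : ℕ, colength (monFilt x lam n) ≤
      (wtLT lam n).card * colength ((satFilt x lam).lc.gt 0) + (B * n ^ (d - 1) : ℕ) := by
  classical
  set a := (satFilt x lam).lc.gt 0 with ha
  obtain ⟨μ₀, hμ₀⟩ := exists_mon_mul_mem_of_fg x lam (t := 0) (J := a)
    (IsNoetherian.noetherian a) (lc_gt _ _)
  obtain ⟨q, hq⟩ := ENat.ne_top_iff_exists.1 hQ
  refine ⟨q * ∑ i, μ₀ i, fun n => ?_⟩
  rcases Nat.eq_zero_or_pos n with rfl | hn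
  · rw [(monFilt x lam).top (by simp), colength_top]; simp
  have := colength_le_sum (wtLT lam n) (wt lam) (monFilt x lam n) (mon x)
    (fun ν => if μ₀ ≤ ν then a else Ideal.span (Set.range x)) ?_
  · refine this.trans ?_
    have htop : monFilt x lam n ⊔ Ideal.span (mon x '' (wtLT lam n : Set (Fin d → ℕ))) = ⊤ := by
      rw [Ideal.eq_top_iff_one]
      refine Ideal.mem_sup_right (Ideal.subset_span ⟨0, ?_, by simp⟩)
      rw [Finset.mem_coe, mem_wtLT h1, wt_zero]
      exact_mod_cast hn
    rw [htop, colength_top, add_zero]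
    rw [← Finset.sum_filter_add_sum_filter_not (wtLT lam n) (fun ν => μ₀ ≤ ν)]
    refine add_le_add ?_ ?_
    · rw [Finset.sum_congr rfl fun ν hν => by rw [if_pos (Finset.mem_filter.1 hν).2],
        Finset.sum_const, nsmul_eq_mul]
      gcongr
      exact Finset.filter_subset _ _
    · rw [Finset.sum_congr rfl fun ν hν => by rw [if_neg (Finset.mem_filter.1 hν).2, ← hq],
        Finset.sum_const, nsmul_eq_mul]
      have := card_wtLT_not_le h1 μ₀ n
      have h2 := Nat.mul_le_mul_right q this
      calc _ = ((((wtLT lam n).filter fun μ => ¬ μ₀ ≤ μ).card * q : ℕ) : ℕ∞) := by push_cast; rfl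
        _ ≤ _ := by
          refine Nat.cast_le.2 (h2.trans (le_of_eq ?_))
          ring
  · intro ν hν b hb
    refine monFilt_gt_le x h1 _ _ ?_
    rw [mul_comm]
    split_ifs at hb with h
    · simpa using hμ₀ ν h b hb
    · exact span_range_mul_mon x h1 hb ν

theorem Good.card_mul_colength_le {G : MulFilt A} {x : Fin d → A} {lam : Fin d → ℝ}
    (hG : G.Good x lam) (h1 : ∀ i, 1 ≤ lam i) (hw : WtIndep lam) (n : ℝ) :
    (wtLT lam n).card * colength (G.gt 0) ≤ colength (G n) := by
  classical
  have := G.sum_colength_le_of_gt (wtLT lam n) (mon x) (wt lam) (fun _ => 0) (fun _ => G.gt 0) n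
    (fun i hi => (mem_wtLT h1).1 hi) (fun i _ => hG.mon_mem i) ?_
  · simpa using this
  · intro ν hν b hb
    have e : (wtLT lam n).filter (fun j => wt lam j = wt lam ν ∧ 0 ≤ 0) = {ν} := by
      ext j
      simp only [le_refl, and_true, Finset.mem_filter, Finset.mem_singleton]
      exact ⟨fun h => hw.injective h.2, fun h => by subst h; exact ⟨hν, rfl⟩⟩
    rw [e, Finset.sum_singleton, mul_comm] at hb
    exact hG.cancel_gt (by simpa using hb)

end MulFilt

/-- Complete Noetherian local rings satisfying growth conditions equivalent to being unmixed of
dimension `d`. -/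
structure ClassC (A : Type*) [CommRing A] [IsLocalRing A] (d : ℕ) : Prop where
  noeth : IsNoetherianRing A
  complete : IsAdicComplete (maximalIdeal A) A
  growth : ∃ B : ℕ, ∀ n : ℕ, colength (maximalIdeal A ^ n) ≤ (B * n ^ d : ℕ)
  unmixed : ∀ z : A, z ≠ 0 → ¬ ∃ B : ℕ, ∀ n : ℕ,
    colength (colonElem (maximalIdeal A ^ n) z) ≤ (B * n ^ (d - 1) : ℕ)

namespace MulFilt

variable {A : Type*} [CommRing A] [IsLocalRing A] {d : ℕ}

theorem mon_mem_pow {x : Fin d → A} {I : Ideal A} (hx : ∀ i, x i ∈ I) (μ : Fin d → ℕ) :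
    mon x μ ∈ I ^ (∑ i, μ i) := by
  rw [← Finset.prod_pow_eq_pow_sum]
  exact Ideal.prod_mem_prod fun i _ => Ideal.pow_mem_pow (hx i) _

theorem monFilt_le_pow {x : Fin d → A} {I : Ideal A} (hx : ∀ i, x i ∈ I) {lam : Fin d → ℝ}
    {L : ℝ} (hL : 0 < L) (h2 : ∀ i, lam i ≤ L) (n : ℕ) {t : ℝ} (ht : L * n ≤ t) :
    monFilt x lam t ≤ I ^ n := by
  refine Ideal.span_le.2 ?_
  rintro _ ⟨μ, hμ, rfl⟩
  refine Ideal.pow_le_pow_right ?_ (mon_mem_pow hx μ)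
  have := wt_le_mul_sum h2 μ
  have h3 : L * n ≤ L * ((∑ i, μ i : ℕ) : ℝ) := by linarith
  exact_mod_cast le_of_mul_le_mul_left h3 hL

variable {x : Fin d → A} {lam : Fin d → ℝ}

theorem colength_pow_ne_top (hA : ClassC A d) (n : ℕ) : colength (maximalIdeal A ^ n) ≠ ⊤ := by
  obtain ⟨B, hB⟩ := hA.growth
  exact ne_top_of_le_ne_top (ENat.natCast_ne_top _) (hB n)

theorem span_le_lc_gt (h1 : ∀ i, 1 ≤ lam i) :
    Ideal.span (Set.range x) ≤ (satFilt x lam).lc.gt 0 := by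
  intro a ha
  have := span_range_mul_mon x h1 ha 0
  rw [mon_zero, one_mul, wt_zero] at this
  exact gt_mono (monFilt_le_lc x lam) _ this

theorem eq_zero_of_forall_mem_lc (hA : ClassC A d) (hx : ∀ i, x i ∈ maximalIdeal A)
    (hQ : colength (Ideal.span (Set.range x)) ≠ ⊤) (h1 : ∀ i, 1 ≤ lam i) (h2 : ∀ i, lam i ≤ 2)
    (hw : WtIndep lam) {z : A} (hz : ∀ t, z ∈ (satFilt x lam).lc t) : z = 0 := by
  have := hA.noeth
  by_contra hz0
  obtain ⟨B, hB⟩ := exists_colength_monFilt_le x h1 hQ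
  refine hA.unmixed z hz0 ⟨B * 2 ^ (d - 1), fun n => ?_⟩
  have hle : monFilt x lam (2 * n : ℕ) ≤ maximalIdeal A ^ n :=
    monFilt_le_pow hx two_pos h2 n (by push_cast; rfl)
  have h3 : colonElem (monFilt x lam (2 * n : ℕ)) z ≤ colonElem (maximalIdeal A ^ n) z := by
    intro a ha
    rw [mem_colonElem] at ha ⊢
    exact hle ha
  refine (colength_anti h3).trans ?_
  have h4 := colength_eq_sup_add_colon (monFilt x lam (2 * n : ℕ)) z
  have h5 := (good_lc_satFilt x lam).card_mul_colength_le h1 hw (2 * n : ℕ)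
  have h6 : monFilt x lam (2 * n : ℕ) ⊔ Ideal.span {z} ≤ (satFilt x lam).lc (2 * n : ℕ) := by
    refine sup_le (monFilt_le_lc _ _ _) ?_
    rw [Ideal.span_singleton_le_iff_mem]
    exact hz _
  have h7 := h5.trans (colength_anti h6)
  have h8 := hB (2 * n)
  rw [h4] at h8
  have hfin : colength (monFilt x lam (2 * n : ℕ) ⊔ Ideal.span {z}) ≠ ⊤ := by
    obtain ⟨q, hq⟩ := ENat.ne_top_iff_exists.1 (ne_top_of_le_ne_top hQ
      (colength_anti (J := Ideal.span (Set.range x)) (K := (satFilt x lam).lc.gt 0) (span_le_lc_gt h1)))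
    · rw [← hq] at h8
      refine ne_top_of_le_ne_top ?_ (le_self_add.trans h8)
      exact_mod_cast ENat.natCast_ne_top (((wtLT lam (2 * n : ℕ)).card * q + B * (2 * n) ^ (d - 1)))
  have h9 : colength (monFilt x lam (2 * n : ℕ) ⊔ Ideal.span {z}) +
      colength (colonElem (monFilt x lam (2 * n : ℕ)) z) ≤
      colength (monFilt x lam (2 * n : ℕ) ⊔ Ideal.span {z}) + (B * (2 * n) ^ (d - 1) : ℕ) :=
    h8.trans (by gcongr)
  have h10 := (ENat.add_le_add_iff_left hfin).1 h9
  refine h10.trans (le_of_eq ?_)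
  congr 1
  rw [mul_pow]; ring

theorem exists_lattice_bound [IsNoetherianRing A]
    (hQ : colength (Ideal.span (Set.range x)) ≠ ⊤) (h1 : ∀ i, 1 ≤ lam i) (h2 : ∀ i, lam i ≤ 2)
    (hw : WtIndep lam) :
    ∃ K : ℕ, ∀ r τ, (satFilt x lam).lc.IsVal r τ → ∀ i : Fin d, ∃ μ : Fin d → ℕ, μ i ≤ K ∧
      ∃ ν β, wt lam ν = wt lam μ + τ ∧ mon x μ * r - β * mon x ν ∈
        (satFilt x lam).lc.gt (wt lam ν) := by
  classical
  obtain ⟨B, hB⟩ := exists_colength_monFilt_le x h1 hQ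
  set V := (satFilt x lam).lc with hV
  have hG : V.Good x lam := good_lc_satFilt x lam
  refine ⟨B * (2 * d + 1) ^ (d - 1), fun r τ hr i => ?_⟩
  set K := B * (2 * d + 1) ^ (d - 1) with hK
  by_contra! hcon
  set M := ⌈τ⌉₊ + 2 * K + 1 with hM
  set n := 2 * d * M + ⌈τ⌉₊ + 2 * K + 1 with hn
  set box : Finset (Fin d → ℕ) :=
    Fintype.piFinset fun j => Finset.range (if j = i then K + 1 else M) with hbox
  have hmem : ∀ μ ∈ box, μ i ≤ K := by
    intro μ hμ
    have := Fintype.mem_piFinset.1 hμ i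
    simp at this
    omega
  have hwt : ∀ μ ∈ box, wt lam μ + τ < n := by
    intro μ hμ
    have hs : ∑ j, μ j ≤ K + d * M := by
      calc ∑ j, μ j ≤ ∑ j : Fin d, ((if j = i then K else 0) + M) := by
            refine Finset.sum_le_sum fun j _ => ?_
            have := Fintype.mem_piFinset.1 hμ j
            rw [Finset.mem_range] at this
            split_ifs at this ⊢ <;> omega
        _ = K + d * M := by simp [Finset.sum_add_distrib]
    have h3 := wt_le_mul_sum h2 μ
    have h4 : ((∑ j, μ j : ℕ) : ℝ) ≤ K + d * M := by exact_mod_cast hs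
    have h5 := Nat.le_ceil τ
    rw [hn]; push_cast
    linarith
  have key := V.sum_colength_le_of_gt ((wtLT lam n).disjSum box)
    (Sum.elim (mon x) fun μ => mon x μ * r) (Sum.elim (wt lam) fun μ => wt lam μ + τ)
    (Sum.elim (fun _ => 1) fun _ => 0)
    (Sum.elim (fun _ => V.gt 0) fun _ => maximalIdeal A) n ?_ ?_ ?_
  · rw [Finset.sum_disjSum] at key
    simp only [Sum.elim_inl, Sum.elim_inr, Finset.sum_const, colength_maximal] at key
    have h3 := key.trans ((colength_anti (monFilt_le_lc x lam n)).trans (hB n))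
    rw [nsmul_eq_mul] at h3
    have hfin : (wtLT lam n).card * colength (V.gt 0) ≠ ⊤ := by
      obtain ⟨q, hq⟩ := ENat.ne_top_iff_exists.1 (ne_top_of_le_ne_top hQ
        (colength_anti (J := Ideal.span (Set.range x)) (K := V.gt 0) (span_le_lc_gt h1)))
      · rw [← hq]
        exact_mod_cast ENat.natCast_ne_top ((wtLT lam n).card * q)
    have h4 := (ENat.add_le_add_iff_left hfin).1 h3
    rw [hbox, card_pi_ite, nsmul_eq_mul, mul_one, Nat.cast_le] at h4
    have h5 : B * n ^ (d - 1) ≤ K * M ^ (d - 1) := by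
      rw [hK, mul_assoc, ← mul_pow]
      gcongr
      rw [hn, hM]; nlinarith
    have h6 : 0 < M ^ (d - 1) := by positivity
    nlinarith
  · rintro (ν | μ) h
    · exact (mem_wtLT h1).1 (Finset.inl_mem_disjSum.1 h)
    · exact hwt μ (Finset.inr_mem_disjSum.1 h)
  · rintro (ν | μ) h
    · exact hG.mon_mem ν
    · exact V.mul (hG.mon_mem μ) hr.1
  · rintro (ν | μ) h b hb
    · rw [Finset.sum_eq_single (Sum.inl ν)] at hb
      · simp only [Sum.elim_inl] at hb ⊢
        rw [mul_comm] at hb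
        exact hG.cancel_gt (by simpa using hb)
      · rintro (ν' | μ') h' hne
        · rw [Finset.mem_filter] at h'
          exact absurd (congrArg Sum.inl (hw.injective h'.2.1)) hne
        · exact absurd (Finset.mem_filter.1 h').2.2 (by simp)
      · intro h'
        exact absurd (Finset.mem_filter.2 ⟨h, rfl, le_rfl⟩) h'
    · rw [Sum.elim_inr, mem_maximalIdeal, mem_nonunits_iff]
      intro hu
      obtain ⟨c, hc⟩ := hu.exists_left_inv
      rw [Finset.sum_filter, Finset.sum_disjSum, Finset.sum_eq_single_of_mem (s := box) μ
        (Finset.inr_mem_disjSum.1 h) (by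
          intro μ' _ hne
          refine if_neg ?_
          rintro ⟨h, -⟩
          simp only [Sum.elim_inr] at h
          exact hne (hw.injective (by linarith))), if_pos ⟨rfl, le_rfl⟩,
        Finset.sum_congr rfl (g := fun ν => if wt lam ν = wt lam μ + τ then
          b (Sum.inl ν) * mon x ν else 0) (by
          intro ν _
          refine if_congr ?_ rfl rfl
          simp)] at hb
      change _ + b (Sum.inr μ) * (mon x μ * r) ∈ V.gt (wt lam μ + τ) at hb
      by_cases hex : ∃ ν ∈ wtLT lam n, wt lam ν = wt lam μ + τ
      · obtain ⟨ν, hν, hντ⟩ := hex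
        rw [Finset.sum_eq_single ν] at hb
        · rw [if_pos hντ] at hb
          refine hcon μ (hmem μ (Finset.inr_mem_disjSum.1 h)) ν (-(c * b (Sum.inl ν))) hντ ?_
          rw [hντ]
          have := Ideal.mul_mem_left _ c hb
          convert this using 1
          linear_combination (-mon x μ * r) * hc
        · intro ν' _ hne
          rw [if_neg]
          intro h
          exact hne (hw.injective (by linarith))
        · intro h'; exact absurd hν h'
      · rw [Finset.sum_eq_zero, zero_add] at hb
        · have := Ideal.mul_mem_left _ c hb
          rw [← mul_assoc, hc, one_mul] at this
          exact hr.2 (hG.cancel_gt this)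
        · intro ν hν
          rw [if_neg]
          intro h
          exact hex ⟨ν, hν, h⟩

end MulFilt

section Chevalley

variable {A : Type*} [CommRing A] [IsLocalRing A]

theorem mem_of_forall_mem_sup_pow [IsNoetherianRing A] {J : Ideal A} {z : A}
    (h : ∀ n : ℕ, z ∈ J ⊔ maximalIdeal A ^ n) : z ∈ J := by
  have h1 := Ideal.iInf_pow_smul_eq_bot_of_isLocalRing (M := A ⧸ J) (maximalIdeal A)
    (maximalIdeal.isMaximal A).ne_top
  rw [← Ideal.Quotient.eq_zero_iff_mem, ← Submodule.mem_bot A, ← h1, Submodule.mem_iInf]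
  intro n
  obtain ⟨a, ha, b, hb, rfl⟩ := Submodule.mem_sup.1 (h n)
  rw [map_add, Ideal.Quotient.eq_zero_iff_mem.2 ha, zero_add]
  have : Ideal.Quotient.mk J b = b • (1 : A ⧸ J) := by
    rw [Algebra.smul_def, mul_one]; rfl
  rw [this]
  exact Submodule.smul_mem_smul hb trivial

theorem exists_le_pow_of_iInf_eq_bot [IsNoetherianRing A] [IsAdicComplete (maximalIdeal A) A]
    (hfin : ∀ n, colength (maximalIdeal A ^ n) ≠ ⊤) (J : ℕ → Ideal A) (hJ : Antitone J)
    (h0 : ∀ z, (∀ n, z ∈ J n) → z = 0) (N : ℕ) : ∃ T, J T ≤ maximalIdeal A ^ N := by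
  have hst : ∀ n, ∃ T, ∀ T', T ≤ T' → J T ≤ J T' ⊔ maximalIdeal A ^ n := by
    intro n
    have := hfin n
    rw [colength, Module.length_ne_top_iff, isFiniteLength_iff_isNoetherian_isArtinian] at this
    have := this.2
    obtain ⟨T, hT⟩ := IsArtinian.monotone_stabilizes
      (⟨fun k => OrderDual.toDual (Submodule.map (Submodule.mkQ (maximalIdeal A ^ n)) (J k)),
        fun a b hab => Submodule.map_mono (hJ hab)⟩ :
        ℕ →o (Submodule A (A ⧸ (maximalIdeal A ^ n)))ᵒᵈ)
    refine ⟨T, fun T' h => ?_⟩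
    have h2 := congrArg (Submodule.comap (Submodule.mkQ (maximalIdeal A ^ n)))
      (congrArg OrderDual.ofDual (hT T' h))
    change Submodule.comap _ (Submodule.map _ (J T)) = Submodule.comap _ (Submodule.map _ (J T'))
      at h2
    rw [Submodule.comap_map_mkQ, Submodule.comap_map_mkQ] at h2
    rw [sup_comm, ← h2]
    exact le_sup_right
  choose T hT using hst
  by_contra! hcon
  set U : ℕ → ℕ := fun n => ∑ i ∈ Finset.range (n + 1), (T i + 1) with hU
  have hTU : ∀ n, T n + 1 ≤ U n := fun n =>
    Finset.single_le_sum (f := fun i => T i + 1) (fun _ _ => Nat.zero_le _) (Finset.self_mem_range_succ n)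
  have hUm : Monotone U := monotone_nat_of_le_succ fun n => by
    simp only [hU]; rw [Finset.sum_range_succ _ (n + 1)]; exact Nat.le_add_right _ _
  have hUn : ∀ n, n ≤ U n := fun n => by
    calc n ≤ ∑ i ∈ Finset.range (n + 1), 1 := by simp
      _ ≤ U n := Finset.sum_le_sum fun i _ => by omega
  have hstep : ∀ n a, a ∈ J (U n) → ∃ b ∈ J (U (n + 1)), a - b ∈ maximalIdeal A ^ n := by
    intro n a ha
    obtain ⟨b, hb, c, hc, rfl⟩ := Submodule.mem_sup.1
      (hT n (U (n + 1)) (by have := hTU n; have := hUm (Nat.le_add_right n 1); omega) (hJ (by have := hTU n; omega) ha))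
    exact ⟨b, hb, by simpa using hc⟩
  choose g hg hg' using hstep
  obtain ⟨z₀, hz₀, hz₀'⟩ := SetLike.not_le_iff_exists.1 (hcon (U N))
  let z : ∀ k : ℕ, {a // a ∈ J (U (N + k))} := fun k =>
    Nat.rec ⟨z₀, hz₀⟩ (fun k a => ⟨g (N + k) a.1 a.2, hg _ _ _⟩) k
  have hz : ∀ k, (z k).1 - (z (k + 1)).1 ∈ maximalIdeal A ^ (N + k) := fun k => hg' _ _ _
  have hzm : ∀ m n, m ≤ n → (z m).1 - (z n).1 ∈ maximalIdeal A ^ m := by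
    intro m n hmn
    induction n, hmn using Nat.le_induction with
    | base => simp
    | succ n hmn ih =>
      have := add_mem ih (Ideal.pow_le_pow_right (by omega) (hz n))
      simpa using this
  obtain ⟨L, hL⟩ := IsPrecomplete.prec (I := maximalIdeal A) (M := A) inferInstance
    (f := fun k => (z k).1) (fun {m n} hmn => by
      rw [SModEq.sub_mem, smul_eq_mul, Ideal.mul_top]
      exact hzm m n hmn)
  have hL' : ∀ n, (z n).1 - L ∈ maximalIdeal A ^ n := fun n => by
    have := hL n
    rwa [SModEq.sub_mem, smul_eq_mul, Ideal.mul_top] at this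
  have hL0 : L = 0 := by
    refine h0 L fun n => mem_of_forall_mem_sup_pow fun k => ?_
    have h1 : n + k ≤ U (N + (n + k)) := (Nat.le_add_left _ _).trans (hUn _)
    have h2 : L = (z (n + k)).1 - ((z (n + k)).1 - L) := by ring
    rw [h2]
    exact sub_mem (Ideal.mem_sup_left (hJ (by omega) (z (n + k)).2))
      (Ideal.mem_sup_right (Ideal.pow_le_pow_right (by omega) (hL' (n + k))))
  refine hz₀' ?_
  have h3 := hL' N
  rw [hL0, sub_zero] at h3
  have h4 : (z 0).1 - (z N).1 ∈ maximalIdeal A ^ N := by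
    have : ∀ k, (z 0).1 - (z k).1 ∈ maximalIdeal A ^ N := by
      intro k
      induction k with
      | zero => simp
      | succ k ih =>
        have := add_mem ih (Ideal.pow_le_pow_right (by omega) (hz k))
        simpa using this
    exact this N
  have := add_mem h4 h3
  rwa [sub_add_cancel] at this

end Chevalley

namespace MulFilt

variable {A : Type*} [CommRing A] {d : ℕ} {x : Fin d → A} {lam : Fin d → ℝ}

theorem exists_lattice_bound' [IsLocalRing A] (hd : 0 < d) [IsNoetherianRing A]
    (hQ : colength (Ideal.span (Set.range x)) ≠ ⊤) (h1 : ∀ i, 1 ≤ lam i) (h2 : ∀ i, lam i ≤ 2)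
    (hw : WtIndep lam) :
    ∃ ρ : Fin d → ℕ, ∀ r τ, (satFilt x lam).lc.IsVal r τ →
      ∃ δ β, wt lam δ = wt lam ρ + τ ∧
        mon x ρ * r - β * mon x δ ∈ (satFilt x lam).lc.gt (wt lam δ) := by
  obtain ⟨K, hK⟩ := exists_lattice_bound hQ h1 h2 hw
  refine ⟨fun _ => K, fun r τ hr => ?_⟩
  choose μ hμK ν β hν hmem using hK r τ hr
  have hγ : ∀ i j, (fun k => ((ν i k : ℤ) - μ i k)) = fun k => ((ν j k : ℤ) - μ j k) := by
    intro i j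
    have e : ν i + μ j = ν j + μ i := hw.injective (by
      rw [wt_add, wt_add, hν, hν]; ring)
    ext k
    have := congrFun e k
    simp only [Pi.add_apply] at this
    omega
  have i₀ : Fin d := ⟨0, hd⟩
  have hle : μ i₀ ≤ ν i₀ + fun _ => K := by
    intro k
    have h3 := congrFun (hγ i₀ k) k
    have h4 := hμK k
    simp only [Pi.add_apply] at h3 ⊢
    omega
  obtain ⟨δ, hδ⟩ := le_iff_exists_add.1 hle
  have hwδ : wt lam δ = wt lam (fun _ => K) + τ := by
    have := congrArg (wt lam) hδ
    rw [wt_add, wt_add, hν] at this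
    linarith
  refine ⟨δ, β i₀, hwδ, ?_⟩
  have hG := good_lc_satFilt x lam
  refine hG.cancel_gt (μ := μ i₀) ?_
  have h5 := (satFilt x lam).lc.mul_mem_gt (hG.mon_mem fun _ => K) (hmem i₀)
  convert h5 using 1
  · rw [hν, hwδ]; congr 1; ring
  · have h6 : mon x (ν i₀) * mon x (fun _ => K) = mon x (μ i₀) * mon x δ := by
      rw [← mon_add, ← mon_add, hδ]
    linear_combination (β i₀) * h6

/-- The ideal of leading coefficients in degree `δ`. -/
def leadIdeal (G : MulFilt A) (x : Fin d → A) (lam : Fin d → ℝ) (ρ δ : Fin d → ℕ) : Ideal A where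
  carrier := {β | ∃ r, mon x ρ * r - β * mon x δ ∈ G.gt (wt lam δ)}
  zero_mem' := ⟨0, by simp⟩
  add_mem' := by
    rintro a b ⟨r, hr⟩ ⟨s, hs⟩
    refine ⟨r + s, ?_⟩
    convert add_mem hr hs using 1
    ring
  smul_mem' := by
    rintro c a ⟨r, hr⟩
    refine ⟨c * r, ?_⟩
    convert Ideal.mul_mem_left _ c hr using 1
    rw [smul_eq_mul]; ring

theorem mem_leadIdeal {G : MulFilt A} {ρ δ : Fin d → ℕ} {β : A} :
    β ∈ leadIdeal G x lam ρ δ ↔ ∃ r, mon x ρ * r - β * mon x δ ∈ G.gt (wt lam δ) := Iff.rfl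

theorem leadIdeal_mono {G : MulFilt A} (hG : G.Good x lam) (ρ : Fin d → ℕ) :
    Monotone (leadIdeal G x lam ρ) := by
  intro δ δ' h β hβ
  obtain ⟨κ, rfl⟩ := le_iff_exists_add.1 h
  obtain ⟨r, hr⟩ := hβ
  refine ⟨mon x κ * r, ?_⟩
  convert G.mul_mem_gt (hG.mon_mem κ) hr using 1
  · rw [wt_add, add_comm]
  · rw [mon_add]; ring

theorem exists_stable_bound [IsNoetherianRing A] (f : (Fin d → ℕ) → Ideal A) (hf : Monotone f) :
    ∃ k : ℕ, ∀ δ, ∃ δ' ≤ δ, ∑ i, δ' i ≤ k ∧ f δ ≤ f δ' := by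
  by_contra! hcon
  choose s hs using hcon
  obtain ⟨g, hg⟩ := WellQuasiOrdered.exists_monotone_subseq (r := fun a b : Fin d → ℕ => a ≤ b)
    wellQuasiOrdered_le s
  obtain ⟨n, hn⟩ := monotone_stabilizes_iff_noetherian.2 ‹IsNoetherianRing A›
    ⟨fun k => f (s (g k)), fun a b hab => hf (hg a b hab)⟩
  set m := n + ∑ i, s (g n) i with hm
  have h1 : n ≤ m := Nat.le_add_right _ _
  have h2 : m ≤ g m := g.strictMono.id_le m
  refine hs (g m) (s (g n)) (hg n m h1) (by omega) ?_
  exact (hn m h1).ge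

theorem exists_approx [IsLocalRing A] (hd : 0 < d) [IsNoetherianRing A]
    (hQ : colength (Ideal.span (Set.range x)) ≠ ⊤) (h1 : ∀ i, 1 ≤ lam i) (h2 : ∀ i, lam i ≤ 2)
    (hw : WtIndep lam) :
    ∃ k₀ : ℝ, ∃ ρ : Fin d → ℕ, ∀ r τ, (satFilt x lam).lc.IsVal r τ →
      (∃ δ, wt lam δ = wt lam ρ + τ) ∧
      ∃ y ∈ monFilt x lam (τ - k₀), r - y ∈ (satFilt x lam).lc.gt τ := by
  obtain ⟨ρ, hρ⟩ := exists_lattice_bound' hd hQ h1 h2 hw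
  have hG := good_lc_satFilt x lam
  obtain ⟨k, hk⟩ := exists_stable_bound _ (leadIdeal_mono hG ρ)
  refine ⟨2 * k, ρ, fun r τ hr => ?_⟩
  obtain ⟨δ, β, hδ, hβ⟩ := hρ r τ hr
  refine ⟨⟨δ, hδ⟩, ?_⟩
  obtain ⟨δ', hle, hk', hlead⟩ := hk δ
  obtain ⟨κ, rfl⟩ := le_iff_exists_add.1 hle
  obtain ⟨r', hr'⟩ := mem_leadIdeal.1 (hlead (mem_leadIdeal.2 ⟨r, hβ⟩))
  refine ⟨mon x κ * r', Ideal.mul_mem_right _ _ (mon_mem_monFilt x lam ?_), ?_⟩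
  · have h3 := wt_le_mul_sum h2 δ'
    have h4 : ((∑ i, δ' i : ℕ) : ℝ) ≤ k := by exact_mod_cast hk'
    have h5 := wt_nonneg (fun i => zero_le_one.trans (h1 i)) ρ
    rw [wt_add] at hδ
    linarith
  · refine hG.cancel_gt (μ := ρ) ?_
    have h6 := (satFilt x lam).lc.mul_mem_gt (hG.mon_mem κ) hr'
    rw [add_comm, ← wt_add] at h6
    have h7 := sub_mem hβ h6
    rw [hδ] at h7
    convert h7 using 1
    rw [mon_add]; ring

theorem lc_le_sup [IsLocalRing A] (hd : 0 < d) [IsNoetherianRing A]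
    (hQ : colength (Ideal.span (Set.range x)) ≠ ⊤) (h1 : ∀ i, 1 ≤ lam i) (h2 : ∀ i, lam i ≤ 2)
    (hw : WtIndep lam) :
    ∃ k₀ : ℝ, ∀ t T, (satFilt x lam).lc t ≤ monFilt x lam (t - k₀) ⊔ (satFilt x lam).lc T := by
  classical
  obtain ⟨k₀, ρ, H⟩ := exists_approx hd hQ h1 h2 hw
  refine ⟨k₀, fun t T => ?_⟩
  set V := (satFilt x lam).lc with hV
  suffices key : ∀ N : ℕ, ∀ t, ∀ r ∈ V t,
      ((wtLT lam (T + wt lam ρ)).filter fun δ => t ≤ wt lam δ - wt lam ρ).card ≤ N →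
      r ∈ monFilt x lam (t - k₀) ⊔ V T from fun r hr => key _ t r hr le_rfl
  intro N
  induction N with
  | zero =>
    intro t r hr hN
    by_cases hrT : r ∈ V T
    · exact Ideal.mem_sup_right hrT
    · exfalso
      obtain ⟨τ, hτ, hval⟩ := (lc_leftCont _).exists_isVal hrT
      obtain ⟨⟨δ, hδ⟩, -⟩ := H r τ hval
      rw [Nat.le_zero, Finset.card_eq_zero] at hN
      have : δ ∈ (∅ : Finset (Fin d → ℕ)) := by
        rw [← hN, Finset.mem_filter, mem_wtLT h1]
        exact ⟨by linarith, by linarith [hval.le hr]⟩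
      simp at this
  | succ N ih =>
    intro t r hr hN
    by_cases hrT : r ∈ V T
    · exact Ideal.mem_sup_right hrT
    · obtain ⟨τ, hτ, hval⟩ := (lc_leftCont _).exists_isVal hrT
      obtain ⟨⟨δ, hδ⟩, y, hy, t', ht', hry⟩ := H r τ hval
      have htτ := hval.le hr
      have := ih t' (r - y) hry ?_
      · have h3 : monFilt x lam (t' - k₀) ⊔ V T ≤ monFilt x lam (t - k₀) ⊔ V T :=
          sup_le_sup_right ((monFilt x lam).anti (by linarith)) _
        have h4 := add_mem (h3 this) (Ideal.mem_sup_left ((monFilt x lam).anti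
          (show t - k₀ ≤ τ - k₀ by linarith) hy))
        simpa using h4
      · refine Nat.le_of_lt_succ (lt_of_lt_of_le (Finset.card_lt_card ?_) hN)
        refine (Finset.ssubset_iff_of_subset ?_).2 ⟨δ, ?_, ?_⟩
        · intro κ hκ
          rw [Finset.mem_filter] at hκ ⊢
          exact ⟨hκ.1, by linarith [hκ.2]⟩
        · rw [Finset.mem_filter, mem_wtLT h1]
          exact ⟨by linarith, by linarith⟩
        · rw [Finset.mem_filter]
          rintro ⟨-, h⟩
          linarith

theorem exists_lc_le [IsLocalRing A] (hA : ClassC A d) (hd : 0 < d)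
    (hx : ∀ i, x i ∈ maximalIdeal A)
    (hQ : colength (Ideal.span (Set.range x)) ≠ ⊤) (h1 : ∀ i, 1 ≤ lam i) (h2 : ∀ i, lam i ≤ 2)
    (hw : WtIndep lam) :
    ∃ k₀ : ℝ, ∀ t, (satFilt x lam).lc t ≤ monFilt x lam (t - k₀) := by
  have := hA.noeth
  have := hA.complete
  obtain ⟨k₀, hk₀⟩ := lc_le_sup hd hQ h1 h2 hw
  refine ⟨k₀, fun t r hr => mem_of_forall_mem_sup_pow fun n => ?_⟩
  obtain ⟨T, hT⟩ := exists_le_pow_of_iInf_eq_bot (colength_pow_ne_top hA)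
    (fun n : ℕ => (satFilt x lam).lc n) (fun a b hab => (satFilt x lam).lc.anti (by exact_mod_cast hab))
    (fun z hz => eq_zero_of_forall_mem_lc hA hx hQ h1 h2 hw fun t => by
      obtain ⟨n, hn⟩ := exists_nat_ge t
      exact (satFilt x lam).lc.mem_of_le hn (hz n)) n
  exact sup_le_sup_left hT _ (hk₀ t T hr)

theorem good_W_monFilt [IsLocalRing A] (hA : ClassC A d) (hd : 0 < d)
    (hx : ∀ i, x i ∈ maximalIdeal A)
    (hQ : colength (Ideal.span (Set.range x)) ≠ ⊤) (h1 : ∀ i, 1 ≤ lam i) (h2 : ∀ i, lam i ≤ 2)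
    (hw : WtIndep lam) : (monFilt x lam).W.Good x lam where
  leftCont := W_leftCont _
  mon_mem μ := le_W _ _ (mon_mem_monFilt x lam le_rfl)
  cancel := by
    obtain ⟨k₀, hk₀⟩ := exists_lc_le hA hd hx hQ h1 h2 hw
    intro μ f t hf t' ht'
    obtain ⟨k, hk⟩ := hf (wt lam μ + t') (by linarith)
    refine ⟨k + k₀, fun s => ?_⟩
    have h3 : f ^ s ∈ satFilt x lam (s * t' - k) := by
      refine ⟨s • μ, ?_⟩
      convert hk s using 1
      · rw [wt_smul]; congr 1; ring
      · rw [mon_smul, mul_pow]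
    convert hk₀ _ (le_lc _ _ h3) using 2
    ring

end MulFilt

section Lengths

variable {A : Type*} [CommRing A]

theorem eq_of_le_of_colength_le {J K : Ideal A} (h : J ≤ K) (hc : colength J ≤ colength K)
    (hJ : colength J ≠ ⊤) : J = K := by
  refine le_antisymm h fun y hy => ?_
  by_contra hyJ
  have h1 := colength_eq_sup_add_colon J y
  have h2 : colength K ≤ colength (J ⊔ Ideal.span {y}) :=
    colength_anti (sup_le h ((Ideal.span_singleton_le_iff_mem _).2 hy))
  have h3 : 1 ≤ colength (colonElem J y) := by
    refine one_le_colength fun htop => hyJ ?_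
    have : (1 : A) ∈ colonElem J y := by rw [htop]; trivial
    simpa [mem_colonElem] using this
  have h4 : colength J + 1 ≤ colength J :=
    calc colength J + 1 ≤ colength (J ⊔ Ideal.span {y}) + colength (colonElem J y) :=
          add_le_add (hc.trans h2) h3
      _ = colength J := h1.symm
  lift colength J to ℕ using hJ with k
  have : k + 1 ≤ k := by exact_mod_cast h4
  omega

theorem exists_stable_of_colength_ne_top {J : Ideal A} (hJ : colength J ≠ ⊤) (f : ℕ → Ideal A)
    (hf : Antitone f) (h : ∀ n, J ≤ f n) : ∃ N, ∀ n, f N ≤ f n := by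
  have hfin : ∀ n, colength (f n) ≠ ⊤ := fun n => ne_top_of_le_ne_top hJ (colength_anti (h n))
  choose L hL using fun n => ENat.ne_top_iff_exists.1 (hfin n)
  obtain ⟨c, hc⟩ := ENat.ne_top_iff_exists.1 hJ
  have hb : ∀ n, L n ≤ c := fun n => by
    have := colength_anti (h n)
    rw [← hL, ← hc] at this
    exact_mod_cast this
  obtain ⟨N, hN⟩ : ∃ N, ∀ n, L n ≤ L N := by
    obtain ⟨y, ⟨N, rfl⟩, hy⟩ := (Set.finite_iff_bddAbove.2 ⟨c, by rintro _ ⟨n, rfl⟩; exact hb n⟩ :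
      (Set.range L).Finite).exists_maximalFor id _ (Set.range_nonempty L)
    exact ⟨N, fun n => by
      by_contra hlt
      exact hlt (hy ⟨n, rfl⟩ (not_le.1 hlt).le)⟩
  refine ⟨N, fun n => ?_⟩
  rcases le_total n N with hn | hn
  · exact hf hn
  · refine (eq_of_le_of_colength_le (hf hn) ?_ (hfin n)).ge
    rw [← hL, ← hL]
    exact_mod_cast hN n

variable [IsLocalRing A]

theorem exists_maximalIdeal_pow_le [IsNoetherianRing A] {Q : Ideal A} (hQ : colength Q ≠ ⊤) :
    ∃ c : ℕ, maximalIdeal A ^ c ≤ Q := by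
  obtain ⟨N, hN⟩ := exists_stable_of_colength_ne_top hQ (fun n => Q ⊔ maximalIdeal A ^ n)
    (fun a b hab => sup_le_sup_left (Ideal.pow_le_pow_right hab) _) fun n => le_sup_left
  exact ⟨N, fun z hz => mem_of_forall_mem_sup_pow fun n => hN n (Ideal.mem_sup_right hz)⟩

theorem colength_le_add_of_relations {J' J : Ideal A} {q : ℕ}
    (hm : ∀ a ∈ maximalIdeal A, ∀ b ∈ J, a * b ∈ J')
    (h : ∀ g : Fin (q + 1) → A, (∀ k, g k ∈ J) →
      ∃ c : Fin (q + 1) → A, (∃ k, c k ∉ maximalIdeal A) ∧ ∑ k, c k * g k ∈ J') :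
    colength J' ≤ colength J + q := by
  induction q generalizing J' with
  | zero =>
    refine (colength_anti fun y hy => ?_).trans le_self_add
    obtain ⟨c, ⟨k, hk⟩, hc⟩ := h (fun _ => y) fun _ => hy
    obtain rfl : k = 0 := Fin.ext (by omega)
    have hu : IsUnit (c 0) := by simpa using hk
    simpa [Ideal.unit_mul_mem_iff_mem _ hu] using hc
  | succ q ih =>
    by_cases hJ : J ≤ J'
    · exact (colength_anti hJ).trans le_self_add
    obtain ⟨g, hg, hg'⟩ := SetLike.not_le_iff_exists.1 hJ
    have h1 := @ih (J' ⊔ Ideal.span {g}) (fun a ha b hb => Ideal.mem_sup_left (hm a ha b hb)) ?_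
    · have h2 : colength (colonElem J' g) ≤ 1 := by
        rw [← colength_maximal (maximalIdeal A)]
        exact colength_anti fun a ha => (mem_colonElem).2 (hm a ha g hg)
      calc colength J' = colength (J' ⊔ Ideal.span {g}) + colength (colonElem J' g) :=
            colength_eq_sup_add_colon J' g
        _ ≤ colength J + q + 1 := add_le_add h1 h2
        _ = _ := by push_cast; rw [add_assoc]
    · intro e he
      obtain ⟨c, ⟨k, hk⟩, hc⟩ := h (Fin.cons g e) (Fin.cases hg he)
      rw [Fin.sum_univ_succ] at hc
      simp only [Fin.cons_zero, Fin.cons_succ] at hc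
      refine ⟨fun k => c k.succ, ?_, ?_⟩
      · by_contra! hall
        refine hg' ?_
        have h3 : ∑ i : Fin (q + 1), c i.succ * e i ∈ J' :=
          Submodule.sum_mem _ fun i _ => hm _ (hall i) _ (he i)
        have h4 : c 0 * g ∈ J' := by simpa using sub_mem hc h3
        revert hk
        refine Fin.cases (fun hk => ?_) (fun i hk => absurd (hall i) hk) k
        have hu : IsUnit (c 0) := by simpa using hk
        rwa [Ideal.unit_mul_mem_iff_mem _ hu] at h4
      · have : ∑ i : Fin (q + 1), c i.succ * e i =
            (c 0 * g + ∑ i : Fin (q + 1), c i.succ * e i) - c 0 * g := by ring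
        rw [this]
        exact sub_mem (Ideal.mem_sup_left hc)
          (Ideal.mem_sup_right (Ideal.mul_mem_left _ _ (Ideal.mem_span_singleton_self g)))

end Lengths

namespace MulFilt

variable {A : Type*} [CommRing A] {d : ℕ} {x : Fin d → A} {lam : Fin d → ℝ}

/-- Independence of a family of elements of the filtration with respect to monomials. -/
def IndepFam [IsLocalRing A] (G : MulFilt A) (x : Fin d → A) (lam : Fin d → ℝ) {ι : Type*}
    [Fintype ι] (f : ι → A) (t : ι → ℝ) : Prop :=
  (∀ j, f j ∈ G (t j)) ∧ ∀ (a : ι → A) (μ : ι → Fin d → ℕ) (τ : ℝ),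
    (∀ j, a j ≠ 0 → wt lam (μ j) + t j = τ) →
    ∑ j, a j * (mon x (μ j) * f j) ∈ G.gt τ → ∀ j, a j ∈ maximalIdeal A

theorem IndepFam.sum_card_le [IsLocalRing A] {G : MulFilt A} (hG : G.Good x lam)
    (h1 : ∀ i, 1 ≤ lam i) (hw : WtIndep lam) {ι : Type*} [Fintype ι] {f : ι → A} {t : ι → ℝ}
    (h : G.IndepFam x lam f t) (n : ℝ) :
    ((∑ j, (wtLT lam (n - t j)).card : ℕ) : ℕ∞) ≤ colength (G n) := by
  classical
  have key := G.sum_colength_le_of_gt (Finset.univ.sigma fun j => wtLT lam (n - t j))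
    (fun k => mon x k.2 * f k.1) (fun k => wt lam k.2 + t k.1) (fun _ => 0)
    (fun _ => maximalIdeal A) n ?_ ?_ ?_
  · simpa [Finset.card_sigma, colength_maximal] using key
  · rintro ⟨j, μ⟩ hk
    simp only [Finset.mem_sigma, Finset.mem_univ, true_and] at hk
    have := (mem_wtLT h1).1 hk
    simp only
    linarith
  · rintro ⟨j, μ⟩ -
    exact G.mul (hG.mon_mem μ) (h.1 j)
  · rintro ⟨i, ν⟩ hi b hb
    set T := (Finset.univ.sigma fun j => wtLT lam (n - t j)).filter
      (fun k => wt lam k.2 + t k.1 = wt lam ν + t i ∧ 0 ≤ 0) with hT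
    have hiT : (⟨i, ν⟩ : Σ _ : ι, Fin d → ℕ) ∈ T := by simp [hT, hi]
    have hinj : ∀ k ∈ T, ∀ k' ∈ T, k.1 = k'.1 → k = k' := by
      rintro ⟨j, μ⟩ hk ⟨j', μ'⟩ hk' rfl
      simp only [hT, Finset.mem_filter] at hk hk'
      have : μ = μ' := hw.injective (by linarith [hk.2.1, hk'.2.1])
      rw [this]
    have hex : ∀ j, ∃ μ : Fin d → ℕ, ∀ k ∈ T, k.1 = j → k = ⟨j, μ⟩ := by
      intro j
      by_cases hj : ∃ k ∈ T, k.1 = j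
      · obtain ⟨⟨j, μ⟩, hk, rfl⟩ := hj
        exact ⟨μ, fun k' hk' he => hinj _ hk' _ hk he⟩
      · exact ⟨0, fun k hk he => absurd ⟨k, hk, he⟩ hj⟩
    choose M hM using hex
    have h3 := h.2 (fun j => if (⟨j, M j⟩ : Σ _ : ι, Fin d → ℕ) ∈ T then b ⟨j, M j⟩ else 0) M
      (wt lam ν + t i) ?_ ?_ i
    · rw [← hM i _ hiT rfl, if_pos hiT] at h3
      exact h3
    · intro j hj
      have : (⟨j, M j⟩ : Σ _ : ι, Fin d → ℕ) ∈ T := by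
        by_contra hn
        exact hj (if_neg hn)
      rw [hT, Finset.mem_filter] at this
      exact this.2.1
    · convert hb using 1
      rw [← Finset.sum_filter_add_sum_filter_not Finset.univ
        (fun j => (⟨j, M j⟩ : Σ _ : ι, Fin d → ℕ) ∈ T)]
      rw [Finset.sum_eq_zero (s := Finset.univ.filter
        fun j => ¬ (⟨j, M j⟩ : Σ _ : ι, Fin d → ℕ) ∈ T), add_zero]
      · refine Finset.sum_bij (fun j _ => ⟨j, M j⟩) ?_ ?_ ?_ ?_
        · intro j hj
          exact (Finset.mem_filter.1 hj).2
        · intro j _ j' _ he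
          exact congrArg Sigma.fst he
        · rintro k hk
          have := hM k.1 k hk rfl
          exact ⟨k.1, Finset.mem_filter.2 ⟨Finset.mem_univ _, this ▸ hk⟩, this.symm⟩
        · intro j hj
          rw [if_pos (Finset.mem_filter.1 hj).2]
      · intro j hj
        rw [if_neg (Finset.mem_filter.1 hj).2, zero_mul]

theorem span_range_le_monFilt (x : Fin d → A) (h1 : ∀ i, 1 ≤ lam i) :
    Ideal.span (Set.range x) ≤ monFilt x lam 1 := by
  rw [Ideal.span_le]
  rintro _ ⟨i, rfl⟩
  rw [← mon_single x i]
  exact mon_mem_monFilt x lam (by rw [wt_single]; exact h1 i)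

theorem span_range_pow_le_monFilt (x : Fin d → A) (h1 : ∀ i, 1 ≤ lam i) (n : ℕ) :
    Ideal.span (Set.range x) ^ n ≤ monFilt x lam n := by
  induction n with
  | zero => exact fun z _ => (monFilt x lam).mem_of_nonpos (by simp) z
  | succ n ih =>
    rw [pow_succ, Ideal.mul_le]
    intro r hr s hs
    convert (monFilt x lam).mul (ih hr) (span_range_le_monFilt x h1 hs) using 2
    push_cast; ring

theorem exists_colength_W_le [IsLocalRing A] (hA : ClassC A d)
    (hQ : colength (Ideal.span (Set.range x)) ≠ ⊤)
    (h1 : ∀ i, 1 ≤ lam i) : ∃ B : ℕ, ∀ n : ℕ, colength ((monFilt x lam).W n) ≤ (B * n ^ d : ℕ) := by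
  have := hA.noeth
  obtain ⟨B, hB⟩ := hA.growth
  obtain ⟨c, hc⟩ := exists_maximalIdeal_pow_le hQ
  refine ⟨B * c ^ d, fun n => ?_⟩
  have h5 : maximalIdeal A ^ (c * n) ≤ (monFilt x lam).W n := by
    rw [pow_mul]
    exact (Ideal.pow_right_mono hc n).trans ((span_range_pow_le_monFilt x h1 n).trans (le_W _ _))
  refine (colength_anti h5).trans ((hB _).trans ?_)
  rw [mul_pow, mul_assoc]

theorem wtLT_mono (h1 : ∀ i, 1 ≤ lam i) {s t : ℝ} (h : s ≤ t) : wtLT lam s ⊆ wtLT lam t :=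
  fun _ hμ => (mem_wtLT h1).2 (((mem_wtLT h1).1 hμ).trans_le h)

theorem IndepFam.card_bound [IsLocalRing A] {G : MulFilt A} (hG : G.Good x lam)
    (h1 : ∀ i, 1 ≤ lam i) (h2 : ∀ i, lam i ≤ 2) (hw : WtIndep lam) {B : ℕ}
    (hB : ∀ n : ℕ, colength (G n) ≤ (B * n ^ d : ℕ)) {ι : Type*} [Fintype ι] {f : ι → A}
    {t : ι → ℝ} (h : G.IndepFam x lam f t) : Fintype.card ι ≤ d.factorial * B * 4 ^ d := by
  obtain ⟨T, hT⟩ := exists_nat_ge (∑ j, |t j|)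
  set n : ℕ := 2 * (T + 1)
  have hj : ∀ j, (n : ℝ) / 2 ≤ n - t j := by
    intro j
    have e1 : |t j| ≤ ∑ j, |t j| :=
      Finset.single_le_sum (f := fun j => |t j|) (fun _ _ => abs_nonneg _) (Finset.mem_univ j)
    have e2 : (n : ℝ) = 2 * (T + 1) := by simp [n]
    have e3 := le_abs_self (t j)
    rw [e2]; linarith
  have hn : (0 : ℝ) < n := by simp [n]; positivity
  have e4 := (h.sum_card_le hG h1 hw n).trans (hB n)
  have e5 : ∑ j, (wtLT lam (n - t j)).card ≤ B * n ^ d := by exact_mod_cast e4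
  have e6 : Fintype.card ι * (wtLT lam (n / 2)).card ≤ B * n ^ d := by
    refine le_trans ?_ e5
    rw [← smul_eq_mul, ← Finset.card_univ, ← Finset.sum_const]
    exact Finset.sum_le_sum fun j _ => Finset.card_le_card (wtLT_mono h1 (hj j))
  have e7 := le_card_wtLT h1 (L := 2) two_pos h2 (t := (n : ℝ) / 2) (by positivity)
  have e8 : (Fintype.card ι : ℝ) * (wtLT lam (n / 2)).card ≤ B * n ^ d := by exact_mod_cast e6
  have e9 : (Fintype.card ι : ℝ) * ((n : ℝ) / 2 / 2) ^ d ≤ d.factorial * B * n ^ d := by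
    calc (Fintype.card ι : ℝ) * ((n : ℝ) / 2 / 2) ^ d
        ≤ Fintype.card ι * (d.factorial * (wtLT lam (n / 2)).card) := by gcongr
      _ = d.factorial * (Fintype.card ι * (wtLT lam (n / 2)).card) := by ring
      _ ≤ d.factorial * (B * n ^ d) := by gcongr
      _ = _ := by ring
  have e10 : ((n : ℝ) / 2 / 2) ^ d = n ^ d / 4 ^ d := by
    rw [div_div, div_pow]; norm_num
  rw [e10, mul_div_assoc', div_le_iff₀ (by positivity)] at e9
  have e11 : (Fintype.card ι : ℝ) ≤ d.factorial * B * 4 ^ d := by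
    refine le_of_mul_le_mul_right ?_ (pow_pos hn d)
    linarith
  exact_mod_cast e11

end MulFilt

namespace MulFilt

variable {A : Type*} [CommRing A] {d : ℕ} {x : Fin d → A} {lam : Fin d → ℝ}

theorem mem_W_gt_of_pow_mem (F : MulFilt A) {f : A} {τ : ℝ} {j : ℕ} (hj : 0 < j)
    (h : f ^ j ∈ F.W.gt (j * τ)) : f ∈ F.W.gt τ := by
  obtain ⟨u, hu, h⟩ := h
  have hj' : (0 : ℝ) < j := by exact_mod_cast hj
  refine ⟨u / j, ?_, mem_W_of_pow_mem _ hj ?_⟩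
  · rw [gt_iff_lt, lt_div_iff₀ hj']; linarith
  · convert h using 2; field_simp

theorem maximalIdeal_le_W_gt [IsLocalRing A] [IsNoetherianRing A]
    (hQ : colength (Ideal.span (Set.range x)) ≠ ⊤) (h1 : ∀ i, 1 ≤ lam i) :
    maximalIdeal A ≤ (monFilt x lam).W.gt 0 := by
  obtain ⟨c, hc⟩ := exists_maximalIdeal_pow_le hQ
  intro a ha
  refine mem_W_gt_of_pow_mem _ (Nat.succ_pos c) ⟨1, by simp, le_W _ _ ?_⟩
  exact span_range_le_monFilt x h1 (hc (Ideal.pow_le_pow_right (Nat.le_succ c)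
    (Ideal.pow_mem_pow ha _)))

theorem exists_relation_of_not_indepFam [IsLocalRing A] {G : MulFilt A}
    (hm : maximalIdeal A ≤ G.gt 0) (hG : G.Good x lam)
    {ι : Type*} [Fintype ι] {f : ι → A} {t : ι → ℝ} (hf : ∀ j, f j ∈ G (t j))
    (h : ¬ G.IndepFam x lam f t) :
    ∃ (U : Finset ι) (a : ι → A) (μ : ι → Fin d → ℕ) (τ : ℝ), U.Nonempty ∧
      (∀ j ∈ U, a j ∉ maximalIdeal A) ∧ (∀ j ∈ U, wt lam (μ j) + t j = τ) ∧
      ∑ j ∈ U, a j * (mon x (μ j) * f j) ∈ G.gt τ := by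
  classical
  simp only [IndepFam, not_and, not_forall] at h
  obtain ⟨a, μ, τ, h1, h2, j, hj⟩ := h hf
  refine ⟨Finset.univ.filter fun j => a j ∉ maximalIdeal A, a, μ, τ, ⟨j, by simpa using hj⟩,
    fun j hj => (Finset.mem_filter.1 hj).2, fun j hj => h1 j ?_, ?_⟩
  · rintro h0
    exact (Finset.mem_filter.1 hj).2 (h0 ▸ zero_mem _)
  · rw [← Finset.sum_filter_add_sum_filter_not Finset.univ
      (fun j => a j ∉ maximalIdeal A)] at h2
    refine (Submodule.add_mem_iff_left _ (Submodule.sum_mem _ fun j hj => ?_)).1 h2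
    have ha := not_not.1 (Finset.mem_filter.1 hj).2
    by_cases h0 : a j = 0
    · rw [h0, zero_mul]; exact zero_mem _
    · rw [← h1 j h0, ← zero_add (wt lam (μ j) + t j)]
      exact G.gt_mul_mem (hm ha) (G.mul (hG.mon_mem _) (hf j))

/-- Scale one coordinate of a weight. -/
noncomputable def scaleWt (lam : Fin d → ℝ) (i₀ : Fin d) (N : ℕ) : Fin d → ℝ :=
  fun i => if i = i₀ then (1 - 1 / N) * lam i else lam i

theorem wt_scaleWt (lam : Fin d → ℝ) (i₀ : Fin d) (N : ℕ) (μ : Fin d → ℕ) :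
    wt (scaleWt lam i₀ N) μ = wt lam μ - 1 / N * (lam i₀ * μ i₀) := by
  have : ∀ i, scaleWt lam i₀ N i * μ i =
      lam i * μ i - if i = i₀ then 1 / N * (lam i * μ i) else 0 := by
    intro i
    rw [scaleWt]
    split_ifs <;> ring
  simp only [wt, this, Finset.sum_sub_distrib, Finset.sum_ite_eq', Finset.mem_univ, if_true]

theorem wtIndep_scaleWt (hw : WtIndep lam) (i₀ : Fin d) {N : ℕ} (hN : 2 ≤ N) :
    WtIndep (scaleWt lam i₀ N) := by
  intro γ hγ
  have hN0 : (N : ℝ) ≠ 0 := by positivity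
  have h := hw (fun i => if i = i₀ then (N - 1) * γ i else N * γ i) ?_
  · funext i
    have := congrFun h i
    simp only [Pi.zero_apply] at this ⊢
    split_ifs at this
    · rcases mul_eq_zero.1 this with h | h
      · omega
      · exact h
    · rcases mul_eq_zero.1 this with h | h
      · omega
      · exact h
  · rw [← mul_zero (N : ℝ), ← hγ, Finset.mul_sum]
    refine Finset.sum_congr rfl fun i _ => ?_
    rw [scaleWt]
    split_ifs
    · push_cast; field_simp
    · push_cast; ring

theorem monFilt_le_monFilt (x : Fin d → A) {lam lam' : Fin d → ℝ} {t t' : ℝ}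
    (h : ∀ μ, t ≤ wt lam μ → t' ≤ wt lam' μ) : monFilt x lam t ≤ monFilt x lam' t' := by
  refine Ideal.span_le.2 ?_
  rintro _ ⟨μ, hμ, rfl⟩
  exact mon_mem_monFilt x _ (h μ hμ)

theorem exists_wt_eq_of_isVal [IsLocalRing A] (hA : ClassC A d) (hd : 0 < d)
    (hx : ∀ i, x i ∈ maximalIdeal A)
    (hQ : colength (Ideal.span (Set.range x)) ≠ ⊤) (h1 : ∀ i, 1 < lam i) (h2 : ∀ i, lam i ≤ 2)
    (hw : WtIndep lam) {f : A} {τ : ℝ} (hf : (monFilt x lam).W.IsVal f τ) :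
    ∃ b : ℕ, 0 < b ∧ ∃ β : Fin d → ℕ, b * τ = wt lam β := by
  have := hA.noeth
  have hG := good_W_monFilt hA hd hx hQ (fun i => (h1 i).le) h2 hw
  have hm := maximalIdeal_le_W_gt hQ (fun i => (h1 i).le)
  obtain ⟨B, hB⟩ := exists_colength_W_le hA hQ (fun i => (h1 i).le)
  set K := d.factorial * B * 4 ^ d
  have hdep : ¬ (monFilt x lam).W.IndepFam x lam (fun j : Fin (K + 1) => f ^ ((j : ℕ) + 1))
      (fun j => ((j : ℕ) + 1 : ℕ) * τ) := by
    intro h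
    have := h.card_bound hG (fun i => (h1 i).le) h2 hw hB
    rw [Fintype.card_fin] at this
    omega
  obtain ⟨U, a, μ, τ', hU, ha, hτ', hsum⟩ :=
    exists_relation_of_not_indepFam hm hG (fun j => pow_mem _ hf.1 _) hdep
  set i := U.max' hU
  have hiU : i ∈ U := U.max'_mem hU
  have hlt : ∀ j ∈ U, j ≠ i → (j : ℕ) < i := fun j hj hji =>
    lt_of_le_of_ne (U.le_max' j hj) fun h => hji (Fin.ext h)
  by_cases hex : ∃ j ∈ U, j ≠ i
  swap
  · exfalso
    push Not at hex
    have : U = {i} := Finset.eq_singleton_iff_unique_mem.2 ⟨hiU, hex⟩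
    rw [this, Finset.sum_singleton, Ideal.unit_mul_mem_iff_mem _ (by simpa using ha i hiU),
      ← hτ' i hiU] at hsum
    exact hf.2 (mem_W_gt_of_pow_mem _ (Nat.succ_pos _) (hG.cancel_gt hsum))
  obtain ⟨j, hj, hji⟩ := hex
  have hjlt := hlt j hj hji
  have hle : μ i ≤ μ j := by
    by_contra hnle
    simp only [Pi.le_def, not_forall, not_le] at hnle
    obtain ⟨i₀, hi₀⟩ := hnle
    have hall : ∀ j' ∈ U, j' ≠ i → μ j' i₀ < μ i i₀ := by
      intro j' hj' hji'
      have hjlt' := hlt j' hj' hji'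
      have e := congrFun (hw (fun k => ((i : ℤ) - j') * ((μ j k : ℤ) - μ i k) -
        ((i : ℤ) - j) * ((μ j' k : ℤ) - μ i k)) ?_) i₀
      · simp only [Pi.zero_apply] at e
        by_contra hge
        have g1 : (0 : ℤ) < (i : ℤ) - j' := by omega
        have g2 : (0 : ℤ) < (i : ℤ) - j := by omega
        have g3 : (μ j i₀ : ℤ) - μ i i₀ < 0 := by omega
        have g4 : (0 : ℤ) ≤ (μ j' i₀ : ℤ) - μ i i₀ := by omega
        nlinarith
      · have q1 := hτ' j hj
        have q2 := hτ' j' hj'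
        have q3 := hτ' i hiU
        have : ∑ k, lam k * (((((i : ℤ) - j') * ((μ j k : ℤ) - μ i k) -
            ((i : ℤ) - j) * ((μ j' k : ℤ) - μ i k)) : ℤ) : ℝ) =
            ((i : ℝ) - j') * (wt lam (μ j) - wt lam (μ i)) -
            ((i : ℝ) - j) * (wt lam (μ j') - wt lam (μ i)) := by
          simp only [wt, ← Finset.sum_sub_distrib, Finset.mul_sum]
          refine Finset.sum_congr rfl fun k _ => ?_
          push_cast
          ring
        rw [this]
        have r1 : wt lam (μ j) - wt lam (μ i) = ((i : ℝ) - j) * τ := by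
          push_cast at q1 q3; linarith
        have r2 : wt lam (μ j') - wt lam (μ i) = ((i : ℝ) - j') * τ := by
          push_cast at q2 q3; linarith
        rw [r1, r2]; ring
    obtain ⟨τ'', hτ'', hsum⟩ := hsum
    have hτ'0 : 0 ≤ τ' := by
      rw [← hτ' i hiU]
      have := wt_nonneg (fun i => (zero_le_one.trans (h1 i).le)) (μ i)
      have := hf.nonneg
      positivity
    obtain ⟨N, hN2, hN3, hN4⟩ : ∃ N : ℕ, 2 ≤ N ∧ 1 ≤ (1 - 1 / N : ℝ) * lam i₀ ∧
        τ' < (1 - 1 / N : ℝ) * τ'' := by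
      have hlim : Filter.Tendsto (fun N : ℕ => (1 - 1 / N : ℝ)) Filter.atTop (nhds 1) := by
        simpa using tendsto_const_nhds.sub (tendsto_one_div_atTop_nhds_zero_nat (𝕜 := ℝ))
      have l1 : ∀ᶠ N : ℕ in Filter.atTop, 1 < (1 - 1 / N : ℝ) * lam i₀ :=
        (hlim.mul_const (lam i₀)).eventually_const_lt (by simpa using h1 i₀)
      have l2 : ∀ᶠ N : ℕ in Filter.atTop, τ' < (1 - 1 / N : ℝ) * τ'' :=
        (hlim.mul_const τ'').eventually_const_lt (by simpa using hτ'')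
      obtain ⟨N, n1, n2, n3⟩ := (l1.and (l2.and (Filter.eventually_ge_atTop 2))).exists
      exact ⟨N, n3, n1.le, n2⟩
    have hN0 : (0 : ℝ) < 1 / N := by positivity
    have hN1 : (0 : ℝ) < 1 - 1 / N := by
      have : (1 : ℝ) / N ≤ 1 / 2 := by
        gcongr; exact_mod_cast hN2
      linarith
    have hlam0 : ∀ i, 0 ≤ lam i := fun i => zero_le_one.trans (h1 i).le
    have hG' := good_W_monFilt (lam := scaleWt lam i₀ N) hA hd hx hQ ?_ ?_ (wtIndep_scaleWt hw i₀ hN2)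
    rotate_left
    · intro k
      rw [scaleWt]
      split_ifs with hk
      · rw [hk]; exact hN3
      · exact (h1 k).le
    · intro k
      rw [scaleWt]
      split_ifs with hk
      · nlinarith [h2 k, hlam0 k]
      · exact h2 k
    have c1 : ∀ t, (monFilt x (scaleWt lam i₀ N)).W t ≤ (monFilt x lam).W t := by
      intro t
      have := W_le_W (F := monFilt x (scaleWt lam i₀ N)) (G := monFilt x lam) (c := 1) (k₀ := 0)
        one_pos (fun t => ?_) t
      · rwa [one_mul] at this
      · rw [one_mul, sub_zero]
        refine monFilt_le_monFilt x fun μ hμ => hμ.trans ?_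
        rw [wt_scaleWt]
        have := mul_nonneg hN0.le (mul_nonneg (hlam0 i₀) (Nat.cast_nonneg (μ i₀)))
        linarith
    have c2 : ∀ t, (monFilt x lam).W t ≤ (monFilt x (scaleWt lam i₀ N)).W ((1 - 1 / N) * t) := by
      refine W_le_W (k₀ := 0) hN1 (fun t => ?_)
      rw [sub_zero]
      refine monFilt_le_monFilt x fun μ hμ => (mul_le_mul_of_nonneg_left hμ hN1.le).trans ?_
      rw [wt_scaleWt]
      have : lam i₀ * μ i₀ ≤ wt lam μ :=
        Finset.single_le_sum (f := fun k => lam k * (μ k : ℝ))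
          (fun k _ => mul_nonneg (hlam0 k) (Nat.cast_nonneg _)) (Finset.mem_univ i₀)
      have := mul_le_mul_of_nonneg_left this hN0.le
      linarith
    obtain ⟨θ, -, hθ⟩ := hG'.leftCont.exists_isVal (f := f) (T := τ + 1)
      (fun h => hf.2 ⟨τ + 1, by simp, c1 _ h⟩)
    have hθτ : θ ≤ τ := hf.le (c1 _ hθ.1)
    have hmain : a i * (mon x (μ i) * f ^ ((i : ℕ) + 1)) ∈ (monFilt x (scaleWt lam i₀ N)).W.gt
        (wt (scaleWt lam i₀ N) (μ i) + ((i : ℕ) + 1 : ℕ) * θ) := by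
      rw [← Finset.add_sum_erase _ _ hiU] at hsum
      refine (Submodule.add_mem_iff_left _ (Submodule.sum_mem _ fun j' hj' => ?_)).1
        (⟨_, ?_, c2 _ hsum⟩ : _ ∈ (monFilt x (scaleWt lam i₀ N)).W.gt _)
      · rw [Finset.mem_erase] at hj'
        refine Ideal.mul_mem_left _ _ ((monFilt x (scaleWt lam i₀ N)).W.le_gt ?_
          ((monFilt x (scaleWt lam i₀ N)).W.mul (hG'.mon_mem (μ j'))
          ((monFilt x (scaleWt lam i₀ N)).W.pow_mem hθ.1 _)))
        rw [wt_scaleWt, wt_scaleWt]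
        have q2 := hτ' j' hj'.2
        have q3 := hτ' i hiU
        have q4 : (μ j' i₀ : ℝ) < μ i i₀ := by exact_mod_cast hall j' hj'.2 hj'.1
        have q5 : lam i₀ * μ j' i₀ < lam i₀ * μ i i₀ :=
          mul_lt_mul_of_pos_left q4 (zero_lt_one.trans (h1 i₀))
        have q6 := mul_lt_mul_of_pos_left q5 hN0
        have q7 : (0 : ℝ) ≤ (i : ℝ) - j' := by
          have : (j' : ℝ) < i := by exact_mod_cast hlt j' hj'.2 hj'.1
          linarith
        have q8 := mul_le_mul_of_nonneg_left hθτ q7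
        push_cast at q2 q3 ⊢
        linarith
      · have q3 := hτ' i hiU
        have q5 : 0 ≤ 1 / N * (lam i₀ * μ i i₀) := by
          have := hlam0 i₀
          positivity
        have q6 : (((i : ℕ) + 1 : ℕ) : ℝ) * θ ≤ ((i : ℕ) + 1 : ℕ) * τ := by gcongr
        rw [wt_scaleWt]
        linarith
    rw [Ideal.unit_mul_mem_iff_mem _ (by simpa using ha i hiU)] at hmain
    exact hθ.2 (mem_W_gt_of_pow_mem _ (Nat.succ_pos _) (hG'.cancel_gt hmain))
  refine ⟨i - j, by omega, μ j - μ i, ?_⟩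
  have e : μ j = μ i + (μ j - μ i) := (add_tsub_cancel_of_le hle).symm
  have e2 := congrArg (wt lam) e
  rw [wt_add] at e2
  have q1 := hτ' j hj
  have q3 := hτ' i hiU
  rw [Nat.cast_sub hjlt.le]
  push_cast at q1 q3
  linarith

end MulFilt

namespace MulFilt

variable {A : Type*} [CommRing A] {d : ℕ} {x : Fin d → A} {lam : Fin d → ℝ}

theorem IndepFam.comp [IsLocalRing A] {G : MulFilt A} {ι κ : Type*} [Fintype ι] [Fintype κ]
    {f : ι → A} {t : ι → ℝ} (h : G.IndepFam x lam f t) {e : κ → ι} (he : Function.Injective e) :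
    G.IndepFam x lam (f ∘ e) (t ∘ e) := by
  refine ⟨fun j => h.1 _, fun a μ τ ha hsum j => ?_⟩
  have := h.2 (Function.extend e a 0) (Function.extend e μ 0) τ ?_ ?_ (e j)
  · rwa [he.extend_apply] at this
  · intro i hi
    by_cases hi' : ∃ k, e k = i
    · obtain ⟨k, rfl⟩ := hi'
      rw [he.extend_apply] at hi ⊢
      exact ha k hi
    · exact absurd (Function.extend_apply' _ _ _ hi') hi
  · convert hsum using 1
    refine (Finset.sum_of_injOn e he.injOn (by simp) (fun i _ hi => ?_) fun k _ => ?_).symm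
    · rw [Function.extend_apply' _ _ _ (by simpa using hi), Pi.zero_apply, zero_mul]
    · simp only [he.extend_apply, Function.comp]

theorem exists_maximal_indepFam [IsLocalRing A] {G : MulFilt A} (K : ℕ)
    (hK : ∀ (q : ℕ) (f : Fin q → A) (t : Fin q → ℝ), G.IndepFam x lam f t → q ≤ K) :
    ∃ r : ℕ, (∃ (f : Fin r → A) (t : Fin r → ℝ), G.IndepFam x lam f t) ∧
      ∀ (f : Fin (r + 1) → A) (t : Fin (r + 1) → ℝ), ¬ G.IndepFam x lam f t := by
  classical
  set P : ℕ → Prop := fun q => ∃ (f : Fin q → A) (t : Fin q → ℝ), G.IndepFam x lam f t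
  have h0 : P 0 := ⟨Fin.elim0, Fin.elim0, fun j => j.elim0, fun _ _ _ _ _ j => j.elim0⟩
  refine ⟨Nat.findGreatest P K, Nat.findGreatest_spec (Nat.zero_le K) h0, fun f t h => ?_⟩
  have h1 : P (Nat.findGreatest P K + 1) := ⟨f, t, h⟩
  have := Nat.le_findGreatest (hK _ f t h) h1
  omega

/-- The number `s` is an integral combination of the weights. -/
def InLattice (lam : Fin d → ℝ) (s : ℝ) : Prop := ∃ γ : Fin d → ℤ, s = ∑ i, lam i * γ i

theorem InLattice.sub {s s' : ℝ} (h : InLattice lam s) (h' : InLattice lam s') :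
    InLattice lam (s - s') := by
  obtain ⟨γ, rfl⟩ := h
  obtain ⟨γ', rfl⟩ := h'
  refine ⟨γ - γ', ?_⟩
  rw [← Finset.sum_sub_distrib]
  exact Finset.sum_congr rfl fun i _ => by simp; ring

theorem inLattice_wt (μ : Fin d → ℕ) : InLattice lam (wt lam μ) := ⟨fun i => μ i, by simp [wt]⟩

theorem wt_div_le {b : ℕ} (hb : 0 < b) (h : ∀ i, 0 ≤ lam i) {β : Fin d → ℕ} {τ : ℝ}
    (hτ : b * τ = wt lam β) : wt lam (fun i => β i / b) ≤ τ := by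
  have hb' : (0 : ℝ) < b := by exact_mod_cast hb
  refine le_of_mul_le_mul_left ?_ hb'
  rw [hτ, wt, wt, Finset.mul_sum]
  refine Finset.sum_le_sum fun i _ => ?_
  have : ((b * (β i / b) : ℕ) : ℝ) ≤ β i := by exact_mod_cast Nat.mul_div_le _ _
  push_cast at this
  calc (b : ℝ) * (lam i * ((β i / b : ℕ) : ℝ)) = lam i * (b * (β i / b : ℕ)) := by ring
    _ ≤ _ := mul_le_mul_of_nonneg_left this (h i)

theorem eq_of_div_eq (hw : WtIndep lam) {b b' : ℕ} (hb : 0 < b) (hb' : 0 < b')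
    {β β' : Fin d → ℕ} {τ τ' : ℝ} (hτ : b * τ = wt lam β) (hτ' : b' * τ' = wt lam β')
    (hd : (fun i => β i / b) = fun i => β' i / b') (hl : InLattice lam (τ - τ')) : τ = τ' := by
  obtain ⟨γ, hγ⟩ := hl
  have key := hw (fun i => b' * β i - b * β' i - b * b' * γ i) ?_
  · have hγ0 : ∀ i, γ i = 0 := by
      intro i
      have e := congrFun key i
      simp only [Pi.zero_apply] at e
      have e1 := congrFun hd i
      have e2 := Nat.div_add_mod (β i) b
      have e3 := Nat.div_add_mod (β' i) b'
      have e4 := Nat.mod_lt (β i) hb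
      have e5 := Nat.mod_lt (β' i) hb'
      rw [e1] at e2
      set q := β' i / b'
      set s := β i % b
      set s' := β' i % b'
      have e6 : (b * b' : ℤ) * γ i = b' * s - b * s' := by
        rw [← e2, ← e3] at e
        push_cast at e
        linarith
      have g1 : (0 : ℤ) < b := by exact_mod_cast hb
      have g2 : (0 : ℤ) < b' := by exact_mod_cast hb'
      have g3 : (s : ℤ) < b := by exact_mod_cast e4
      have g4 : (s' : ℤ) < b' := by exact_mod_cast e5
      have g5 : (0 : ℤ) < b * b' := mul_pos g1 g2
      have g6 : (b' : ℤ) * s < b' * b := mul_lt_mul_of_pos_left g3 g2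
      have g7 : (b : ℤ) * s' < b * b' := mul_lt_mul_of_pos_left g4 g1
      have g8 : (0 : ℤ) ≤ b' * s := by positivity
      have g9 : (0 : ℤ) ≤ b * s' := by positivity
      have h1 : γ i < 1 := by
        by_contra! h
        nlinarith
      have h2 : -1 < γ i := by
        by_contra! h
        nlinarith
      omega
    have : τ - τ' = 0 := by rw [hγ]; simp [hγ0]
    linarith
  · have : ∑ i, lam i * ((b' * β i - b * β' i - b * b' * γ i : ℤ) : ℝ) =
        b' * wt lam β - b * wt lam β' - b * b' * ∑ i, lam i * γ i := by
      simp only [wt, Finset.mul_sum, ← Finset.sum_sub_distrib]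
      exact Finset.sum_congr rfl fun i _ => by push_cast; ring
    rw [this, ← hγ, ← hτ, ← hτ']
    ring

open Classical in
theorem exists_relation_of_maximal [IsLocalRing A] {G : MulFilt A}
    (hm : maximalIdeal A ≤ G.gt 0) (hG : G.Good x lam) (hw : WtIndep lam) {r : ℕ}
    {f : Fin r → A} {t : Fin r → ℝ} (hf : G.IndepFam x lam f t)
    (hmax : ∀ (f : Fin (r + 1) → A) (t : Fin (r + 1) → ℝ), ¬ G.IndepFam x lam f t) (τ : ℝ)
    {q : ℕ} (hq : q = (Finset.univ.filter fun j => InLattice lam (τ - t j)).card)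
    (g : Fin (q + 1) → A) (hg : ∀ k, g k ∈ G τ) :
    ∃ c : Fin (q + 1) → A, (∃ k, c k ∉ maximalIdeal A) ∧ ∑ k, c k * g k ∈ G.gt τ := by
  have hcard : Fintype.card ({j : Fin r // ¬ InLattice lam (τ - t j)} ⊕ Fin (q + 1)) = r + 1 := by
    have h1 := Fintype.card_subtype (fun j : Fin r => ¬ InLattice lam (τ - t j))
    have h2 := Finset.card_filter_add_card_filter_not (s := (Finset.univ : Finset (Fin r)))
      (fun j => InLattice lam (τ - t j))
    rw [Finset.card_univ, Fintype.card_fin] at h2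
    rw [Fintype.card_sum, Fintype.card_fin, h1]
    omega
  have hdep : ¬ G.IndepFam x lam
      (Sum.elim (fun j : {j : Fin r // ¬ InLattice lam (τ - t j)} => f j) g)
      (Sum.elim (fun j => t j) fun _ => τ) := fun h =>
    hmax _ _ (h.comp (Fintype.equivFinOfCardEq hcard).symm.injective)
  obtain ⟨U, a, μ, τ', hU, ha, hτ', hsum⟩ := exists_relation_of_not_indepFam hm hG
    (by rintro (j | k); exacts [hf.1 _, hg k]) hdep
  have hsum' : ∑ s, (if s ∈ U then a s else 0) * (mon x (μ s) * Sum.elim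
      (fun j : {j : Fin r // ¬ InLattice lam (τ - t j)} => f j) g s) ∈ G.gt τ' := by
    simpa only [ite_mul, zero_mul, Finset.sum_ite_mem, Finset.univ_inter] using hsum
  rw [Fintype.sum_sum_type] at hsum'
  simp only [Sum.elim_inl, Sum.elim_inr] at hsum'
  by_cases hex : ∃ j, Sum.inl j ∈ U
  · exfalso
    obtain ⟨j, hj⟩ := hex
    have hinr : ∀ k, Sum.inr k ∉ U := by
      intro k hk
      refine j.2 ?_
      have e1 := hτ' _ hj
      have e2 := hτ' _ hk
      simp only [Sum.elim_inl, Sum.elim_inr] at e1 e2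
      have : τ - t j = wt lam (μ (Sum.inl j)) - wt lam (μ (Sum.inr k)) := by linarith
      rw [this]
      exact (inLattice_wt _).sub (inLattice_wt _)
    simp only [hinr, if_false, zero_mul, Finset.sum_const_zero, add_zero] at hsum'
    have := (hf.comp (Subtype.val_injective (p := fun j : Fin r => ¬ InLattice lam (τ - t j)))).2
      (fun j => if Sum.inl j ∈ U then a (Sum.inl j) else 0) (fun j => μ (Sum.inl j)) τ'
      (fun j' hj' => ?_) hsum' j
    · rw [if_pos hj] at this
      exact ha _ hj this
    · have : Sum.inl j' ∈ U := by
        by_contra h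
        exact hj' (if_neg h)
      exact hτ' _ this
  · push Not at hex
    simp only [hex, if_false, zero_mul, Finset.sum_const_zero, zero_add] at hsum'
    obtain ⟨s, hs⟩ := hU
    rcases s with j | k
    · exact absurd hs (hex j)
    have e1 := hτ' _ hs
    simp only [Sum.elim_inr] at e1
    refine ⟨fun k => if Sum.inr k ∈ U then a (Sum.inr k) else 0, ⟨k, by
      simp only [if_pos hs]; exact ha _ hs⟩, hG.cancel_gt (μ := μ (Sum.inr k)) ?_⟩
    rw [e1]
    convert hsum' using 1
    rw [Finset.mul_sum]
    refine Finset.sum_congr rfl fun k' _ => ?_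
    by_cases hk' : Sum.inr k' ∈ U
    · simp only [if_pos hk']
      have e2 := hτ' _ hk'
      simp only [Sum.elim_inr] at e2
      have : μ (Sum.inr k') = μ (Sum.inr k) := hw.injective (by linarith)
      rw [this]; ring
    · simp only [if_neg hk']; ring

theorem exists_maximal_indepFam_colength [IsLocalRing A] (hA : ClassC A d) (hd : 0 < d)
    (hx : ∀ i, x i ∈ maximalIdeal A)
    (hQ : colength (Ideal.span (Set.range x)) ≠ ⊤) (h1 : ∀ i, 1 < lam i) (h2 : ∀ i, lam i ≤ 2)
    (hw : WtIndep lam) :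
    ∃ r : ℕ, (∃ (f : Fin r → A) (t : Fin r → ℝ), (monFilt x lam).W.IndepFam x lam f t) ∧
      ∀ n : ℝ, colength ((monFilt x lam).W n) ≤ (r * (wtLT lam n).card : ℕ) := by
  classical
  have := hA.noeth
  have h1' : ∀ i, 1 ≤ lam i := fun i => (h1 i).le
  have hG := good_W_monFilt hA hd hx hQ h1' h2 hw
  have hm := maximalIdeal_le_W_gt hQ h1'
  obtain ⟨B, hB⟩ := exists_colength_W_le hA hQ h1'
  obtain ⟨r, ⟨f, t, hf⟩, hmax⟩ := exists_maximal_indepFam (G := (monFilt x lam).W) (x := x)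
    (lam := lam) (d.factorial * B * 4 ^ d) (fun q f t h => by
      simpa using h.card_bound hG h1' h2 hw hB)
  refine ⟨r, ⟨f, t, hf⟩, fun n => ?_⟩
  set G := (monFilt x lam).W
  set q : ℝ → ℕ := fun τ => (Finset.univ.filter fun j => InLattice lam (τ - t j)).card with hq
  have hstep : ∀ τ, colength (G.gt τ) ≤ colength (G τ) + q τ := by
    intro τ
    refine colength_le_add_of_relations (fun a ha b hb => ?_) fun g hg =>
      exists_relation_of_maximal hm hG hw hf hmax τ rfl g hg
    rw [← zero_add τ]
    exact G.gt_mul_mem (hm ha) hb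
  have hpos : ∀ g τ, G.IsVal g τ → ∃ j, InLattice lam (τ - t j) := by
    intro g τ hg
    by_contra! hno
    obtain ⟨c, ⟨k, hk⟩, hc⟩ := exists_relation_of_maximal hm hG hw hf hmax τ (q := 0)
      (by simp [hno]) (fun _ => g) (fun _ => hg.1)
    obtain rfl : k = 0 := Fin.ext (by omega)
    rw [Fin.sum_univ_one, Ideal.unit_mul_mem_iff_mem _ (by simpa using hk)] at hc
    exact hg.2 hc
  have hval : ∀ τ : {τ // ∃ g, G.IsVal g τ}, ∃ b : ℕ, 0 < b ∧ ∃ β : Fin d → ℕ,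
      b * (τ : ℝ) = wt lam β := fun τ =>
    exists_wt_eq_of_isVal hA hd hx hQ h1 h2 hw τ.2.choose_spec
  choose b hb β hβ using hval
  set ν : {τ // ∃ g, G.IsVal g τ} → Fin d → ℕ := fun τ i => β τ i / b τ with hν
  have hνinj : ∀ (τ τ' : {τ // ∃ g, G.IsVal g τ}) j, InLattice lam ((τ : ℝ) - t j) →
      InLattice lam ((τ' : ℝ) - t j) → ν τ = ν τ' →
      τ = τ' := fun τ τ' j hj hj' h => Subtype.ext (eq_of_div_eq hw (hb τ) (hb τ') (hβ τ) (hβ τ') h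
        (by simpa using hj.sub hj'))
  have hνlt : ∀ τ : {τ // ∃ g, G.IsVal g τ}, (τ : ℝ) < n → ν τ ∈ wtLT lam n := fun τ hτ =>
    (mem_wtLT h1').2 ((wt_div_le (hb τ) (fun i => zero_le_one.trans (h1' i)) (hβ τ)).trans_lt hτ)
  choose J hJ using fun τ : {τ // ∃ g, G.IsVal g τ} => hpos _ _ τ.2.choose_spec
  have hfin : {τ : {τ // ∃ g, G.IsVal g τ} | (τ : ℝ) < n}.Finite := by
    refine Set.Finite.of_injOn (f := fun τ => (J τ, ν τ))
      (t := ((Finset.univ ×ˢ wtLT lam n : Finset (Fin r × (Fin d → ℕ))) : Set _)) ?_ ?_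
      (Finset.finite_toSet _)
    · intro τ hτ
      simpa using hνlt τ hτ
    · intro τ _ τ' _ h
      simp only [Prod.mk.injEq] at h
      exact hνinj τ τ' (J τ) (hJ τ) (h.1 ▸ hJ τ') h.2
  set V := hfin.toFinset with hV
  have hcount : ∑ τ ∈ V, q τ ≤ r * (wtLT lam n).card := by
    have e1 : ∑ τ ∈ V, q τ = (V.sigma fun τ =>
        Finset.univ.filter fun j => InLattice lam ((τ : ℝ) - t j)).card := by
      rw [Finset.card_sigma]
    have e2 : r * (wtLT lam n).card =
        (Finset.univ ×ˢ wtLT lam n : Finset (Fin r × (Fin d → ℕ))).card := by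
      rw [Finset.card_product, Finset.card_univ, Fintype.card_fin]
    rw [e1, e2]
    refine Finset.card_le_card_of_injOn (fun p => (p.2, ν p.1)) ?_ ?_
    · rintro ⟨τ, j⟩ hp
      simp only [Finset.coe_sigma, Set.mem_sigma_iff, Finset.mem_coe, hV, Set.Finite.mem_toFinset,
        Set.mem_ofPred_eq] at hp
      simpa using hνlt τ hp.1
    · rintro ⟨τ, j⟩ hp ⟨τ', j'⟩ hp' h
      simp only [Prod.mk.injEq] at h
      obtain ⟨rfl, h⟩ := h
      simp only [Finset.coe_sigma, Set.mem_sigma_iff, Finset.mem_coe, Finset.mem_filter,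
        Finset.mem_univ, true_and] at hp hp'
      rw [hνinj τ τ' j hp.2 hp'.2 h]
  have hmain : ∀ (V : Finset ℝ) (n : ℝ), (∀ g τ, G.IsVal g τ → τ < n → τ ∈ V) →
      (∀ τ ∈ V, τ < n) → colength (G n) ≤ (∑ τ ∈ V, q τ : ℕ) := by
    intro V
    induction V using Finset.induction_on_max with
    | empty =>
      intro n hn _
      have : G n = ⊤ := by
        rw [Ideal.eq_top_iff_one]
        by_contra h
        obtain ⟨τ, hτ, hv⟩ := hG.leftCont.exists_isVal h
        exact absurd (hn _ _ hv hτ) (Finset.notMem_empty _)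
      rw [this, colength_top]
      exact zero_le
    | insert τ V hlt ih =>
      intro n hn hVn
      have hτV : τ ∉ V := fun h => lt_irrefl _ (hlt τ h)
      have e1 := ih τ (fun g τ' hg hτ' => (Finset.mem_insert.1 (hn g τ' hg
        (hτ'.trans (hVn τ (Finset.mem_insert_self _ _))))).resolve_left hτ'.ne) hlt
      have e2 : G.gt τ ≤ G n := by
        rintro g ⟨u, hu, hg⟩
        by_contra h
        obtain ⟨τ', hτ', hv⟩ := hG.leftCont.exists_isVal h
        have g1 := hv.le hg
        rcases Finset.mem_insert.1 (hn _ _ hv hτ') with h | h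
        · linarith
        · linarith [hlt _ h]
      rw [Finset.sum_insert hτV]
      calc colength (G n) ≤ colength (G.gt τ) := colength_anti e2
        _ ≤ colength (G τ) + q τ := hstep τ
        _ ≤ (∑ τ ∈ V, q τ : ℕ) + q τ := add_le_add e1 le_rfl
        _ = _ := by push_cast; ring
  refine (hmain (V.map ⟨Subtype.val, Subtype.val_injective⟩) n ?_ ?_).trans ?_
  · intro g τ hg hτ
    simp only [Finset.mem_map, Function.Embedding.coeFn_mk, hV, Set.Finite.mem_toFinset,
      Set.mem_ofPred_eq]
    exact ⟨⟨τ, g, hg⟩, hτ, rfl⟩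
  · intro τ hτ
    simp only [Finset.mem_map, Function.Embedding.coeFn_mk, hV, Set.Finite.mem_toFinset,
      Set.mem_ofPred_eq] at hτ
    obtain ⟨τ, h, rfl⟩ := hτ
    exact h
  · rw [Finset.sum_map]
    exact_mod_cast hcount

end MulFilt

theorem exists_wtIndep (d : ℕ) {ε : ℝ} (hε : 0 < ε) :
    ∃ lam : Fin d → ℝ, (∀ i, 1 < lam i) ∧ (∀ i, lam i ≤ 1 + ε) ∧ WtIndep lam := by
  have hne : {s : ℝ | 1 < s ∧ s ^ d < 1 + ε}.Nonempty := by
    have h1 : ∀ᶠ s : ℝ in nhds 1, s ^ d < 1 + ε :=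
      (continuous_pow d).continuousAt.eventually_lt_const (by simpa using hε)
    have h2 : ∀ᶠ s : ℝ in nhdsWithin 1 (Set.Ioi 1), 1 < s ∧ s ^ d < 1 + ε :=
      (eventually_mem_nhdsWithin).and (h1.filter_mono nhdsWithin_le_nhds)
    exact h2.exists
  have hopen : IsOpen {s : ℝ | 1 < s ∧ s ^ d < 1 + ε} :=
    (isOpen_lt continuous_const continuous_id).inter
      (isOpen_lt (continuous_pow d) continuous_const)
  obtain ⟨s, ⟨hs1, hs2⟩, hs⟩ :=
    ((Algebraic.countable ℤ ℝ).dense_compl ℝ).exists_mem_open hopen hne |>.imp fun s h => h.symm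
  refine ⟨fun i => s ^ ((i : ℕ) + 1), fun i => one_lt_pow₀ hs1 (by omega), fun i =>
    (pow_le_pow_right₀ hs1.le (by omega)).trans hs2.le, fun γ hγ => ?_⟩
  set P : Polynomial ℤ := ∑ i : Fin d, Polynomial.monomial ((i : ℕ) + 1) (γ i) with hP
  have hP0 : P = 0 := by
    by_contra h
    refine hs ⟨P, h, ?_⟩
    rw [hP, map_sum, ← hγ]
    refine Finset.sum_congr rfl fun i _ => ?_
    rw [Polynomial.aeval_monomial]
    simp [mul_comm]
  funext i
  have := congrArg (fun Q : Polynomial ℤ => Q.coeff ((i : ℕ) + 1)) hP0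
  simp only [hP, Polynomial.finsetSum_coeff, Polynomial.coeff_monomial, Polynomial.coeff_zero] at this
  rw [Finset.sum_eq_single i] at this
  · simpa using this
  · intro j _ hj
    rw [if_neg]
    intro h
    exact hj (Fin.ext (by omega))
  · simp

namespace MulFilt

variable {A : Type*} [CommRing A] {d : ℕ}

/-- The asymptotic bound on the colengths of integral closures of powers of an ideal. -/
def MainBound (I : Ideal A) (d : ℕ) : Prop :=
  ∃ L : ℕ → ℕ, (∀ n : ℕ, colength ((powFilt I).W n) = L n) ∧ ∀ δ : ℝ, 0 < δ → ∀ n : ℕ, ∃ r : ℕ,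
    L n ≤ r * (n + d - 1).choose d ∧
    ∀ᶠ t : ℕ in Filter.atTop, (r : ℝ) * (t : ℝ) ^ d ≤ (1 + δ) * d.factorial * L t

theorem mainBound_span [IsLocalRing A] (hA : ClassC A d) (hd : 0 < d) {x : Fin d → A}
    (hx : ∀ i, x i ∈ maximalIdeal A) (hQ : colength (Ideal.span (Set.range x)) ≠ ⊤) :
    MainBound (Ideal.span (Set.range x)) d := by
  have := hA.noeth
  set Q := Ideal.span (Set.range x) with hQdef
  have hxQ : ∀ i, x i ∈ Q := fun i => Ideal.subset_span ⟨i, rfl⟩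
  obtain ⟨c, hc⟩ := exists_maximalIdeal_pow_le hQ
  have hfin : ∀ n : ℕ, colength ((powFilt Q).W n) ≠ ⊤ := by
    intro n
    refine ne_top_of_le_ne_top (colength_pow_ne_top hA (c * n)) (colength_anti ?_)
    rw [pow_mul]
    refine (Ideal.pow_right_mono hc n).trans ?_
    rw [← powFilt_natCast]
    exact le_W _ _
  choose L hL using fun n => ENat.ne_top_iff_exists.1 (hfin n)
  refine ⟨L, fun n => (hL n).symm, fun δ hδ n => ?_⟩
  have hε1 : ∃ ε > 0, (powFilt Q).W (n / (1 + ε)) ≤ (powFilt Q).W n := by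
    have hanti : Antitone fun k : ℕ => (powFilt Q).W (n / (1 + 1 / ((k : ℝ) + 1))) := by
      intro a b hab
      refine (powFilt Q).W.anti ?_
      gcongr
    obtain ⟨N, hN⟩ := exists_stable_of_colength_ne_top (hfin n) _ hanti fun k =>
      (powFilt Q).W.anti (div_le_self (Nat.cast_nonneg n) (by
        have : (0 : ℝ) ≤ 1 / ((k : ℝ) + 1) := by positivity
        linarith))
    refine ⟨1 / ((N : ℝ) + 1), by positivity, fun f hf => W_leftCont _ _ _ fun t' ht' => ?_⟩
    have hlim : Filter.Tendsto (fun k : ℕ => (n : ℝ) / (1 + 1 / ((k : ℝ) + 1))) Filter.atTop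
        (nhds n) := by
      have := (tendsto_const_nhds (x := (n : ℝ))).div ((tendsto_const_nhds (x := (1 : ℝ))).add
        (tendsto_one_div_add_atTop_nhds_zero_nat (𝕜 := ℝ))) (by simp)
      rw [add_zero, div_one] at this
      exact this
    obtain ⟨k, hk⟩ := (hlim.eventually_const_lt ht').exists
    exact (powFilt Q).W.mem_of_le hk.le (hN k hf)
  obtain ⟨ε₁, hε₁, hW₁⟩ := hε1
  obtain ⟨ε₂, hε₂, hε₂'⟩ : ∃ ε > 0, (1 + ε) ^ d < 1 + δ := by
    have h1 : ∀ᶠ s : ℝ in nhds 0, (1 + s) ^ d < 1 + δ :=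
      (by fun_prop : Continuous fun s : ℝ => (1 + s) ^ d).continuousAt.eventually_lt_const
        (by simpa using hδ)
    have h2 : ∀ᶠ s : ℝ in nhdsWithin 0 (Set.Ioi 0), 0 < s ∧ (1 + s) ^ d < 1 + δ :=
      (eventually_mem_nhdsWithin).and (h1.filter_mono nhdsWithin_le_nhds)
    exact h2.exists
  obtain ⟨lam, h1, h2, hw⟩ := exists_wtIndep d (ε := min ε₁ (min ε₂ 1)) (by positivity)
  have hl1 : ∀ i, lam i ≤ 1 + ε₁ := fun i => (h2 i).trans (by gcongr; exact min_le_left _ _)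
  have hl2 : ∀ i, lam i ≤ 1 + ε₂ := fun i =>
    (h2 i).trans (by gcongr; exact (min_le_right _ _).trans (min_le_left _ _))
  have hl3 : ∀ i, lam i ≤ 2 := fun i => by
    have := (min_le_right ε₁ (min ε₂ 1)).trans (min_le_right _ _)
    linarith [h2 i]
  have h1' : ∀ i, 1 ≤ lam i := fun i => (h1 i).le
  have hG := good_W_monFilt hA hd hx hQ h1' hl3 hw
  obtain ⟨r, ⟨f, t, hf⟩, hr⟩ := exists_maximal_indepFam_colength hA hd hx hQ h1 hl3 hw
  refine ⟨r, ?_, ?_⟩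
  · have e1 : (monFilt x lam).W n ≤ (powFilt Q).W n := by
      refine le_trans ?_ hW₁
      have := W_le_W (F := monFilt x lam) (G := powFilt Q) (c := 1 / (1 + ε₁)) (k₀ := 0)
        (by positivity) (fun t => ?_) n
      · rwa [one_div_mul_eq_div] at this
      · rw [sub_zero, one_div_mul_eq_div]
        refine Ideal.span_le.2 ?_
        rintro _ ⟨μ, hμ, rfl⟩
        refine Ideal.pow_le_pow_right (Nat.ceil_le.2 ?_) (mon_mem_pow hxQ μ)
        rw [div_le_iff₀ (by positivity), mul_comm]
        exact hμ.trans (wt_le_mul_sum hl1 μ)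
    have e2 := (colength_anti e1).trans (hr n)
    rw [← hL] at e2
    have e3 : L n ≤ r * (wtLT lam n).card := by exact_mod_cast e2
    exact e3.trans (Nat.mul_le_mul_left _ (card_wtLT_le h1' n))
  · obtain ⟨T, hT⟩ := exists_nat_ge (∑ j, |t j|)
    have hlim : Filter.Tendsto (fun s : ℕ => (1 - T * (1 / (s : ℝ))) ^ d * (1 + δ)) Filter.atTop
        (nhds (1 + δ)) := by
      have := ((tendsto_const_nhds (x := (1 : ℝ))).sub
        ((tendsto_one_div_atTop_nhds_zero_nat (𝕜 := ℝ)).const_mul (T : ℝ))).pow d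
      simpa using this.mul_const (1 + δ)
    filter_upwards [hlim.eventually_const_lt hε₂', Filter.eventually_gt_atTop T] with s hs hsT
    have e1 : (powFilt Q).W s ≤ (monFilt x lam).W s := by
      have := W_le_W (F := powFilt Q) (G := monFilt x lam) (c := 1) (k₀ := 0)
        one_pos (fun t => ?_) s
      · rwa [one_mul] at this
      · rw [sub_zero, one_mul]
        exact (span_range_pow_le_monFilt x h1' _).trans ((monFilt x lam).anti (Nat.le_ceil t))
    have e2 := (hf.sum_card_le hG h1' hw s).trans (colength_anti e1)
    rw [← hL] at e2
    have e3 : ∑ j, (wtLT lam (s - t j)).card ≤ L s := by exact_mod_cast e2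
    have e4 : r * (wtLT lam (s - T)).card ≤ L s := by
      refine le_trans ?_ e3
      have : r * (wtLT lam (s - T)).card = ∑ _j : Fin r, (wtLT lam (s - T)).card := by simp
      rw [this]
      refine Finset.sum_le_sum fun j _ => Finset.card_le_card (wtLT_mono h1' ?_)
      have e5 : |t j| ≤ ∑ j, |t j| :=
        Finset.single_le_sum (f := fun j => |t j|) (fun _ _ => abs_nonneg _) (Finset.mem_univ j)
      linarith [le_abs_self (t j)]
    have hsT' : (T : ℝ) < s := by exact_mod_cast hsT
    have hs0 : (0 : ℝ) < s := (Nat.cast_nonneg T).trans_lt hsT'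
    have e6 := le_card_wtLT h1' (L := 1 + ε₂) (by positivity) hl2 (t := (s : ℝ) - T) (by linarith)
    rw [div_pow, div_le_iff₀ (by positivity)] at e6
    have e7 : (s : ℝ) ^ d * (1 + ε₂) ^ d ≤ ((s : ℝ) - T) ^ d * (1 + δ) := by
      have : ((s : ℝ) - T) = s * (1 - T * (1 / s)) := by field_simp
      rw [this, mul_pow, mul_assoc]
      gcongr
    have e8 : (r : ℝ) * (wtLT lam (s - T)).card ≤ L s := by exact_mod_cast e4
    have hε₂pos : (0 : ℝ) < (1 + ε₂) ^ d := by positivity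
    refine le_of_mul_le_mul_right ?_ hε₂pos
    calc (r : ℝ) * (s : ℝ) ^ d * (1 + ε₂) ^ d = r * ((s : ℝ) ^ d * (1 + ε₂) ^ d) := by ring
      _ ≤ r * (((s : ℝ) - T) ^ d * (1 + δ)) := by gcongr
      _ ≤ r * ((d.factorial * (wtLT lam (s - T)).card * (1 + ε₂) ^ d) * (1 + δ)) := by gcongr
      _ = (1 + δ) * d.factorial * (r * (wtLT lam (s - T)).card) * (1 + ε₂) ^ d := by ring
      _ ≤ _ := by gcongr

end MulFilt

namespace MulFilt

variable {A : Type*} [CommRing A] {d M : ℕ}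

theorem monomial_equivFun_eval (a : Fin M → A) (μ : Fin M → ℕ) (b : A) :
    MvPolynomial.eval a (MvPolynomial.monomial (Finsupp.equivFunOnFinite.symm μ) b) =
      b * mon a μ := by
  rw [MvPolynomial.eval_monomial, Finsupp.prod_fintype _ _ (by simp)]
  simp [mon]

theorem exists_homogeneous_relation [IsLocalRing A] (hA : ClassC A d) {a : Fin M → A}
    (ha : ∀ i, a i ∈ maximalIdeal A) (hcol : colength (Ideal.span (Set.range a)) ≠ ⊤)
    (hM : d < M) :
    ∃ (s : ℕ) (F : MvPolynomial (Fin M) A), F.IsHomogeneous s ∧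
      MvPolynomial.eval a F ∈ maximalIdeal A * Ideal.span (Set.range a) ^ s ∧
      MvPolynomial.map (residue A) F ≠ 0 := by
  classical
  by_contra! hcon
  have := hA.noeth
  obtain ⟨B, hB⟩ := hA.growth
  obtain ⟨c, hc⟩ := exists_maximalIdeal_pow_le hcol
  set I := Ideal.span (Set.range a) with hI
  have hIm : I ≤ maximalIdeal A := Ideal.span_le.2 (by rintro _ ⟨i, rfl⟩; exact ha i)
  have haI : ∀ i, a i ∈ I := fun i => Ideal.subset_span ⟨i, rfl⟩
  have hsucc : ∀ s j : ℕ, s < j → I ^ j ≤ maximalIdeal A * I ^ s := by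
    intro s j h
    refine (Ideal.pow_le_pow_right h).trans ?_
    rw [pow_succ, mul_comm]
    exact Ideal.mul_mono_left hIm
  have hcard : ∀ n : ℕ, ((wtLT (fun _ : Fin M => (1 : ℝ)) n).card : ℕ∞) ≤ colength (I ^ n) := by
    intro n
    have h1 := sum_colength_le (wtLT (fun _ : Fin M => (1 : ℝ)) n) (fun μ => ∑ i, μ i) (I ^ n)
      (mon a) (fun _ => maximalIdeal A) (by
      intro i hi b hb
      by_contra hbm
      rw [Submodule.mem_sup] at hb
      obtain ⟨w, hw, y, hy, hwy⟩ := hb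
      set T := (wtLT (fun _ : Fin M => (1 : ℝ)) n).filter
        fun j => j ≠ i ∧ ∑ k, i k ≤ ∑ k, j k with hT
      have hTset : {j | j ∈ wtLT (fun _ : Fin M => (1 : ℝ)) n ∧ j ≠ i ∧ ∑ k, i k ≤ ∑ k, j k} =
          (T : Set (Fin M → ℕ)) := by ext; simp [hT]
      rw [hTset] at hy
      obtain ⟨e, rfl⟩ := exists_sum_of_mem_span_image hy
      set s := ∑ k, i k with hs
      have hsn : s < n := by
        have := (mem_wtLT (fun _ => le_refl _)).1 hi
        simp only [wt, one_mul] at this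
        exact_mod_cast this
      set F : MvPolynomial (Fin M) A :=
        MvPolynomial.monomial (Finsupp.equivFunOnFinite.symm i) b -
          ∑ j ∈ T with ∑ k, j k = s, MvPolynomial.monomial (Finsupp.equivFunOnFinite.symm j) (e j)
        with hF
      have hdeg : ∀ μ : Fin M → ℕ, (Finsupp.equivFunOnFinite.symm μ).degree = ∑ k, μ k := by
        intro μ
        simp [Finsupp.degree_eq_sum]
      refine hbm ?_
      have h2 := hcon s F ?_ ?_
      · have h3 := congrArg (MvPolynomial.coeff (Finsupp.equivFunOnFinite.symm i)) h2
        rw [MvPolynomial.coeff_map, hF, MvPolynomial.coeff_sub, MvPolynomial.coeff_monomial,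
          if_pos rfl, MvPolynomial.coeff_sum, Finset.sum_eq_zero, sub_zero,
          MvPolynomial.coeff_zero, residue_eq_zero_iff] at h3
        · exact h3
        · intro j hj
          rw [MvPolynomial.coeff_monomial, if_neg]
          intro h
          simp only [hT, Finset.mem_filter] at hj
          exact hj.1.2.1 (Finsupp.equivFunOnFinite.symm.injective h)
      · refine MvPolynomial.IsHomogeneous.sub ?_ ?_
        · exact MvPolynomial.isHomogeneous_monomial _ (hdeg _)
        · refine MvPolynomial.IsHomogeneous.sum _ _ _ fun j hj => ?_
          refine MvPolynomial.isHomogeneous_monomial _ ((hdeg _).trans ?_)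
          exact (Finset.mem_filter.1 hj).2
      · rw [hF, map_sub, map_sum, monomial_equivFun_eval, ← hwy]
        simp only [monomial_equivFun_eval]
        rw [← Finset.sum_filter_add_sum_filter_not T (fun j => ∑ k, j k = s)]
        have h4 : w + ((∑ j ∈ T with ∑ k, j k = s, e j * mon a j) +
            ∑ j ∈ T with ¬ ∑ k, j k = s, e j * mon a j) -
            ∑ j ∈ T with ∑ k, j k = s, e j * mon a j =
            w + ∑ j ∈ T with ¬ ∑ k, j k = s, e j * mon a j := by ring
        rw [h4]
        refine add_mem (hsucc s n hsn hw) (Ideal.sum_mem _ fun j hj => Ideal.mul_mem_left _ _ ?_)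
        simp only [hT, Finset.mem_filter] at hj
        exact hsucc s _ (lt_of_le_of_ne hj.1.2.2 (Ne.symm hj.2)) (mon_mem_pow haI j))
    simp only [colength_maximal, Finset.sum_const, nsmul_eq_mul, mul_one] at h1
    exact le_self_add.trans h1
  have hbound : ∀ n : ℕ, 0 < n → n ≤ M.factorial * (B * c ^ d) := by
    intro n hn
    have h1 : ((wtLT (fun _ : Fin M => (1 : ℝ)) n).card : ℕ∞) ≤ (B * (c * n) ^ d : ℕ) := by
      refine (hcard n).trans ((colength_anti ?_).trans (hB (c * n)))
      rw [pow_mul]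
      exact Ideal.pow_right_mono hc n
    have h1' : (wtLT (fun _ : Fin M => (1 : ℝ)) n).card ≤ B * (c * n) ^ d := by exact_mod_cast h1
    have h2 := le_card_wtLT (lam := fun _ : Fin M => (1 : ℝ)) (fun _ => le_refl _) one_pos
      (fun _ => le_refl _) (t := n) (by exact_mod_cast hn)
    rw [div_one] at h2
    have h2' : n ^ M ≤ M.factorial * (wtLT (fun _ : Fin M => (1 : ℝ)) n).card := by
      exact_mod_cast h2
    have h3 : n ^ (d + 1) ≤ n ^ M := Nat.pow_le_pow_right hn hM
    have h4 := h3.trans (h2'.trans (Nat.mul_le_mul_left _ h1'))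
    rw [mul_pow, pow_succ] at h4
    have h5 : n ^ d * n ≤ n ^ d * (M.factorial * (B * c ^ d)) := by
      refine h4.trans (le_of_eq ?_); ring
    exact Nat.le_of_mul_le_mul_left h5 (by positivity)
  have := hbound (M.factorial * (B * c ^ d) + 1) (by omega)
  omega

end MulFilt

namespace MulFilt

variable {A : Type*} [CommRing A] {d M : ℕ}

/-- Two elements of `I ^ n` whose difference lies in `I' * I ^ (n - 1)`. -/
def PowCongr (I I' : Ideal A) (n : ℕ) (f g : A) : Prop :=
  f ∈ I ^ n ∧ g ∈ I ^ n ∧ match n with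
    | 0 => f = g
    | k + 1 => f - g ∈ I' * I ^ k

theorem PowCongr.mul {I I' : Ideal A} {n m : ℕ} {f g f' g' : A} (h : PowCongr I I' n f g)
    (h' : PowCongr I I' m f' g') : PowCongr I I' (n + m) (f * f') (g * g') := by
  obtain ⟨hf, hg, hn⟩ := h
  obtain ⟨hf', hg', hm⟩ := h'
  refine ⟨pow_add I n m ▸ Ideal.mul_mem_mul hf hf', pow_add I n m ▸ Ideal.mul_mem_mul hg hg', ?_⟩
  match n, m, hn, hm with
  | 0, 0, hn, hm => exact congrArg₂ _ hn hm
  | 0, m + 1, hn, hm =>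
    rw [show 0 + (m + 1) = m + 1 by omega]
    change f = g at hn
    change f * f' - g * g' ∈ I' * I ^ m
    rw [hn, ← mul_sub]
    exact Ideal.mul_mem_left _ _ hm
  | n + 1, 0, hn, hm =>
    change f' = g' at hm
    change f * f' - g * g' ∈ I' * I ^ n
    rw [hm, ← sub_mul]
    exact Ideal.mul_mem_right _ _ hn
  | n + 1, m + 1, hn, hm =>
    change f * f' - g * g' ∈ I' * I ^ (n + 1 + m)
    have h1 : f * f' - g * g' = (f' - g') * f + (f - g) * g' := by ring
    rw [h1]
    refine add_mem ?_ ?_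
    · have := Ideal.mul_mem_mul hm hf
      rwa [mul_assoc, ← pow_add, add_comm m] at this
    · have := Ideal.mul_mem_mul hn hg'
      rwa [mul_assoc, ← pow_add, show n + (m + 1) = n + 1 + m by ring] at this

theorem PowCongr.one (I I' : Ideal A) : PowCongr I I' 0 1 1 := by
  refine ⟨by simp, by simp, ?_⟩
  rfl

theorem PowCongr.pow {I I' : Ideal A} {f g : A} (h : PowCongr I I' 1 f g) (k : ℕ) :
    PowCongr I I' k (f ^ k) (g ^ k) := by
  induction k with
  | zero => simpa using PowCongr.one I I'
  | succ k ih => rw [pow_succ, pow_succ]; exact ih.mul h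

theorem powCongr_mon {I I' : Ideal A} {u v : Fin M → A} (h : ∀ i, PowCongr I I' 1 (u i) (v i))
    (μ : Fin M → ℕ) : PowCongr I I' (∑ i, μ i) (mon u μ) (mon v μ) := by
  classical
  unfold mon
  induction (Finset.univ : Finset (Fin M)) using Finset.induction_on with
  | empty => simpa using PowCongr.one I I'
  | insert i S hi ih =>
    rw [Finset.prod_insert hi, Finset.prod_insert hi, Finset.sum_insert hi]
    exact ((h i).pow _).mul ih

theorem eval_sub_eval_mem {I I' : Ideal A} {u v : Fin M → A}
    (h : ∀ i, PowCongr I I' 1 (u i) (v i)) {t : ℕ} {F : MvPolynomial (Fin M) A}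
    (hF : F.IsHomogeneous (t + 1)) :
    MvPolynomial.eval u F - MvPolynomial.eval v F ∈ I' * I ^ t := by
  rw [MvPolynomial.eval_eq', MvPolynomial.eval_eq', ← Finset.sum_sub_distrib]
  refine Ideal.sum_mem _ fun μ hμ => ?_
  rw [← mul_sub]
  refine Ideal.mul_mem_left _ _ ?_
  have h1 : μ.degree = t + 1 := by
    have := hF (MvPolynomial.mem_support_iff.1 hμ)
    exact (DFunLike.congr_fun (Finsupp.degree_eq_weight_one (R := ℕ)) μ).trans this
  have h2 := powCongr_mon h μ
  rw [← Finsupp.degree_eq_sum, h1] at h2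
  exact h2.2.2

theorem sup_pow_succ_le (J Y : Ideal A) (t : ℕ) :
    (J ⊔ Y) ^ (t + 1) ≤ J * (J ⊔ Y) ^ t ⊔ Y ^ (t + 1) := by
  induction t with
  | zero => simp
  | succ t ih =>
    rw [pow_succ' _ (t + 1), Ideal.sup_mul]
    refine sup_le le_sup_left ?_
    refine (Ideal.mul_mono_right ih).trans ?_
    rw [Ideal.mul_sup]
    refine sup_le (le_sup_of_le_left ?_) (le_sup_of_le_right (by rw [← pow_succ']))
    rw [← mul_assoc, mul_comm Y J, mul_assoc]
    refine Ideal.mul_mono_right ?_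
    rw [pow_succ']
    exact Ideal.mul_mono_left le_sup_right

theorem eval_smul_of_isHomogeneous {F : MvPolynomial (Fin M) A} {s : ℕ} (hF : F.IsHomogeneous s)
    (y : A) (e : Fin M → A) :
    MvPolynomial.eval (fun i => y * e i) F = y ^ s * MvPolynomial.eval e F := by
  rw [MvPolynomial.eval_eq', MvPolynomial.eval_eq', Finset.mul_sum]
  refine Finset.sum_congr rfl fun μ hμ => ?_
  have h1 : μ.degree = s := by
    have := hF (MvPolynomial.mem_support_iff.1 hμ)
    exact (DFunLike.congr_fun (Finsupp.degree_eq_weight_one (R := ℕ)) μ).trans this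
  simp only [mul_pow, Finset.prod_mul_distrib]
  rw [Finset.prod_pow_eq_pow_sum, ← Finsupp.degree_eq_sum, h1]
  ring

/-- If `I ^ (t + 1) ≤ I' * I ^ t`, then `I` and `I'` define the same integral closures. -/
theorem W_powFilt_eq_of_reduction {I I' : Ideal A} (hle : I' ≤ I) {t : ℕ}
    (h : I ^ (t + 1) ≤ I' * I ^ t) (τ : ℝ) : (powFilt I).W τ = (powFilt I').W τ := by
  have h1 : ∀ j : ℕ, I ^ (t + j) ≤ I' ^ j := by
    intro j
    have : I ^ (t + j) ≤ I' ^ j * I ^ t := by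
      induction j with
      | zero => simp
      | succ j ih =>
        rw [← add_assoc, pow_succ, pow_succ, mul_assoc]
        refine (Ideal.mul_mono_left ih).trans ?_
        rw [mul_assoc, ← pow_succ]
        exact Ideal.mul_mono_right h
    exact this.trans Ideal.mul_le_left
  refine le_antisymm ?_ ?_
  · have := W_le_W (F := powFilt I) (G := powFilt I') (c := 1) (k₀ := t) one_pos (fun τ => ?_) τ
    · simpa using this
    · change I ^ ⌈τ⌉₊ ≤ I' ^ ⌈1 * τ - t⌉₊
      rw [one_mul]
      rcases le_or_gt τ t with hτ | hτ
      · rw [Nat.ceil_eq_zero.2 (show τ - t ≤ 0 by linarith)]; simp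
      · have h2 : ⌈τ - t⌉₊ = ⌈τ⌉₊ - t := Nat.ceil_sub_natCast _ _
        have h3 : t ≤ ⌈τ⌉₊ := by
          have := Nat.le_ceil τ
          exact_mod_cast hτ.le.trans this
        rw [h2]
        have := h1 (⌈τ⌉₊ - t)
        rwa [Nat.add_sub_cancel' h3] at this
  · have := W_le_W (F := powFilt I') (G := powFilt I) (c := 1) (k₀ := 0) one_pos (fun τ => ?_) τ
    · simpa using this
    · change I' ^ ⌈τ⌉₊ ≤ I ^ ⌈1 * τ - 0⌉₊
      rw [one_mul, sub_zero]
      exact Ideal.pow_right_mono hle _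

theorem exists_reduction_of_eval [IsLocalRing A] [IsNoetherianRing A] {a : Fin M → A}
    {s : ℕ} {F : MvPolynomial (Fin M) A}
    (hF : F.IsHomogeneous s)
    (hev : MvPolynomial.eval a F ∈ maximalIdeal A * Ideal.span (Set.range a) ^ s)
    {c : Fin M → A} (hc : MvPolynomial.eval c F ∉ maximalIdeal A) :
    ∃ (i₀ : Fin M) (a' : Fin M → A), a' i₀ = 0 ∧
      Ideal.span (Set.range a') ≤ Ideal.span (Set.range a) ∧ ∃ t : ℕ,
      Ideal.span (Set.range a) ^ (t + 1) ≤
        Ideal.span (Set.range a') * Ideal.span (Set.range a) ^ t := by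
  classical
  set I := Ideal.span (Set.range a) with hI
  have haI : ∀ i, a i ∈ I := fun i => Ideal.subset_span ⟨i, rfl⟩
  obtain ⟨t, rfl⟩ : ∃ t, s = t + 1 := by
    rcases s with _ | t
    · exfalso
      obtain ⟨u, rfl⟩ : ∃ u, F = MvPolynomial.C u :=
        ⟨_, MvPolynomial.totalDegree_eq_zero_iff_eq_C.1
          ((MvPolynomial.totalDegree_zero_iff_isHomogeneous _).2 hF)⟩
      rw [MvPolynomial.eval_C] at hev hc
      exact hc (by simpa using hev)
    · exact ⟨t, rfl⟩
  obtain ⟨i₀, hi₀⟩ : ∃ i₀, c i₀ ∉ maximalIdeal A := by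
    by_contra! hall
    have h1 := eval_sub_eval_mem (I := ⊤) (I' := maximalIdeal A) (u := c) (v := 0)
      (fun i => ⟨by simp, by simp, by change c i - 0 ∈ _; simpa using hall i⟩) hF
    have h2 : MvPolynomial.eval (0 : Fin M → A) F = 0 := by
      have := eval_smul_of_isHomogeneous hF 0 (0 : Fin M → A)
      have h3 : (fun i => (0 : A) * (0 : Fin M → A) i) = 0 := by ext; simp
      rw [h3] at this
      rw [this]; simp
    rw [h2, sub_zero] at h1
    exact hc (Ideal.mul_le_left h1)
  have hu : IsUnit (c i₀) := by simpa using hi₀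
  obtain ⟨v, hv⟩ := hu.exists_right_inv
  set e : Fin M → A := fun i => v * c i with he
  set y := a i₀ with hy
  set a' : Fin M → A := fun i => a i - y * e i with ha'
  set I' := Ideal.span (Set.range a') with hI'
  have ha'I : ∀ i, a' i ∈ I' := fun i => Ideal.subset_span ⟨i, rfl⟩
  have hle : I' ≤ I := by
    refine Ideal.span_le.2 ?_
    rintro _ ⟨i, rfl⟩
    exact sub_mem (haI i) (Ideal.mul_mem_right _ _ (haI i₀))
  refine ⟨i₀, a', ?_, hle, t, ?_⟩
  · simp only [ha', he, hy]
    rw [mul_comm v, hv, mul_one, sub_self]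
  have hIsup : I' ⊔ Ideal.span {y} = I := by
    refine le_antisymm (sup_le hle ((Ideal.span_singleton_le_iff_mem _).2 (haI i₀))) ?_
    refine Ideal.span_le.2 ?_
    rintro _ ⟨i, rfl⟩
    have : a i = a' i + y * e i := by simp [ha']
    rw [this]
    exact add_mem (Ideal.mem_sup_left (ha'I i))
      (Ideal.mem_sup_right (Ideal.mul_mem_right _ _ (Ideal.mem_span_singleton_self y)))
  have h1 : MvPolynomial.eval a F - MvPolynomial.eval (fun i => y * e i) F ∈ I' * I ^ t :=
    eval_sub_eval_mem (fun i => ⟨by simpa using haI i,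
      by simpa using Ideal.mul_mem_right _ _ (haI i₀), by simpa using ha'I i⟩) hF
  rw [eval_smul_of_isHomogeneous hF, he, eval_smul_of_isHomogeneous hF] at h1
  have hys : y ^ (t + 1) ∈ I' * I ^ t ⊔ maximalIdeal A * I ^ (t + 1) := by
    have hunit : IsUnit (v ^ (t + 1) * MvPolynomial.eval c F) := by
      refine IsUnit.mul (IsUnit.pow _ ?_) (by simpa using hc)
      exact IsUnit.of_mul_eq_one _ (by rw [mul_comm]; exact hv)
    rw [← Ideal.unit_mul_mem_iff_mem _ hunit]
    have h2 := sub_mem (Ideal.mem_sup_right hev : _ ∈ I' * I ^ t ⊔ maximalIdeal A * I ^ (t + 1))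
      (Ideal.mem_sup_left h1)
    rw [sub_sub_cancel, mul_comm (y ^ (t + 1))] at h2
    exact h2
  have hmain : I ^ (t + 1) ≤ I' * I ^ t ⊔ maximalIdeal A • I ^ (t + 1) := by
    have h3 := sup_pow_succ_le I' (Ideal.span {y}) t
    rw [hIsup] at h3
    refine h3.trans (sup_le le_sup_left ?_)
    rw [Ideal.span_singleton_pow, Ideal.span_singleton_le_iff_mem]
    exact hys
  exact Submodule.le_of_le_smul_of_le_jacobson_bot (IsNoetherian.noetherian _)
    (maximalIdeal_le_jacobson ⊥) hmain

end MulFilt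

section FlatExtension

variable {A B : Type*} [CommRing A] [CommRing B] [IsLocalRing A] [IsLocalRing B] [Algebra A B]
  [IsLocalHom (algebraMap A B)] [Module.Flat A B]

theorem colength_map_of_flat
    (hm : maximalIdeal B = (maximalIdeal A).map (algebraMap A B)) (J : Ideal A) :
    colength (J.map (algebraMap A B)) = colength J := by
  have h1 := IsLocalRing.length_baseChange A B (A ⧸ J)
  rw [(Algebra.TensorProduct.quotIdealMapEquivTensorQuot B J).symm.toLinearEquiv.length_eq,
    ← hm] at h1
  have h2 := colength_maximal (maximalIdeal B)
  rw [colength] at h2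
  rw [h2, mul_one] at h1
  exact h1

namespace MulFilt

theorem map_W_le (I : Ideal A) (t : ℝ) :
    ((powFilt I).W t).map (algebraMap A B) ≤ (powFilt (I.map (algebraMap A B))).W t := by
  refine Ideal.map_le_iff_le_comap.2 fun f hf => ?_
  rw [Ideal.mem_comap, mem_W]
  intro t' ht'
  obtain ⟨k, hk⟩ := mem_W.1 hf t' ht'
  refine ⟨k, fun s => ?_⟩
  have := Ideal.mem_map_of_mem (algebraMap A B) (hk s)
  rw [map_pow] at this
  change _ ∈ (I.map (algebraMap A B)) ^ _
  rw [← Ideal.map_pow]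
  exact this

theorem comap_W_eq (I : Ideal A) (t : ℝ) :
    ((powFilt (I.map (algebraMap A B))).W t).comap (algebraMap A B) = (powFilt I).W t := by
  have : Module.FaithfullyFlat A B := Module.FaithfullyFlat.of_flat_of_isLocalHom
  refine le_antisymm ?_ (Ideal.map_le_iff_le_comap.1 (map_W_le I t))
  intro f hf
  rw [Ideal.mem_comap, mem_W] at hf
  rw [mem_W]
  intro t' ht'
  obtain ⟨k, hk⟩ := hf t' ht'
  refine ⟨k, fun s => ?_⟩
  have h1 : algebraMap A B (f ^ s) ∈ (I.map (algebraMap A B)) ^ ⌈(s * t' - k : ℝ)⌉₊ := by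
    rw [map_pow]; exact hk s
  rw [← Ideal.map_pow, ← Ideal.mem_comap, Ideal.comap_map_eq_self_of_faithfullyFlat] at h1
  exact h1

theorem colength_W_eq (hm : maximalIdeal B = (maximalIdeal A).map (algebraMap A B))
    {I : Ideal A} {t : ℝ} (h : (powFilt (I.map (algebraMap A B))).W t ≤
      ((powFilt I).W t).map (algebraMap A B)) :
    colength ((powFilt (I.map (algebraMap A B))).W t) = colength ((powFilt I).W t) := by
  rw [le_antisymm h (map_W_le I t), colength_map_of_flat hm]

theorem MainBound.of_flat (hm : maximalIdeal B = (maximalIdeal A).map (algebraMap A B))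
    {I : Ideal A} {d : ℕ} (hW : ∀ t : ℝ, (powFilt (I.map (algebraMap A B))).W t ≤
      ((powFilt I).W t).map (algebraMap A B)) (h : MainBound (I.map (algebraMap A B)) d) :
    MainBound I d := by
  obtain ⟨L, hL, h⟩ := h
  exact ⟨L, fun n => (colength_W_eq hm (hW n)).symm.trans (hL n), h⟩

end MulFilt

end FlatExtension

universe u

section FiniteExtension

variable {A B : Type u} [CommRing A] [CommRing B] [Algebra A B]

theorem isAdicComplete_of_finite [IsNoetherianRing A] (I : Ideal A) [IsAdicComplete I A]
    (M : Type u) [AddCommGroup M] [Module A M] [Module.Finite A M] : IsAdicComplete I M := by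
  rw [← AdicCompletion.of_bijective_iff]
  have h1 : ∀ x, AdicCompletion.of I M x =
      AdicCompletion.ofTensorProduct I M (LinearEquiv.rTensor M (AdicCompletion.ofLinearEquiv I A)
        ((TensorProduct.lid A M).symm x)) := by
    intro x
    simp only [TensorProduct.lid_symm_apply, LinearEquiv.rTensor_tmul,
      AdicCompletion.ofLinearEquiv_apply, AdicCompletion.ofTensorProduct_tmul]
    exact (one_smul (AdicCompletion I A) _).symm
  have h2 : ⇑(AdicCompletion.of I M) = AdicCompletion.ofTensorProduct I M ∘
      (LinearEquiv.rTensor M (AdicCompletion.ofLinearEquiv I A)) ∘ (TensorProduct.lid A M).symm :=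
    funext h1
  rw [h2]
  exact (AdicCompletion.ofTensorProduct_bijective_of_finite_of_isNoetherian I M).comp
    ((LinearEquiv.bijective _).comp (LinearEquiv.bijective _))

variable [IsLocalRing A] [IsLocalRing B] [IsLocalHom (algebraMap A B)]

theorem ClassC.of_finite_free {d : ℕ} (hA : ClassC A d) [Module.Finite A B] [Module.Free A B]
    (hm : maximalIdeal B = (maximalIdeal A).map (algebraMap A B)) : ClassC B d := by
  have := hA.noeth
  have := hA.complete
  refine ⟨IsNoetherianRing.of_finite A B, ?_, ?_, ?_⟩
  · rw [hm, IsAdicComplete.map_algebraMap_iff]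
    exact isAdicComplete_of_finite _ _
  · obtain ⟨C, hC⟩ := hA.growth
    refine ⟨C, fun n => ?_⟩
    rw [hm, ← Ideal.map_pow, colength_map_of_flat hm]
    exact hC n
  · rintro z hz ⟨C, hC⟩
    have b := Module.Free.chooseBasis A B
    obtain ⟨j, hj⟩ : ∃ j, b.repr z j ≠ 0 := by
      by_contra! h
      exact hz (b.repr.map_eq_zero_iff.1 (Finsupp.ext h))
    set q := Module.length (ResidueField A) (ResidueField B) with hq
    obtain ⟨q', hq'⟩ : ∃ q' : ℕ, q = q' := by
      have : Module.Finite A (ResidueField B) := Module.Finite.trans B _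
      have : Module.Finite (ResidueField A) (ResidueField B) := Module.Finite.of_restrictScalars_finite A _ _
      exact ⟨_, Module.length_eq_finrank _ _⟩
    refine hA.unmixed _ hj ⟨C * q', fun n => ?_⟩
    set K := colonElem (maximalIdeal B ^ n) z with hK
    have h1 : K.comap (algebraMap A B) ≤ colonElem (maximalIdeal A ^ n) (b.repr z j) := by
      intro a ha
      rw [Ideal.mem_comap, hK, mem_colonElem, hm, ← Ideal.map_pow] at ha
      rw [mem_colonElem]
      have h3 : a • z ∈ (maximalIdeal A ^ n) • (⊤ : Submodule A B) := by
        rw [Ideal.smul_top_eq_map]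
        rw [Algebra.smul_def]
        exact ha
      have h4 : ∀ w ∈ (maximalIdeal A ^ n) • (⊤ : Submodule A B), b.coord j w ∈ maximalIdeal A ^ n := by
        intro w hw
        induction hw using Submodule.smul_induction_on' with
        | smul r hr y hy =>
          rw [map_smul, smul_eq_mul]
          exact Ideal.mul_mem_right _ _ hr
        | add y _ z _ h1 h2 => rw [map_add]; exact add_mem h1 h2
      simpa using h4 _ h3
    have h2 : colength (K.comap (algebraMap A B)) ≤ colength K * q := by
      rw [colength, colength, hq, ← IsLocalRing.length_restrictScalars A B (B ⧸ K)]
      have hker : K.comap (algebraMap A B) = LinearMap.ker (Algebra.linearMap A (B ⧸ K)) := by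
        ext a
        rw [Ideal.mem_comap, LinearMap.mem_ker, Algebra.linearMap_apply,
          IsScalarTower.algebraMap_apply A B (B ⧸ K), Ideal.Quotient.algebraMap_eq,
          Ideal.Quotient.eq_zero_iff_mem]
      rw [(Submodule.quotEquivOfEq _ _ hker).length_eq,
        (LinearMap.quotKerEquivRange (Algebra.linearMap A (B ⧸ K))).length_eq]
      exact Module.length_le_of_injective (Submodule.subtype _) (Submodule.subtype_injective _)
    refine (colength_anti h1).trans (h2.trans ?_)
    rw [hq']
    refine (mul_le_mul_left (hC n) _).trans (le_of_eq ?_)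
    push_cast; ring

end FiniteExtension

section ResidueExtension

open Polynomial in
theorem exists_monic_irreducible_natDegree_eq (k : Type*) [Field k] [Finite k] (s : ℕ) :
    ∃ h : k[X], h.Monic ∧ Irreducible h ∧ h.natDegree = s + 1 := by
  obtain ⟨p, hp⟩ := CharP.exists k
  have : Fact p.Prime := ⟨CharP.char_is_prime k p⟩
  obtain ⟨α, hα⟩ := Field.exists_primitive_element k (FiniteField.Extension k p (s + 1))
  have hα_int : IsIntegral k α := Algebra.IsIntegral.isIntegral α
  refine ⟨minpoly k α, minpoly.monic hα_int, minpoly.irreducible hα_int, ?_⟩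
  rw [(Field.primitive_element_iff_minpoly_natDegree_eq k α).1 hα, FiniteField.finrank_extension]

open Polynomial in
theorem exists_roots_adjoinRoot {k : Type*} [Field k] [Finite k] {h : k[X]} (hm : h.Monic)
    [hi : Fact (Irreducible h)] : h.Separable ∧ ∃ r : Fin h.natDegree → AdjoinRoot h,
      Function.Injective r ∧ ∀ i, aeval (r i) h = 0 := by
  have hsep : h.Separable := PerfectField.separable_of_irreducible hi.out
  have : Module.Finite k (AdjoinRoot h) := hm.finite_adjoinRoot
  have : Finite (AdjoinRoot h) := Module.finite_of_finite k
  have : Fintype (AdjoinRoot h) := Fintype.ofFinite _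
  have hroot : minpoly k (AdjoinRoot.root h) = h := by
    rw [AdjoinRoot.minpoly_root hm.ne_zero, hm.leadingCoeff]; simp
  have hsplit : (h.map (algebraMap k (AdjoinRoot h))).Splits := by
    have := Normal.splits (F := k) (K := AdjoinRoot h) inferInstance (AdjoinRoot.root h)
    rwa [hroot] at this
  refine ⟨hsep, ?_⟩
  have hcard := card_rootSet_eq_natDegree hsep hsplit
  have e : Fin h.natDegree ≃ h.rootSet (AdjoinRoot h) := 
    (Fin.castOrderIso hcard.symm).toEquiv.trans (Fintype.equivFin _).symm
  exact ⟨fun i => e i, Subtype.val_injective.comp e.injective,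
    fun i => aeval_eq_zero_of_mem_rootSet (e i).2⟩

open Polynomial in
theorem exists_finite_free_extension (A : Type u) [CommRing A] [IsNoetherianRing A] [IsLocalRing A]
    [IsAdicComplete (maximalIdeal A) A] [Finite (ResidueField A)] (s : ℕ) :
    ∃ (B : Type u) (_ : CommRing B) (_ : IsLocalRing B) (_ : Algebra A B)
      (_ : IsLocalHom (algebraMap A B)) (_ : Module.Finite A B) (_ : Module.Free A B),
      maximalIdeal B = (maximalIdeal A).map (algebraMap A B) ∧
      (s : Cardinal) ≤ Cardinal.mk (ResidueField B) ∧
      ∃ (q : ℕ) (b : Module.Basis (Fin q) A B) (σ : Fin q → B →ₐ[A] B),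
        IsUnit (Matrix.of fun i j => σ i (b j)).det := by
  obtain ⟨h, hm, hi, hdeg⟩ := exists_monic_irreducible_natDegree_eq (ResidueField A) s
  have : Fact (Irreducible h) := ⟨hi⟩
  obtain ⟨hsep, r, hr, hr0⟩ := exists_roots_adjoinRoot hm
  obtain ⟨g, hg, hgd, hgm⟩ := lifts_and_degree_eq_and_monic (f := residue A) (p := h)
    (by
      rw [lifts_iff_coeff_lifts]
      exact fun n => residue_surjective _) hm
  let B := AdjoinRoot g
  let I : Ideal B := (maximalIdeal A).map (algebraMap A B)
  let π : B →+* AdjoinRoot h := AdjoinRoot.lift ((algebraMap _ (AdjoinRoot h)).comp (residue A))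
    (AdjoinRoot.root h) (by
      rw [← eval₂_map, hg]
      exact AdjoinRoot.eval₂_root h)
  have hπ : ∀ f : A[X], π (AdjoinRoot.mk g f) = AdjoinRoot.mk h (f.map (residue A)) := by
    intro f
    rw [AdjoinRoot.lift_mk, ← eval₂_map, ← AdjoinRoot.aeval_eq, aeval_def]
  have hπs : Function.Surjective π := by
    intro y
    obtain ⟨f, rfl⟩ := AdjoinRoot.mk_surjective y
    obtain ⟨F, rfl⟩ := Polynomial.map_surjective _ (residue_surjective (R := A)) f
    exact ⟨_, hπ F⟩
  have hker : RingHom.ker π = I := by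
    refine le_antisymm ?_ ?_
    · intro z hz
      obtain ⟨f, rfl⟩ := AdjoinRoot.mk_surjective z
      rw [RingHom.mem_ker, hπ, AdjoinRoot.mk_eq_zero] at hz
      obtain ⟨w, hw⟩ := hz
      obtain ⟨U, rfl⟩ := Polynomial.map_surjective _ (residue_surjective (R := A)) w
      have h1 : AdjoinRoot.mk g f = AdjoinRoot.mk g (f - g * U) := by
        rw [map_sub, map_mul, AdjoinRoot.mk_self]; ring
      have h2 : f - g * U ∈ (maximalIdeal A).map (C : A →+* A[X]) := by
        rw [Ideal.mem_map_C_iff]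
        intro n
        rw [← residue_eq_zero_iff, ← coeff_map]
        simp [hw, hg]
      rw [h1]
      have h3 := Ideal.mem_map_of_mem (AdjoinRoot.mk g) h2
      rw [Ideal.map_map] at h3
      exact h3
    · refine Ideal.map_le_iff_le_comap.2 fun a ha => ?_
      rw [Ideal.mem_comap, RingHom.mem_ker]
      change π (AdjoinRoot.mk g (C a)) = 0
      rw [hπ, map_C, (residue_eq_zero_iff a).2 ha]
      simp
  have hfin : Module.Finite A B := hgm.finite_adjoinRoot
  have hfree : Module.Free A B := hgm.free_adjoinRoot
  have hImax : I.IsMaximal := hker ▸ RingHom.ker_isMaximal_of_surjective π hπs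
  have hIc : IsAdicComplete I B := by
    rw [IsAdicComplete.map_algebraMap_iff]
    exact isAdicComplete_of_finite _ _
  have hloc : IsLocalRing B := isLocalRing_of_isAdicComplete_maximal I
  have hmI : maximalIdeal B = I := (IsLocalRing.eq_maximalIdeal hImax).symm
  have hlh : IsLocalHom (algebraMap A B) := by
    refine ((IsLocalRing.local_hom_TFAE (algebraMap A B)).out 0 2).2 ?_
    rw [hmI]
  have hunit : ∀ x : B, π x ≠ 0 → IsUnit x := by
    intro x hx
    by_contra hx'
    have : x ∈ I := hmI ▸ (mem_maximalIdeal _).2 hx'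
    rw [← hker] at this
    exact hx this
  have hroot : ∀ i, ∃ θ : B, aeval θ g = 0 ∧ π θ = r i := by
    intro i
    obtain ⟨a₀, ha₀⟩ := hπs (r i)
    have hev : ∀ f : A[X], π (eval a₀ (f.map (algebraMap A B))) = aeval (r i) (f.map (residue A)) := by
      intro f
      rw [aeval_def, eval₂_map, eval_map, hom_eval₂, ha₀]
      congr 1
      ext a
      change π (AdjoinRoot.mk g (C a)) = _
      rw [hπ, map_C]; rfl
    obtain ⟨θ, h1, h2⟩ := HenselianRing.is_henselian (I := I) (g.map (algebraMap A B)) (hgm.map _) a₀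
      (by rw [← hker, RingHom.mem_ker, hev, hg, hr0])
      (by
        refine (hunit _ ?_).map _
        rw [derivative_map, hev, ← derivative_map, hg]
        exact hsep.aeval_derivative_ne_zero (hr0 i))
    refine ⟨θ, ?_, ?_⟩
    · rw [aeval_def, ← eval_map]; exact h1
    · rw [← hker, RingHom.mem_ker, map_sub, sub_eq_zero] at h2
      rw [h2, ha₀]
  choose θ hθ hθr using hroot
  have hdim : (AdjoinRoot.powerBasis' hgm).dim = h.natDegree := by
    rw [AdjoinRoot.powerBasis'_dim]
    exact natDegree_eq_of_degree_eq hgd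
  have hdu : ∀ i j, i ≠ j → IsUnit (θ i - θ j) := by
    intro i j hij
    refine hunit _ ?_
    rw [map_sub, hθr, hθr]
    exact sub_ne_zero.2 fun h => hij (hr h)
  refine ⟨B, inferInstance, hloc, inferInstance, hlh, hfin, hfree, hmI, ?_, h.natDegree,
    (AdjoinRoot.powerBasis' hgm).basis.reindex (finCongr hdim),
    fun i => AdjoinRoot.liftAlgHom g (Algebra.ofId A B) (θ i) (hθ i), ?_⟩
  · have : Function.Injective fun i => residue B (θ i) := by
      intro i j hij
      by_contra hne
      have h1 := (mem_maximalIdeal _).1 ((residue_eq_zero_iff _).1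
        (show residue B (θ i - θ j) = 0 by rw [map_sub]; exact sub_eq_zero.2 hij))
      exact h1 (hdu i j hne)
    have h1 := Cardinal.lift_mk_le_lift_mk_of_injective this
    simp only [Cardinal.mk_fin, Cardinal.lift_natCast, Cardinal.lift_id'] at h1
    refine le_trans ?_ h1
    exact_mod_cast (by omega : s ≤ h.natDegree)
  · have : (Matrix.of fun i j => AdjoinRoot.liftAlgHom g (Algebra.ofId A B) (θ i) (hθ i)
        ((AdjoinRoot.powerBasis' hgm).basis.reindex (finCongr hdim) j)) = Matrix.vandermonde θ := by
      ext i j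
      rw [Matrix.of_apply, Matrix.vandermonde_apply, Module.Basis.reindex_apply,
        PowerBasis.basis_eq_pow, map_pow, AdjoinRoot.powerBasis'_gen]
      exact congrArg (· ^ (j : ℕ)) (AdjoinRoot.liftAlgHom_root (p := g) (Algebra.ofId A B) (θ i) (hθ i))
    rw [this, Matrix.det_vandermonde, IsUnit.prod_iff]
    intro i _
    rw [IsUnit.prod_iff]
    intro j hj
    exact hdu j i (Finset.mem_Ioi.1 hj).ne'

namespace MulFilt

theorem W_map_le_of_basis {A B : Type*} [CommRing A] [CommRing B] [IsLocalRing A] [IsLocalRing B]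
    [Algebra A B] [IsLocalHom (algebraMap A B)] [Module.Flat A B] {q : ℕ}
    (b : Module.Basis (Fin q) A B) (σ : Fin q → B →ₐ[A] B)
    (hdet : IsUnit (Matrix.of fun i j => σ i (b j)).det) (I : Ideal A) (t : ℝ) :
    (powFilt (I.map (algebraMap A B))).W t ≤ ((powFilt I).W t).map (algebraMap A B) := by
  intro z hz
  have hσ : ∀ i, σ i z ∈ (powFilt (I.map (algebraMap A B))).W t := by
    intro i
    rw [mem_W] at hz ⊢
    intro t' ht'
    obtain ⟨k, hk⟩ := hz t' ht'
    refine ⟨k, fun s => ?_⟩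
    have h1 := Ideal.mem_map_of_mem (σ i : B →+* B) (hk s)
    change _ ∈ Ideal.map _ ((I.map (algebraMap A B)) ^ _) at h1
    rw [Ideal.map_pow, Ideal.map_map, AlgHom.comp_algebraMap] at h1
    rw [← map_pow]
    exact h1
  set M := Matrix.of fun i j => σ i (b j) with hM
  have h1 : M.mulVec (fun j => algebraMap A B (b.repr z j)) = fun i => σ i z := by
    funext i
    rw [Matrix.mulVec, dotProduct]
    conv_rhs => rw [← b.sum_repr z, map_sum]
    refine Finset.sum_congr rfl fun j _ => ?_
    rw [map_smul, Algebra.smul_def, mul_comm]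
    rfl
  have h2 : (fun j => algebraMap A B (b.repr z j)) = M⁻¹.mulVec fun i => σ i z := by
    rw [← h1, Matrix.mulVec_mulVec, Matrix.nonsing_inv_mul _ hdet, Matrix.one_mulVec]
  have h3 : ∀ j, b.repr z j ∈ (powFilt I).W t := by
    intro j
    rw [← comap_W_eq (B := B), Ideal.mem_comap]
    rw [show algebraMap A B (b.repr z j) = ∑ i, M⁻¹ j i * σ i z from congrFun h2 j]
    exact Ideal.sum_mem _ fun i _ => Ideal.mul_mem_left _ _ (hσ i)
  rw [← b.sum_repr z]
  refine Ideal.sum_mem _ fun j _ => ?_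
  rw [Algebra.smul_def]
  exact Ideal.mul_mem_right _ _ (Ideal.mem_map_of_mem _ (h3 j))

end MulFilt

end ResidueExtension

namespace MulFilt

theorem mainBound_of_relation {A : Type*} [CommRing A] [IsLocalRing A] {d N : ℕ} (hA : ClassC A d)
    (ih : ∀ a : Fin N → A, (∀ i, a i ∈ maximalIdeal A) → colength (Ideal.span (Set.range a)) ≠ ⊤ →
      MainBound (Ideal.span (Set.range a)) d)
    {a : Fin (N + 1) → A} (ha : ∀ i, a i ∈ maximalIdeal A)
    (hcol : colength (Ideal.span (Set.range a)) ≠ ⊤) {s : ℕ} {F : MvPolynomial (Fin (N + 1)) A}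
    (hF : F.IsHomogeneous s)
    (hev : MvPolynomial.eval a F ∈ maximalIdeal A * Ideal.span (Set.range a) ^ s)
    (hF0 : MvPolynomial.map (residue A) F ≠ 0) (hs : (s : Cardinal) ≤ Cardinal.mk (ResidueField A)) :
    MainBound (Ideal.span (Set.range a)) d := by
  have := hA.noeth
  obtain ⟨c', hc'⟩ : ∃ c' : Fin (N + 1) → ResidueField A,
      MvPolynomial.eval c' (MvPolynomial.map (residue A) F) ≠ 0 := by
    by_contra! h
    exact hF0 ((hF.map (residue A)).eq_zero_of_forall_eval_eq_zero_of_le_card h hs)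
  choose c hc using fun i => residue_surjective (c' i)
  have hcF : MvPolynomial.eval c F ∉ maximalIdeal A := by
    rw [← residue_eq_zero_iff]
    have : residue A (MvPolynomial.eval c F) =
        MvPolynomial.eval c' (MvPolynomial.map (residue A) F) := by
      rw [MvPolynomial.eval_map, MvPolynomial.eval, MvPolynomial.coe_eval₂Hom,
        MvPolynomial.eval₂_comp_left]
      congr 1
      exact funext hc
    rwa [this]
  obtain ⟨i₀, a', h0, hle, t, ht⟩ := exists_reduction_of_eval hF hev hcF
  set I := Ideal.span (Set.range a)
  have hI : I ≤ maximalIdeal A := Ideal.span_le.2 (by rintro _ ⟨i, rfl⟩; exact ha i)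
  have hrange : Ideal.span (Set.range a') = Ideal.span (Set.range (a' ∘ i₀.succAbove)) := by
    refine le_antisymm (Ideal.span_le.2 ?_) (Ideal.span_mono (Set.range_comp_subset_range _ _))
    rintro _ ⟨i, rfl⟩
    rcases Fin.eq_self_or_eq_succAbove i₀ i with rfl | ⟨j, rfl⟩
    · rw [h0]; exact Ideal.zero_mem _
    · exact Ideal.subset_span ⟨j, rfl⟩
  have hfin : colength (Ideal.span (Set.range a')) ≠ ⊤ := by
    obtain ⟨c, hc⟩ := exists_maximalIdeal_pow_le hcol
    have h1 : maximalIdeal A ^ (c * (t + 1)) ≤ Ideal.span (Set.range a') := by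
      rw [pow_mul]
      exact (Ideal.pow_right_mono hc _).trans (ht.trans Ideal.mul_le_left)
    exact ne_top_of_le_ne_top (colength_pow_ne_top hA _) (colength_anti h1)
  obtain ⟨L, hL, h⟩ := ih (a' ∘ i₀.succAbove)
    (fun i => hI (hle (Ideal.subset_span ⟨_, rfl⟩))) (by rwa [← hrange])
  rw [← hrange] at hL
  exact ⟨L, fun n => by rw [W_powFilt_eq_of_reduction hle ht]; exact hL n, h⟩

theorem mainBound_span_range {d : ℕ} (hd : 0 < d) : ∀ (N : ℕ) (A : Type u) [CommRing A]
    [IsLocalRing A], ClassC A d → ∀ a : Fin N → A, (∀ i, a i ∈ maximalIdeal A) →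
      colength (Ideal.span (Set.range a)) ≠ ⊤ → MainBound (Ideal.span (Set.range a)) d := by
  intro N
  induction N with
  | zero =>
    intro A _ _ hA a ha hcol
    have h0 : Ideal.span (Set.range a) = Ideal.span (Set.range (fun _ : Fin d => (0 : A))) := by
      rw [Set.range_eq_empty, Ideal.span_empty, eq_comm, eq_bot_iff, Ideal.span_le]
      rintro _ ⟨i, rfl⟩
      exact rfl
    rw [h0] at hcol ⊢
    exact mainBound_span hA hd (fun _ => Ideal.zero_mem _) hcol
  | succ N ih =>
    intro A _ _ hA a ha hcol
    by_cases hN : N + 1 ≤ d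
    · let x : Fin d → A := fun i => if h : (i : ℕ) < N + 1 then a ⟨i, h⟩ else 0
      have hx : ∀ (i : Fin d) (h : (i : ℕ) < N + 1), x i = a ⟨i, h⟩ := fun i h => dif_pos h
      have hx' : ∀ i : Fin d, ¬ (i : ℕ) < N + 1 → x i = 0 := fun i h => dif_neg h
      have h0 : Ideal.span (Set.range a) = Ideal.span (Set.range x) := by
        refine le_antisymm (Ideal.span_le.2 ?_) (Ideal.span_le.2 ?_)
        · rintro _ ⟨i, rfl⟩
          exact Ideal.subset_span ⟨⟨i, i.2.trans_le hN⟩, hx _ i.2⟩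
        · rintro _ ⟨i, rfl⟩
          by_cases h : (i : ℕ) < N + 1
          · rw [hx i h]; exact Ideal.subset_span ⟨_, rfl⟩
          · rw [hx' i h]; exact Ideal.zero_mem _
      rw [h0] at hcol ⊢
      refine mainBound_span hA hd (fun i => ?_) hcol
      by_cases h : (i : ℕ) < N + 1
      · rw [hx i h]; exact ha _
      · rw [hx' i h]; exact Ideal.zero_mem _
    · have := hA.noeth
      have := hA.complete
      obtain ⟨s, F, hF, hev, hF0⟩ := exists_homogeneous_relation hA ha hcol (by omega)
      by_cases hs : (s : Cardinal) ≤ Cardinal.mk (ResidueField A)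
      · exact mainBound_of_relation hA (ih A hA) ha hcol hF hev hF0 hs
      have hfin : Finite (ResidueField A) := by
        rw [← Cardinal.mk_lt_aleph0_iff]
        exact (not_le.1 hs).trans Cardinal.natCast_lt_aleph0
      obtain ⟨B, _, _, _, _, _, _, hm, hsB, q, b, σ, hdet⟩ := exists_finite_free_extension A s
      have hspan : (Ideal.span (Set.range a)).map (algebraMap A B) =
          Ideal.span (Set.range (algebraMap A B ∘ a)) := by
        rw [Ideal.map_span, Set.range_comp]
      refine MainBound.of_flat hm (W_map_le_of_basis b σ hdet _) ?_
      have hB := ClassC.of_finite_free hA hm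
      rw [hspan]
      refine mainBound_of_relation (s := s) (F := MvPolynomial.map (algebraMap A B) F) hB
        (ih B hB) (fun i => ?_) ?_ (hF.map _) ?_ ?_ hsB
      · rw [hm]; exact Ideal.mem_map_of_mem _ (ha i)
      · rw [← hspan, colength_map_of_flat hm]; exact hcol
      · have h1 := Ideal.mem_map_of_mem (algebraMap A B) hev
        rw [Ideal.map_mul, Ideal.map_pow, hspan, ← hm] at h1
        rw [MvPolynomial.eval_map]
        rw [MvPolynomial.eval, MvPolynomial.coe_eval₂Hom, MvPolynomial.eval₂_comp_left] at h1
        exact h1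
      · intro h
        refine hF0 (MvPolynomial.map_injective (ResidueField.map (algebraMap A B))
          (ResidueField.map (algebraMap A B)).injective ?_)
        rw [MvPolynomial.map_map, map_zero, ← h, MvPolynomial.map_map]
        rfl

theorem mainBound {A : Type u} [CommRing A] [IsLocalRing A] {d : ℕ} (hd : 0 < d)
    (hA : ClassC A d) {I : Ideal A} (hI : I ≤ maximalIdeal A) (hcol : colength I ≠ ⊤) :
    MainBound I d := by
  have := hA.noeth
  obtain ⟨N, a, ha⟩ := Submodule.fg_iff_exists_fin_generating_family.1
    ((isNoetherianRing_iff_ideal_fg A).1 inferInstance I)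
  obtain rfl : Ideal.span (Set.range a) = I := ha
  exact mainBound_span_range hd N A hA a (fun i => hI (Ideal.subset_span ⟨i, rfl⟩)) hcol

end MulFilt

section AsymptoticIntegralClosure

theorem radical_span_singleton_eq_maximalIdeal {E : Type*} [CommRing E] [IsNoetherianRing E]
    [IsLocalRing E] [IsDomain E] {f : E} (hf0 : f ≠ 0) (hf : f ∈ maximalIdeal E)
    (h : ∀ q : Ideal E, q.IsPrime → q ≠ ⊥ → f ∈ q) :
    (Ideal.span {f}).radical = maximalIdeal E := by
  have hle : Ideal.span {f} ≤ maximalIdeal E := (Ideal.span_singleton_le_iff_mem _).2 hf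
  have key : maximalIdeal E ∈ (Ideal.span {f}).minimalPrimes := by
    by_contra hmin
    have hfin : (Ideal.span {f}).minimalPrimes.Finite :=
      Ideal.finite_minimalPrimes_of_isNoetherianRing _ _
    have h1 : ¬ ((maximalIdeal E : Set E) ⊆
        ⋃ p ∈ (hfin.toFinset : Set (Ideal E)), ((id p : Ideal E) : Set E)) := by
      rw [Ideal.subset_union_prime ⊥ ⊥]
      · rintro ⟨p, hp, hle⟩
        have hp' : p ∈ (Ideal.span {f}).minimalPrimes := by simpa using hp
        have := hp'.1.1
        rw [(IsLocalRing.maximalIdeal.isMaximal E).eq_of_le this.ne_top hle] at hmin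
        exact hmin hp'
      · intro p hp _ _
        have hp' : p ∈ (Ideal.span {f}).minimalPrimes := by simpa using hp
        exact hp'.1.1
    obtain ⟨y, hym, hy⟩ := Set.not_subset.1 h1
    have hy' : ∀ p ∈ (Ideal.span {f}).minimalPrimes, y ∉ p := by
      intro p hp hyp
      exact hy (Set.mem_biUnion (x := p) (by simpa using hp) hyp)
    have hyle : Ideal.span {y} ≤ maximalIdeal E := (Ideal.span_singleton_le_iff_mem _).2 hym
    obtain ⟨Q, hQ, hQm⟩ := Ideal.exists_minimalPrimes_le hyle
    have hQp := hQ.1.1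
    have hyQ : y ∈ Q := hQ.1.2 (Ideal.mem_span_singleton_self y)
    have hy0 : y ≠ 0 := by
      rintro rfl
      obtain ⟨p, hp, -⟩ := Ideal.exists_minimalPrimes_le hle
      exact hy' p hp (Ideal.zero_mem _)
    have hfQ : f ∈ Q := h Q hQp (fun hb => hy0 (by rwa [hb] at hyQ))
    obtain ⟨p, hp, hpQ⟩ := Ideal.exists_minimalPrimes_le
      ((Ideal.span_singleton_le_iff_mem _).2 hfQ)
    have hpp := hp.1.1
    have hfp : f ∈ p := hp.1.2 (Ideal.mem_span_singleton_self f)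
    have hlt1 : p < Q := lt_of_le_of_ne hpQ (fun he => hy' p hp (he ▸ hyQ))
    have hlt2 : (⊥ : Ideal E) < p := bot_lt_iff_ne_bot.2 (fun hb => hf0 (by rwa [hb] at hfp))
    have hb : (⊥ : Ideal E).IsPrime := Ideal.isPrime_bot
    have a1 := Ideal.height_strict_mono_of_isPrime_of_isPrime hlt1
    have a2 := Ideal.height_strict_mono_of_isPrime_of_isPrime hlt2
    have a3 := Ideal.height_le_one_of_isPrincipal_of_mem_minimalPrimes _ Q hQ
    have a4 : p.height = 0 := by
      have := a1.trans_le a3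
      exact Order.lt_one_iff.1 this
    rw [a4] at a2
    exact not_lt_bot a2
  refine le_antisymm ((IsLocalRing.maximalIdeal.isMaximal E).isPrime.radical_le_iff.2 hle) ?_
  rw [← Ideal.sInf_minimalPrimes]
  refine le_sInf fun p hp => ?_
  exact key.2 hp.1 (le_maximalIdeal hp.1.1.ne_top)

theorem isNilpotent_of_forall_pow_mem {E : Type*} [CommRing E] [IsNoetherianRing E]
    [IsLocalRing E] {f : E} (h : ∀ M : ℕ, ∃ k : ℕ, ∀ u, f ^ (u + k) ∈ maximalIdeal E ^ (M * u - k)) :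
    IsNilpotent f := by
  by_contra hnil
  rw [nilpotent_iff_mem_prime] at hnil
  push Not at hnil
  obtain ⟨q₀, hq₀, hfq₀⟩ := hnil
  obtain ⟨q, ⟨hq, hfq⟩, hmax⟩ := set_has_maximal_iff_noetherian.2
    (inferInstance : IsNoetherian E E) {q : Ideal E | q.IsPrime ∧ f ∉ q} ⟨q₀, hq₀, hfq₀⟩
  let D := E ⧸ q
  have : Nontrivial D := Ideal.Quotient.nontrivial_iff.2 hq.ne_top
  have : IsLocalRing D := IsLocalRing.of_surjective' _ Ideal.Quotient.mk_surjective
  let g : D := Ideal.Quotient.mk q f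
  have hg0 : g ≠ 0 := fun h0 => hfq (Ideal.Quotient.eq_zero_iff_mem.1 h0)
  have hmle : (maximalIdeal E).map (Ideal.Quotient.mk q) ≤ maximalIdeal D :=
    ((IsLocalRing.local_hom_TFAE (Ideal.Quotient.mk q)).out 0 2).1
      (IsLocalHom.of_surjective _ Ideal.Quotient.mk_surjective)
  have hg : ∀ M : ℕ, ∃ k : ℕ, ∀ u, g ^ (u + k) ∈ maximalIdeal D ^ (M * u - k) := by
    intro M
    obtain ⟨k, hk⟩ := h M
    refine ⟨k, fun u => ?_⟩
    have h1 := Ideal.mem_map_of_mem (Ideal.Quotient.mk q) (hk u)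
    rw [Ideal.map_pow, map_pow] at h1
    exact Ideal.pow_right_mono hmle _ h1
  have hgm : g ∈ maximalIdeal D := by
    obtain ⟨k, hk⟩ := hg 1
    have h1 := hk (k + 1)
    rw [show 1 * (k + 1) - k = 1 by omega, pow_one] at h1
    exact (IsLocalRing.maximalIdeal.isMaximal D).isPrime.mem_of_pow_mem _ h1
  have hrad := radical_span_singleton_eq_maximalIdeal hg0 hgm (by
    intro p hp hpb
    by_contra hgp
    have hc : (p.comap (Ideal.Quotient.mk q)).IsPrime := Ideal.comap_isPrime _ _
    refine hmax (p.comap (Ideal.Quotient.mk q)) ⟨hc, hgp⟩ ?_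
    refine lt_of_le_of_ne ?_ ?_
    · intro x hx
      rw [Ideal.mem_comap, Ideal.Quotient.eq_zero_iff_mem.2 hx]
      exact Ideal.zero_mem _
    · intro he
      refine hpb ?_
      rw [eq_bot_iff]
      intro y hy
      obtain ⟨x, rfl⟩ := Ideal.Quotient.mk_surjective y
      have : x ∈ q := he ▸ hy
      exact Ideal.Quotient.eq_zero_iff_mem.2 this)
  obtain ⟨c, hc⟩ := Ideal.exists_radical_pow_le_of_fg (Ideal.span {g}) (IsNoetherian.noetherian _)
  rw [hrad] at hc
  obtain ⟨k, hk⟩ := hg (2 * c)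
  have hc0 : c ≠ 0 := by
    rintro rfl
    rw [pow_zero, Ideal.one_eq_top, top_le_iff, Ideal.span_singleton_eq_top] at hc
    exact (mem_maximalIdeal _).1 hgm hc
  have h1 := hk (2 * k + 1)
  have h2 : maximalIdeal D ^ (2 * c * (2 * k + 1) - k) ≤ Ideal.span {g ^ (2 * k + 1 + k + 1)} := by
    refine (Ideal.pow_le_pow_right ?_).trans ((pow_mul (maximalIdeal D) c _).le.trans
      ((Ideal.pow_right_mono hc (2 * k + 1 + k + 1)).trans (Ideal.span_singleton_pow _ _).le))
    have : 1 ≤ c := Nat.one_le_iff_ne_zero.2 hc0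
    refine Nat.le_sub_of_add_le ?_
    nlinarith
  have h3 := h2 h1
  rw [Ideal.mem_span_singleton, pow_dvd_pow_iff hg0 ((mem_maximalIdeal _).1 hgm)] at h3
  omega

open Polynomial in
theorem mem_integralOverIdeal_of_forall_pow_mem {R : Type*} [CommRing R] [IsNoetherianRing R]
    {J : Ideal R} {f : R} (h : ∀ M : ℕ, ∃ k : ℕ, ∀ u, f ^ ((M + 1) * u) ∈ J ^ (M * u - k)) :
    ∃ m : ℕ, 0 < m ∧ ∃ a : ℕ → R, (∀ j, 1 ≤ j → j ≤ m → a j ∈ J ^ j) ∧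
      f ^ m + ∑ j ∈ Finset.Icc 1 m, a j * f ^ (m - j) = 0 := by
  let L := Localization.Away f
  let w : L := IsLocalization.Away.invSelf f
  have hw : algebraMap R L f * w = 1 := IsLocalization.Away.mul_invSelf f
  let ρ : reesAlgebra J →ₐ[R] L := (aeval w).comp (reesAlgebra J).val
  let C := ρ.range
  let τ : reesAlgebra J →ₐ[R] C := ρ.rangeRestrict
  have hτ : Function.Surjective τ := ρ.rangeRestrict_surjective
  have hCn : IsNoetherianRing C := isNoetherianRing_of_surjective _ _ (τ : reesAlgebra J →+* C) hτ
  let 𝔞 : Ideal (reesAlgebra J) :=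
    RingHom.ker ((constantCoeff : R[X] →+* R).comp ((reesAlgebra J).val : reesAlgebra J →+* R[X]))
  let P₀ : Ideal C := 𝔞.map (τ : reesAlgebra J →+* C)
  let F : C := algebraMap R C f
  have hFu : ∀ x : C, (F * x : C) = 0 → x = 0 := by
    intro x hx
    have h1 : algebraMap R L f * (x : L) = 0 := congrArg Subtype.val hx
    refine Subtype.ext ?_
    calc (x : L) = w * (algebraMap R L f * x) := by linear_combination (-(x : L)) * hw
      _ = 0 := by rw [h1, mul_zero]
  have hFpow : ∀ (n : ℕ) (x y : C), F ^ n * x = F ^ n * y → x = y := by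
    intro n
    induction n with
    | zero => intro x y hxy; simpa using hxy
    | succ n ih =>
      intro x y hxy
      refine ih x y (sub_eq_zero.1 (hFu _ ?_))
      linear_combination hxy
  have hJ : J.map (algebraMap R C) ≤ Ideal.span {F} * P₀ := by
    refine Ideal.map_le_iff_le_comap.2 fun j hj => ?_
    let y : reesAlgebra J := ⟨monomial 1 j, reesAlgebra.monomial_mem.2 (by simpa using hj)⟩
    have hy : y ∈ 𝔞 := by
      change constantCoeff (monomial 1 j) = 0
      simp [coeff_monomial]
    have h1 : algebraMap R C j = F * τ y := by
      refine Subtype.ext ?_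
      change algebraMap R L j = algebraMap R L f * aeval w (monomial 1 j)
      rw [aeval_monomial, pow_one]
      linear_combination (-algebraMap R L j) * hw
    rw [Ideal.mem_comap, h1]
    exact Ideal.mul_mem_mul (Ideal.mem_span_singleton_self F)
      (Ideal.mem_map_of_mem (τ : reesAlgebra J →+* C) hy)
  by_cases hP : P₀ = ⊤
  · have h1 : (1 : C) ∈ P₀ := hP ▸ Submodule.mem_top
    obtain ⟨p, hp, hp1⟩ := (Ideal.mem_map_iff_of_surjective (τ : reesAlgebra J →+* C) hτ).1 h1
    have hp0 : (p : R[X]).coeff 0 = 0 := hp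
    have hpw : aeval w (p : R[X]) = 1 := congrArg Subtype.val hp1
    set m := (p : R[X]).natDegree + 1 with hm
    have hsum : algebraMap R L (f ^ m - ∑ j ∈ Finset.Icc 1 m, (p : R[X]).coeff j * f ^ (m - j)) = 0 := by
      have h2 : aeval w (p : R[X]) = ∑ j ∈ Finset.Icc 1 m, algebraMap R L ((p : R[X]).coeff j) * w ^ j := by
        rw [aeval_eq_sum_range' (n := m + 1) (by omega), Finset.sum_range_succ', hp0]
        simp only [map_zero, zero_mul, add_zero, Algebra.smul_def]
        rw [← Finset.sum_image (s := range m) (g := fun j => j + 1)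
          (f := fun j => algebraMap R L ((p : R[X]).coeff j) * w ^ j) (by intro a _ b _ h; simpa using h)]
        refine Finset.sum_congr ?_ fun _ _ => rfl
        ext j
        simp only [Finset.mem_image, Finset.mem_range, Finset.mem_Icc]
        constructor
        · rintro ⟨a, ha, rfl⟩; omega
        · intro hj; exact ⟨j - 1, by omega, by omega⟩
      rw [map_sub, map_sum, sub_eq_zero]
      calc algebraMap R L (f ^ m) = algebraMap R L f ^ m * aeval w (p : R[X]) := by
            rw [hpw, mul_one, map_pow]
        _ = _ := by
          rw [h2, Finset.mul_sum]
          refine Finset.sum_congr rfl fun j hj => ?_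
          have hjm := (Finset.mem_Icc.1 hj).2
          rw [map_mul, map_pow]
          have h3 : algebraMap R L f ^ m = algebraMap R L f ^ (m - j) * algebraMap R L f ^ j := by
            rw [← pow_add]; congr 1; omega
          have h4 : algebraMap R L f ^ j * w ^ j = 1 := by rw [← mul_pow, hw, one_pow]
          rw [h3]
          linear_combination (algebraMap R L f ^ (m - j) * algebraMap R L ((p : R[X]).coeff j)) * h4
    obtain ⟨⟨_, N, rfl⟩, hN⟩ := (IsLocalization.map_eq_zero_iff (Submonoid.powers f) L _).1 hsum
    refine ⟨N + m, by omega, fun j => if j ≤ m then -(p : R[X]).coeff j else 0, ?_, ?_⟩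
    · intro j _ _
      simp only
      split_ifs with hj
      · exact neg_mem (p.2 j)
      · exact Ideal.zero_mem _
    · have h5 : ∑ j ∈ Finset.Icc 1 (N + m),
          (if j ≤ m then -(p : R[X]).coeff j else 0) * f ^ (N + m - j) =
          ∑ j ∈ Finset.Icc 1 m, -((p : R[X]).coeff j) * f ^ (N + m - j) := by
        symm
        refine Finset.sum_subset_zero_on_sdiff (Finset.Icc_subset_Icc_right (by omega)) ?_ ?_
        · intro j hj
          rw [Finset.mem_sdiff, Finset.mem_Icc, Finset.mem_Icc] at hj
          rw [if_neg (by omega), zero_mul]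
        · intro j hj
          rw [if_pos (Finset.mem_Icc.1 hj).2]
      rw [h5, ← hN]
      change f ^ (N + m) + _ = f ^ N * _
      rw [mul_sub, Finset.mul_sum, ← pow_add, sub_eq_add_neg, ← Finset.sum_neg_distrib]
      congr 1
      refine Finset.sum_congr rfl fun j hj => ?_
      rw [Nat.add_sub_assoc (Finset.mem_Icc.1 hj).2, pow_add]
      ring
  · exfalso
    obtain ⟨P, hPm, hPle⟩ := Ideal.exists_le_maximal P₀ hP
    have hPp := hPm.isPrime
    let E := Localization.AtPrime P
    have hEn : IsNoetherianRing E := IsLocalization.isNoetherianRing P.primeCompl E hCn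
    have hnil : IsNilpotent (algebraMap C E F) := by
      refine isNilpotent_of_forall_pow_mem (E := E) (f := algebraMap C E F) fun M => ?_
      obtain ⟨k, hk⟩ := h M
      refine ⟨k, fun u => ?_⟩
      by_cases hMu : M * u ≤ k
      · rw [Nat.sub_eq_zero_of_le hMu, pow_zero, Ideal.one_eq_top]; exact Submodule.mem_top
      have h1 := Ideal.mem_map_of_mem (algebraMap R C) (hk u)
      rw [Ideal.map_pow, map_pow] at h1
      have h2 := Ideal.pow_right_mono hJ _ h1
      rw [mul_pow, Ideal.span_singleton_pow, Ideal.mem_span_singleton_mul] at h2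
      obtain ⟨z, hz, hz2⟩ := h2
      have h3 : F ^ (u + k) = z := by
        refine hFpow (M * u - k) _ _ ?_
        rw [hz2, ← pow_add]
        congr 1
        have : (M + 1) * u = M * u + u := by ring
        omega
      have h4 : F ^ (u + k) ∈ P ^ (M * u - k) := h3 ▸ Ideal.pow_right_mono hPle _ hz
      have h5 := Ideal.mem_map_of_mem (algebraMap C E) h4
      rw [Ideal.map_pow, Localization.AtPrime.map_eq_maximalIdeal, map_pow] at h5
      exact h5
    obtain ⟨n, hn⟩ := hnil
    rw [← map_pow] at hn
    obtain ⟨⟨c, hc⟩, hc0⟩ := (IsLocalization.map_eq_zero_iff P.primeCompl E _).1 hn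
    have : c = 0 := hFpow n _ _ (by rw [mul_zero, mul_comm]; exact hc0)
    exact hc (this ▸ P.zero_mem)

namespace MulFilt

theorem W_le_span_integral {R : Type*} [CommRing R] [IsNoetherianRing R] (I : Ideal R) {n : ℕ}
    (hn : 0 < n) {f : R} (hf : f ∈ (powFilt I).W n) (M : ℕ) :
    ∃ k : ℕ, ∀ u, f ^ ((M + 1) * u) ∈ (I ^ n) ^ (M * u - k) := by
  have hM : (0 : ℝ) < M + 1 := by positivity
  have hn' : (0 : ℝ) < n := by exact_mod_cast hn
  obtain ⟨k, hk⟩ := mem_W.1 hf (n * M / (M + 1)) (by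
    rw [div_lt_iff₀ hM]; nlinarith)
  refine ⟨⌈k⌉₊, fun u => ?_⟩
  have h1 := hk ((M + 1) * u)
  change _ ∈ I ^ _ at h1
  rw [← pow_mul]
  refine Ideal.pow_le_pow_right ?_ h1
  rcases Nat.le_total (M * u) ⌈k⌉₊ with h | h
  · rw [Nat.sub_eq_zero_of_le h]; simp
  · rw [← Nat.cast_le (α := ℝ)]
    refine le_trans ?_ (Nat.le_ceil _)
    push_cast [Nat.cast_sub h]
    have h2 : ((M + 1) * u : ℝ) * (n * M / (M + 1)) = n * M * u := by field_simp
    rw [h2]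
    have h3 := Nat.le_ceil k
    have h4 : (1 : ℝ) ≤ n := by exact_mod_cast hn
    have h5 : (0 : ℝ) ≤ ⌈k⌉₊ := by positivity
    nlinarith

theorem mem_W_of_integral {R : Type*} [CommRing R] (I : Ideal R) {n : ℕ} {f : R}
    {m : ℕ} {a : ℕ → R} (ha : ∀ j, 1 ≤ j → j ≤ m → a j ∈ (I ^ n) ^ j)
    (h : f ^ m + ∑ j ∈ Finset.Icc 1 m, a j * f ^ (m - j) = 0) : f ∈ (powFilt I).W n := by
  have key : ∀ s : ℕ, f ^ s ∈ (I ^ n) ^ (s - m) := by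
    intro s
    induction s using Nat.strong_induction_on with
    | _ s ih =>
      rcases Nat.lt_or_ge s m with hs | hs
      · rw [Nat.sub_eq_zero_of_le hs.le, pow_zero, Ideal.one_eq_top]; exact Submodule.mem_top
      have h1 : f ^ s = ∑ j ∈ Finset.Icc 1 m, -(a j * f ^ (s - j)) := by
        have h2 : f ^ s = f ^ (s - m) * f ^ m := by rw [← pow_add]; congr 1; omega
        rw [h2, eq_neg_of_add_eq_zero_left h, Finset.sum_neg_distrib, mul_neg, Finset.mul_sum]
        congr 1
        refine Finset.sum_congr rfl fun j hj => ?_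
        have := (Finset.mem_Icc.1 hj).2
        rw [show s - j = (s - m) + (m - j) by omega, pow_add]; ring
      rw [h1]
      refine Ideal.sum_mem _ fun j hj => neg_mem ?_
      obtain ⟨hj1, hj2⟩ := Finset.mem_Icc.1 hj
      have h3 := Ideal.mul_mem_mul (ha j hj1 hj2) (ih (s - j) (by omega))
      rw [← pow_add] at h3
      exact Ideal.pow_le_pow_right (by omega) h3
  rw [mem_W]
  intro t' ht'
  refine ⟨n * m, fun s => ?_⟩
  have h1 := key s
  rw [← pow_mul] at h1
  refine Ideal.pow_le_pow_right (Nat.ceil_le.2 ?_) h1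
  rcases Nat.le_total m s with hs | hs
  · push_cast [Nat.cast_sub hs]
    have : (0 : ℝ) ≤ s := by positivity
    nlinarith
  · rw [Nat.sub_eq_zero_of_le hs]
    have : (0 : ℝ) ≤ s := by positivity
    have h2 : (s : ℝ) ≤ m := by exact_mod_cast hs
    have h3 : (0 : ℝ) ≤ n := by positivity
    simp only [mul_zero, Nat.cast_zero]
    nlinarith

end MulFilt

end AsymptoticIntegralClosure

section CompletionNoetherian

variable {R : Type*} [CommRing R] [IsNoetherianRing R] [IsLocalRing R]

theorem AdicCompletion.exists_sub_algebraMap_mem_map_pow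
    (a : AdicCompletion (maximalIdeal R) R) (n : ℕ) :
    ∃ r : R, a - algebraMap R (AdicCompletion (maximalIdeal R) R) r ∈
      (maximalIdeal R ^ n).map (algebraMap R (AdicCompletion (maximalIdeal R) R)) := by
  have fg : (maximalIdeal R).FG := (isNoetherianRing_iff_ideal_fg R).1 inferInstance _
  obtain ⟨z, hz⟩ := Ideal.Quotient.mk_surjective (a.1 n)
  refine ⟨z, ?_⟩
  rw [← Submodule.restrictScalars_mem R, ← Ideal.smul_top_eq_map]
  have : a - (algebraMap R (AdicCompletion (maximalIdeal R) R)) z ∈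
    (maximalIdeal R) ^ n • (⊤ : Submodule R (AdicCompletion (maximalIdeal R) R)) := by
    rw [AdicCompletion.algebraMap_apply, AdicCompletion.pow_smul_top_eq_ker_eval fg]
    simpa [AdicCompletion.eval, sub_eq_zero] using hz.symm
  exact this

theorem AdicCompletion.isNoetherianRing_of_isLocalRing :
    IsNoetherianRing (AdicCompletion (maximalIdeal R) R) := by
  have fg : (maximalIdeal R).FG := (isNoetherianRing_iff_ideal_fg R).1 inferInstance _
  obtain ⟨N, x, hx⟩ := Submodule.fg_iff_exists_fin_generating_family.1 fg
  set A := AdicCompletion (maximalIdeal R) R with hA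
  let φ : MvPolynomial (Fin N) R →+* A :=
    (algebraMap R A).comp (MvPolynomial.eval x)
  set 𝔫 := MvPolynomial.idealOfVars (Fin N) R with h𝔫
  have hmap : 𝔫.map φ = maximalIdeal A := by
    have h1 : 𝔫.map (MvPolynomial.eval x) = maximalIdeal R := by
      rw [h𝔫, MvPolynomial.idealOfVars, Ideal.map_span, ← hx]
      change Submodule.span R _ = _
      congr 1
      ext z
      simp
    rw [AdicCompletion.maximalIdeal_eq_map, ← Ideal.map_map, h1]
  have hle : ∀ n, 𝔫 ^ n ≤ (maximalIdeal A ^ n).comap φ := fun n => by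
    rw [← Ideal.map_le_iff_le_comap, Ideal.map_pow, hmap]
  let f : ∀ n, AdicCompletion 𝔫 (MvPolynomial (Fin N) R) →+* A ⧸ maximalIdeal A ^ n := fun n =>
    (Ideal.quotientMap (maximalIdeal A ^ n) φ (hle n)).comp (AdicCompletion.evalₐ 𝔫 n).toRingHom
  have hf : ∀ {m n : ℕ} (hle : m ≤ n), (Ideal.Quotient.factorPow (maximalIdeal A) hle).comp (f n) = f m := by
    intro m n hmn
    ext z
    obtain ⟨a, rfl⟩ := AdicCompletion.mk_surjective 𝔫 _ z
    set z := AdicCompletion.mk 𝔫 (MvPolynomial (Fin N) R) a with hz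
    set p := a n with hpa
    have hp : Ideal.Quotient.mk _ p = AdicCompletion.evalₐ 𝔫 n z :=
      (AdicCompletion.evalₐ_mk 𝔫 n a).symm
    have hp' : AdicCompletion.evalₐ 𝔫 m z = Ideal.Quotient.mk _ p := by
      rw [hz, AdicCompletion.evalₐ_mk]
      exact (AdicCompletion.Ideal.mk_eq_mk 𝔫 hmn a).symm
    have h1 : f n z = Ideal.Quotient.mk _ (φ p) := by
      simp only [f, RingHom.comp_apply]
      change Ideal.quotientMap _ φ _ (AdicCompletion.evalₐ 𝔫 n z) = _
      rw [← hp, Ideal.quotientMap_mk]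
    have h2 : f m z = Ideal.Quotient.mk _ (φ p) := by
      simp only [f, RingHom.comp_apply]
      change Ideal.quotientMap _ φ _ (AdicCompletion.evalₐ 𝔫 m z) = _
      rw [hp', Ideal.quotientMap_mk]
    rw [RingHom.comp_apply, h1, h2]
    rfl
  let g := IsAdicComplete.liftRingHom (maximalIdeal A) f hf
  have hg : ∀ p, g (algebraMap _ _ p) = φ p := by
    intro p
    rw [IsHausdorff.eq_iff_smodEq (I := maximalIdeal A)]
    intro n
    rw [smul_eq_mul, Ideal.mul_top, SModEq]
    change Ideal.Quotient.mk _ (g _) = Ideal.Quotient.mk _ _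
    rw [IsAdicComplete.mk_liftRingHom]
    simp only [f, RingHom.comp_apply]
    change Ideal.quotientMap _ φ _ (AdicCompletion.evalₐ 𝔫 n (algebraMap _ _ p)) = _
    rw [AdicCompletion.algebraMap_apply, Algebra.algebraMap_self, RingHom.id_apply, AdicCompletion.evalₐ_of, Ideal.quotientMap_mk]
  have hI : (𝔫.map (algebraMap _ (AdicCompletion 𝔫 (MvPolynomial (Fin N) R)))).map g =
      maximalIdeal A := by
    rw [Ideal.map_map, ← hmap]
    congr 1
    ext p <;> simp [hg]
  have hc := AdicCompletion.isAdicComplete_self 𝔫 (MvPolynomial.idealOfVars_fg _ _)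
  have hH : IsHausdorff ((𝔫.map (algebraMap _ (AdicCompletion 𝔫 (MvPolynomial (Fin N) R)))).map g) A := by
    rw [hI]; infer_instance
  have hs : Function.Surjective g := by
    refine surjective_of_mk_map_comp_surjective
      (I := 𝔫.map (algebraMap _ (AdicCompletion 𝔫 (MvPolynomial (Fin N) R)))) g ?_
    intro y
    obtain ⟨a, rfl⟩ := Ideal.Quotient.mk_surjective y
    obtain ⟨r, hr⟩ := AdicCompletion.exists_sub_algebraMap_mem_map_pow a 1
    refine ⟨algebraMap (MvPolynomial (Fin N) R) _ (MvPolynomial.C r), ?_⟩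
    rw [RingHom.comp_apply, hg, eq_comm, Ideal.Quotient.eq, hI, AdicCompletion.maximalIdeal_eq_map]
    simpa [φ] using hr
  have h1 : IsNoetherianRing (AdicCompletion 𝔫 (MvPolynomial (Fin N) R)) :=
    isNoetherianRing_of_ringEquiv (MvPowerSeries (Fin N) R)
      (MvPowerSeries.toAdicCompletionAlgEquiv (Fin N) R).toRingEquiv
  exact isNoetherianRing_of_surjective _ _ g hs

end CompletionNoetherian

section DimensionFromGrowth

theorem ringKrullDim_quotient_le_of_forall_isPrime {A : Type*} [CommRing A] {J : Ideal A}
    {n : WithBot ℕ∞} (h : ∀ p : Ideal A, p.IsPrime → J ≤ p → ringKrullDim (A ⧸ p) ≤ n) :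
    ringKrullDim (A ⧸ J) ≤ n := by
  rw [ringKrullDim_quotient, Order.krullDim]
  refine iSup_le fun l => ?_
  refine le_trans ?_ (h l.head.1.asIdeal l.head.1.isPrime l.head.2)
  rw [ringKrullDim_quotient]
  let l' : LTSeries (PrimeSpectrum.zeroLocus (R := A) l.head.1.asIdeal) :=
    { length := l.length
      toFun := fun i => ⟨(l i).1, by
        have : l.head ≤ l i := LTSeries.head_le l i
        exact this⟩
      step := fun i => l.step i }
  exact le_iSup_of_le l' le_rfl

theorem colonElem_of_isPrime {A : Type*} [CommRing A] {p : Ideal A} (hp : p.IsPrime) {x : A} (hx : x ∉ p) :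
    colonElem p x = p := by
  ext a
  rw [mem_colonElem]
  exact ⟨fun h => (hp.mem_or_mem h).resolve_right hx, fun h => p.mul_mem_right _ h⟩

variable {A : Type*} [CommRing A] [IsLocalRing A] [IsNoetherianRing A]

theorem exists_colonElem_pow_sup_le (p : Ideal A) (x : A) :
    ∃ k : ℕ, ∀ n, colonElem (maximalIdeal A ^ n ⊔ p) x ≤
      maximalIdeal A ^ (n - k) ⊔ colonElem p x := by
  obtain ⟨k, hk⟩ := Ideal.exists_pow_inf_eq_pow_smul (M := A ⧸ p) (maximalIdeal A)
    (Submodule.span A {Ideal.Quotient.mk p x})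
  refine ⟨k, fun n a ha => ?_⟩
  rw [mem_colonElem] at ha
  rcases lt_or_ge n k with hn | hn
  · rw [Nat.sub_eq_zero_of_le hn.le, pow_zero, Ideal.one_eq_top]
    exact Ideal.mem_sup_left trivial
  have key : ∀ (q : ℕ) (z : A), (Ideal.Quotient.mk p z) ∈ (maximalIdeal A ^ q • ⊤ : Submodule A (A ⧸ p)) ↔
      z ∈ maximalIdeal A ^ q ⊔ p := by
    intro q z
    rw [Ideal.smul_top_eq_map, Submodule.restrictScalars_mem]
    change _ ∈ Ideal.map (Ideal.Quotient.mk p) _ ↔ _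
    rw [Ideal.mem_quotient_iff_mem_sup]
  have h1 : Ideal.Quotient.mk p (a * x) ∈ maximalIdeal A ^ n • ⊤ ⊓ Submodule.span A {Ideal.Quotient.mk p x} := by
    refine ⟨(key n _).2 ha, ?_⟩
    exact Submodule.mem_span_singleton.2 ⟨a, rfl⟩
  rw [hk n hn] at h1
  have h2 := Submodule.smul_mono (le_refl (maximalIdeal A ^ (n - k))) (inf_le_right :
    (maximalIdeal A ^ k • ⊤ ⊓ Submodule.span A {Ideal.Quotient.mk p x}) ≤ _) h1
  obtain ⟨b, hb, hbx⟩ := Submodule.mem_smul_span_singleton.1 h2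
  have h3 : b * x - a * x ∈ p := by
    rw [← Ideal.Quotient.eq]
    exact hbx
  have h4 : a - b ∈ colonElem p x := by
    rw [mem_colonElem, ← neg_mem_iff]
    convert h3 using 1
    ring
  have h5 : a = b + (a - b) := by ring
  rw [h5]
  exact Submodule.add_mem_sup hb h4

theorem ringKrullDim_quotient_le_of_growth (c : ℕ) : ∀ (J : Ideal A),
    (∃ C : ℕ, ∀ n : ℕ, colength (maximalIdeal A ^ n ⊔ J) ≤ (C * (n + 1) ^ c : ℕ)) →
    ringKrullDim (A ⧸ J) ≤ c := by
  induction c with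
  | zero =>
    rintro J ⟨C, hC⟩
    refine ringKrullDim_quotient_le_of_forall_isPrime fun p hp hJp => ?_
    have hne : ∀ n, colength (maximalIdeal A ^ n ⊔ J) ≠ ⊤ := fun n =>
      ne_top_of_le_ne_top (ENat.natCast_ne_top _) (hC n)
    choose L hL using fun n => ENat.ne_top_iff_exists.1 (hne n)
    have hb : ∀ n, L n ≤ C := fun n => by
      have := hC n
      rw [← hL n] at this
      simpa using ENat.natCast_le_natCast.1 this
    have hmono : Monotone L := fun a b hab => by
      have h := colength_anti (sup_le_sup_right (Ideal.pow_le_pow_right hab) J :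
        maximalIdeal A ^ b ⊔ J ≤ maximalIdeal A ^ a ⊔ J)
      rw [← hL, ← hL] at h
      exact ENat.natCast_le_natCast.1 h
    obtain ⟨n, hn⟩ : ∃ n, L (n + 1) ≤ L n := by
      by_contra! hcon
      have : ∀ n, n ≤ L n := fun n => by
        induction n with
        | zero => exact Nat.zero_le _
        | succ n ih => exact lt_of_le_of_lt ih (hcon n)
      have h1 := this (C + 1)
      have h2 := hb (C + 1)
      omega
    have heq : maximalIdeal A ^ (n + 1) ⊔ J = maximalIdeal A ^ n ⊔ J := by
      refine eq_of_le_of_colength_le (sup_le_sup_right (Ideal.pow_le_pow_right n.le_succ) J) ?_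
        (hne _)
      rw [← hL, ← hL]
      exact_mod_cast hn
    have hle : maximalIdeal A ^ n ≤ J := by
      refine Submodule.le_of_le_smul_of_le_jacobson_bot (I := maximalIdeal A)
        (IsNoetherian.noetherian _) (IsLocalRing.maximalIdeal_le_jacobson _) ?_
      have h1 : maximalIdeal A ^ n ≤ maximalIdeal A ^ (n + 1) ⊔ J := heq ▸ le_sup_left
      rw [pow_succ', sup_comm] at h1
      exact h1
    have hpm : p = maximalIdeal A :=
      le_antisymm (le_maximalIdeal hp.ne_top) (hp.le_of_pow_le (hle.trans hJp))
    subst hpm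
    have := (Ideal.Quotient.maximal_ideal_iff_isField_quotient (maximalIdeal A)).1 inferInstance
    rw [ringKrullDim_eq_zero_of_isField this]
    simp
  | succ c ih =>
    rintro J ⟨C, hC⟩
    refine ringKrullDim_quotient_le_of_forall_isPrime fun p hp hJp => ?_
    by_cases hpm : maximalIdeal A ≤ p
    · have hpm : p = maximalIdeal A := le_antisymm (le_maximalIdeal hp.ne_top) hpm
      subst hpm
      have := (Ideal.Quotient.maximal_ideal_iff_isField_quotient (maximalIdeal A)).1 inferInstance
      rw [ringKrullDim_eq_zero_of_isField this]
      exact_mod_cast Nat.zero_le _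
    obtain ⟨x, hxm, hxp⟩ := Set.not_subset.1 hpm
    have hdim : ringKrullDim (A ⧸ p) ≤ ringKrullDim (A ⧸ (p ⊔ Ideal.span {x})) + 1 := by
      have : IsLocalRing (A ⧸ p) := IsLocalRing.of_surjective' (Ideal.Quotient.mk p) Ideal.Quotient.mk_surjective
      have h := ringKrullDim_le_ringKrullDim_quotient_add_card {Ideal.Quotient.mk p x} (by
        rw [Finset.coe_singleton, Set.singleton_subset_iff, SetLike.mem_coe,
          IsLocalRing.ringJacobson_eq_maximalIdeal, mem_maximalIdeal, mem_nonunits_iff]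
        intro hu
        obtain ⟨y, hy⟩ := hu.exists_right_inv
        obtain ⟨y, rfl⟩ := Ideal.Quotient.mk_surjective y
        rw [← map_mul, ← map_one (Ideal.Quotient.mk p), Ideal.Quotient.eq] at hy
        have h1 := le_maximalIdeal hp.ne_top hy
        rw [← Ideal.neg_mem_iff, neg_sub] at h1
        have h2 := Ideal.add_mem _ h1 ((maximalIdeal A).mul_mem_right y hxm)
        rw [sub_add_cancel] at h2
        exact (maximalIdeal A).ne_top_iff_one.1 (maximalIdeal.isMaximal A).ne_top h2)
      rw [Finset.card_singleton, Finset.coe_singleton] at h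
      have e := ringKrullDim_eq_of_ringEquiv (DoubleQuot.quotQuotEquivQuotSup p (Ideal.span {x}))
      rw [Ideal.map_span, Set.image_singleton] at e
      rw [← e]
      exact h
    refine hdim.trans ?_
    push_cast
    refine add_le_add_left (ih _ ?_) _
    obtain ⟨k, hk⟩ := exists_colonElem_pow_sup_le p x
    simp only [colonElem_of_isPrime hp hxp] at hk
    have hne : ∀ n, colength (maximalIdeal A ^ n ⊔ p) ≠ ⊤ := fun n =>
      ne_top_of_le_ne_top (ENat.natCast_ne_top _) ((colength_anti (sup_le_sup_left hJp _)).trans (hC n))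
    choose L hL using fun n => ENat.ne_top_iff_exists.1 (hne n)
    have hLb : ∀ n, L n ≤ C * (n + 1) ^ (c + 1) := fun n => by
      have := (colength_anti (sup_le_sup_left hJp _)).trans (hC n)
      rw [← hL n] at this
      exact ENat.natCast_le_natCast.1 this
    have hne' : ∀ n, colength (maximalIdeal A ^ n ⊔ (p ⊔ Ideal.span {x})) ≠ ⊤ := fun n =>
      ne_top_of_le_ne_top (hne n) (colength_anti (sup_le_sup_left le_sup_left _))
    choose H hH using fun n => ENat.ne_top_iff_exists.1 (hne' n)
    have hHmono : Monotone H := fun a b hab => by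
      have h := colength_anti (sup_le_sup_right (Ideal.pow_le_pow_right hab) (p ⊔ Ideal.span {x}) :
        maximalIdeal A ^ b ⊔ (p ⊔ Ideal.span {x}) ≤ maximalIdeal A ^ a ⊔ (p ⊔ Ideal.span {x}))
      rw [← hH, ← hH] at h
      exact ENat.natCast_le_natCast.1 h
    have hstep : ∀ n, H (n + k) + L n ≤ L (n + k) := fun n => by
      have h1 := colength_eq_sup_add_colon (maximalIdeal A ^ (n + k) ⊔ p) x
      have h2 := colength_anti (hk (n + k))
      rw [Nat.add_sub_cancel, ← hL] at h2
      rw [sup_assoc, ← hL, ← hH] at h1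
      have h3 : ((H (n + k) + L n : ℕ) : ℕ∞) ≤ L (n + k) := by
        rw [h1]
        push_cast
        exact add_le_add_right h2 _
      exact_mod_cast h3
    have hsum : ∀ n i, i * H n ≤ L (n + i * k) := fun n i => by
      induction i with
      | zero => simp
      | succ i ihi =>
        have h1 := hstep (n + i * k)
        have h2 : H n ≤ H (n + i * k + k) := hHmono (by omega)
        have h3 : n + (i + 1) * k = n + i * k + k := by ring
        rw [h3, add_mul, one_mul]
        omega
    refine ⟨C * (k + 1) ^ (c + 1), fun n => ?_⟩
    rw [← hH]
    refine ENat.natCast_le_natCast.2 ?_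
    have h1 := (hsum n (n + 1)).trans (hLb _)
    have h2 : n + (n + 1) * k + 1 = (k + 1) * (n + 1) := by ring
    rw [h2, mul_pow, pow_succ (n + 1)] at h1
    refine Nat.le_of_mul_le_mul_left (h1.trans_eq ?_) n.succ_pos
    ring

end DimensionFromGrowth

section Growth

theorem colength_le_mul_pow {A : Type*} [CommRing A] {d : ℕ} (x : Fin d → A) {I : Ideal A}
    (hx : ∀ i, x i ∈ I) {B : ℕ} (hB : colength (Ideal.span (Set.range x)) = B) (n : ℕ) :
    colength (I ^ n) ≤ (B * n ^ d : ℕ) := by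
  rcases n.eq_zero_or_pos with rfl | hn
  · rw [pow_zero, Ideal.one_eq_top, colength_top]
    exact zero_le
  set J : Ideal A := Ideal.span (Set.range fun i => x i ^ n) with hJ
  have hJI : J ≤ I ^ n := by
    rw [hJ, Ideal.span_le]
    rintro _ ⟨i, rfl⟩
    exact Ideal.pow_mem_pow (hx i) n
  refine (colength_anti hJI).trans ?_
  set S : Finset (Fin d → ℕ) := Fintype.piFinset fun _ => Finset.range n with hS
  have key : ∀ μ ∈ S, ∀ a ∈ Ideal.span (Set.range x), a * mon x μ ∈ J ⊔ Ideal.span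
      (mon x '' {ν | ν ∈ S ∧ ∑ i, μ i < ∑ i, ν i}) := by
    intro μ hμ a ha
    induction ha using Submodule.span_induction with
    | mem y hy =>
      obtain ⟨i, rfl⟩ := hy
      by_cases h : μ i + 1 < n
      · refine Ideal.mem_sup_right (Ideal.subset_span ⟨μ + Pi.single i 1, ⟨?_, ?_⟩, ?_⟩)
        · rw [hS, Fintype.mem_piFinset] at hμ ⊢
          intro j
          by_cases hj : j = i
          · subst hj; simpa using h
          · simpa [hj] using hμ j
        · simp [Finset.sum_add_distrib]
        · rw [mon_add, mon_single, mul_comm]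
      · refine Ideal.mem_sup_left ?_
        rw [hS, Fintype.mem_piFinset] at hμ
        have h1 : μ i + 1 = n := by
          have := Finset.mem_range.1 (hμ i)
          omega
        have h2 : x i * mon x μ = x i ^ n * ∏ j ∈ Finset.univ.erase i, x j ^ μ j := by
          rw [mon, ← Finset.mul_prod_erase _ _ (Finset.mem_univ i), ← h1]
          ring
        rw [h2]
        exact J.mul_mem_right _ (Ideal.subset_span ⟨i, rfl⟩)
    | zero => rw [zero_mul]; exact zero_mem _
    | add y z _ _ hy hz => rw [add_mul]; exact add_mem hy hz
    | smul b y _ hy => rw [smul_eq_mul, mul_assoc]; exact Ideal.mul_mem_left _ _ hy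
  refine (colength_le_sum S (fun μ => ∑ i, μ i) J (mon x) (fun _ => Ideal.span (Set.range x))
    key).trans ?_
  have htop : J ⊔ Ideal.span (mon x '' S) = ⊤ := by
    rw [Ideal.eq_top_iff_one]
    refine Ideal.mem_sup_right (Ideal.subset_span ⟨0, ?_, mon_zero x⟩)
    simp [hS, hn]
  rw [htop, colength_top, add_zero, Finset.sum_const, hB, hS, Fintype.card_piFinset]
  simp [mul_comm]

theorem colength_mul_ne_top {A : Type*} [CommRing A] (P : Ideal A) [P.IsMaximal] {K : Ideal A}
    (hfg : K.FG) (hK : colength K ≠ ⊤) : colength (P * K) ≠ ⊤ := by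
  classical
  obtain ⟨S, rfl⟩ := hfg
  have h := colength_le_sum S (fun _ => (0 : ℕ)) (P * Ideal.span (S : Set A)) (fun s => s)
    (fun _ => P) fun i hi a ha => Ideal.mem_sup_left (Ideal.mul_mem_mul ha (Ideal.subset_span hi))
  refine ne_top_of_le_ne_top ?_ h
  rw [Set.image_id', sup_eq_right.2 Ideal.mul_le_right, colength_maximal, Finset.sum_const]
  refine WithTop.add_ne_top.2 ⟨?_, hK⟩
  rw [nsmul_one]
  exact ENat.natCast_ne_top _

variable {A : Type*} [CommRing A] [IsLocalRing A] [IsNoetherianRing A]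

theorem colength_maximalIdeal_pow_ne_top (n : ℕ) : colength (maximalIdeal A ^ n) ≠ ⊤ := by
  induction n with
  | zero => simp [Ideal.one_eq_top, colength_top]
  | succ n ih =>
    rw [pow_succ']
    exact colength_mul_ne_top _ (IsNoetherian.noetherian _) ih

theorem exists_maximalIdeal_pow_le_of_radical {Q : Ideal A} (h : maximalIdeal A ≤ Q.radical) :
    ∃ c, maximalIdeal A ^ c ≤ Q := 
  Ideal.exists_pow_le_of_le_radical_of_fg h (IsNoetherian.noetherian _)

theorem exists_growth {e : ℕ} (he : ringKrullDim A = e) :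
    ∃ B : ℕ, ∀ n, colength (maximalIdeal A ^ n) ≤ (B * n ^ e : ℕ) := by
  obtain ⟨s, hs, hcard⟩ := (maximalIdeal A).exists_finset_card_eq_height_of_isNoetherianRing
  have hse : s.card = e := by
    have h1 := IsLocalRing.maximalIdeal_height_eq_ringKrullDim (R := A)
    rw [he, ← hcard] at h1
    exact_mod_cast h1
  subst hse
  have hx : Set.range (fun i => (s.equivFin.symm i : A)) = s := by
    ext z
    constructor
    · rintro ⟨i, rfl⟩
      exact (s.equivFin.symm i).2
    · intro hz
      exact ⟨s.equivFin ⟨z, hz⟩, by simp⟩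
  have hrad : maximalIdeal A ≤ (Ideal.span (s : Set A)).radical := by
    rw [Ideal.radical_eq_sInf]
    refine le_sInf ?_
    rintro p ⟨hp, hpp⟩
    exact hs.2 ⟨hpp, hp⟩ (le_maximalIdeal hpp.ne_top)
  obtain ⟨c, hc⟩ := exists_maximalIdeal_pow_le_of_radical hrad
  obtain ⟨B, hB⟩ := ENat.ne_top_iff_exists.1
    (ne_top_of_le_ne_top (colength_maximalIdeal_pow_ne_top c) (colength_anti hc))
  refine ⟨B, colength_le_mul_pow (fun i => (s.equivFin.symm i : A)) (fun i => ?_) ?_⟩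
  · exact hs.1.2 (Ideal.subset_span (s.equivFin.symm i).2)
  · rw [hx, hB]

end Growth

section CompletionTransfer

variable {R : Type*} [CommRing R] [IsNoetherianRing R] [IsLocalRing R]

theorem exists_nat_ringKrullDim {A : Type*} [CommRing A] [FiniteRingKrullDim A] :
    ∃ e : ℕ, ringKrullDim A = e := by
  obtain ⟨a, ha⟩ := WithBot.ne_bot_iff_exists.1 (ringKrullDim_ne_bot (R := A))
  have h : a ≠ ⊤ := by
    rintro rfl
    exact ringKrullDim_ne_top (R := A) ha.symm
  obtain ⟨e, rfl⟩ := ENat.ne_top_iff_exists.1 h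
  exact ⟨e, ha.symm⟩

theorem colength_map_pow_adicCompletion (n : ℕ) :
    colength (maximalIdeal (AdicCompletion (maximalIdeal R) R) ^ n) =
      colength (maximalIdeal R ^ n) := by
  rw [AdicCompletion.maximalIdeal_eq_map, ← Ideal.map_pow,
    colength_map_of_flat AdicCompletion.maximalIdeal_eq_map]

theorem le_ringKrullDim_adicCompletion :
    ringKrullDim R ≤ ringKrullDim (AdicCompletion (maximalIdeal R) R) := by
  have := AdicCompletion.isNoetherianRing_of_isLocalRing (R := R)
  obtain ⟨e, he⟩ := exists_nat_ringKrullDim (A := AdicCompletion (maximalIdeal R) R)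
  obtain ⟨B, hB⟩ := exists_growth he
  rw [he, ringKrullDim_eq_of_ringEquiv (RingEquiv.quotientBot R).symm]
  refine ringKrullDim_quotient_le_of_growth e ⊥ ⟨B, fun n => ?_⟩
  rw [sup_bot_eq, ← colength_map_pow_adicCompletion]
  refine (hB n).trans ?_
  exact_mod_cast Nat.mul_le_mul_left B (Nat.pow_le_pow_left n.le_succ e)

theorem classC_adicCompletion {d : ℕ} (hd : 0 < d) (hdim : ringKrullDim R = d)
    (hunmixed : ∀ p ∈ associatedPrimes (AdicCompletion (maximalIdeal R) R)
        (AdicCompletion (maximalIdeal R) R),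
      ringKrullDim (AdicCompletion (maximalIdeal R) R ⧸ p) =
        ringKrullDim (AdicCompletion (maximalIdeal R) R)) :
    ClassC (AdicCompletion (maximalIdeal R) R) d := by
  have hN := AdicCompletion.isNoetherianRing_of_isLocalRing (R := R)
  refine ⟨hN, inferInstance, ?_, ?_⟩
  · obtain ⟨B, hB⟩ := exists_growth hdim
    exact ⟨B, fun n => (colength_map_pow_adicCompletion n).trans_le (hB n)⟩
  · rintro z hz ⟨B, hB⟩
    obtain ⟨p, hp, hzp⟩ :=
      exists_le_isAssociatedPrime_of_isNoetherianRing (AdicCompletion (maximalIdeal R) R) z hz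
    obtain ⟨k, hk⟩ := exists_colonElem_pow_sup_le ⊥ z
    have hle : colonElem ⊥ z ≤ p := by
      refine le_trans (fun a ha => ?_) hzp
      rw [mem_colonElem] at ha
      rw [Submodule.mem_colon_singleton]
      exact ha
    have h1 : ringKrullDim (AdicCompletion (maximalIdeal R) R ⧸ p) ≤ (d - 1 : ℕ) := by
      refine ringKrullDim_quotient_le_of_growth (d - 1) p ⟨B * (k + 1) ^ (d - 1), fun n => ?_⟩
      have h2 := hk (n + k)
      rw [Nat.add_sub_cancel, sup_bot_eq] at h2
      refine (colength_anti (h2.trans (sup_le_sup_left hle _))).trans ((hB (n + k)).trans ?_)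
      rw [ENat.natCast_le_natCast, mul_assoc, ← mul_pow]
      refine Nat.mul_le_mul_left B (Nat.pow_le_pow_left ?_ _)
      nlinarith
    rw [hunmixed p hp] at h1
    have h3 := hdim ▸ (le_ringKrullDim_adicCompletion (R := R)).trans h1
    have h4 : d ≤ d - 1 := by exact_mod_cast h3
    omega

namespace MulFilt

theorem W_map_le_map_W_adicCompletion {I : Ideal R} (hI : I.radical = maximalIdeal R) (t : ℝ) :
    (powFilt (I.map (algebraMap R (AdicCompletion (maximalIdeal R) R)))).W t ≤
      ((powFilt I).W t).map (algebraMap R (AdicCompletion (maximalIdeal R) R)) := by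
  obtain ⟨c, hc⟩ := exists_maximalIdeal_pow_le_of_radical hI.ge
  have hle : (maximalIdeal R ^ (c * ⌈t⌉₊)) ≤ (powFilt I).W t := by
    refine le_trans ?_ (le_W _ t)
    rw [pow_mul]
    exact Ideal.pow_right_mono hc _
  intro z hz
  obtain ⟨r, hr⟩ := AdicCompletion.exists_sub_algebraMap_mem_map_pow z (c * ⌈t⌉₊)
  have h1 := Ideal.map_mono (f := algebraMap R (AdicCompletion (maximalIdeal R) R)) hle hr
  have h2 : r ∈ (powFilt I).W t := by
    rw [← comap_W_eq (B := AdicCompletion (maximalIdeal R) R), Ideal.mem_comap]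
    have h3 := sub_mem hz (map_W_le (B := AdicCompletion (maximalIdeal R) R) I t h1)
    rwa [sub_sub_cancel] at h3
  have h4 := add_mem h1 (Ideal.mem_map_of_mem (algebraMap R (AdicCompletion (maximalIdeal R) R)) h2)
  rwa [sub_add_cancel] at h4

theorem mainBound_of_unmixed {d : ℕ} (hd : 0 < d) (hdim : ringKrullDim R = d)
    (hunmixed : ∀ p ∈ associatedPrimes (AdicCompletion (maximalIdeal R) R)
        (AdicCompletion (maximalIdeal R) R),
      ringKrullDim (AdicCompletion (maximalIdeal R) R ⧸ p) =
        ringKrullDim (AdicCompletion (maximalIdeal R) R)) {I : Ideal R}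
    (hI : I.radical = maximalIdeal R) : MainBound I d := by
  obtain ⟨c, hc⟩ := exists_maximalIdeal_pow_le_of_radical hI.ge
  refine MainBound.of_flat AdicCompletion.maximalIdeal_eq_map (W_map_le_map_W_adicCompletion hI)
    (mainBound hd (classC_adicCompletion hd hdim hunmixed) ?_ ?_)
  · rw [AdicCompletion.maximalIdeal_eq_map]
    exact Ideal.map_mono (Ideal.le_radical.trans hI.le)
  · rw [colength_map_of_flat AdicCompletion.maximalIdeal_eq_map]
    exact ne_top_of_le_ne_top (colength_maximalIdeal_pow_ne_top c) (colength_anti hc)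

end MulFilt

end CompletionTransfer

section HilbertPolynomialAsymptotics

open Filter Topology

theorem tendsto_choose_add_div_pow (k : ℕ) :
    Tendsto (fun n : ℕ => ((n + k).choose k : ℝ) / (n : ℝ) ^ k) atTop (𝓝 (1 / k.factorial)) := by
  induction k with
  | zero => simp
  | succ k ih =>
    have h1 : Tendsto (fun n : ℕ => ((n : ℝ) + (k + 1)) / n / (k + 1)) atTop
        (𝓝 (1 / (k + 1))) := by
      have h0 : Tendsto (fun n : ℕ => 1 + ((k : ℝ) + 1) / n) atTop (𝓝 (1 + 0)) :=
        tendsto_const_nhds.add (tendsto_const_div_atTop_nhds_zero_nat _)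
      rw [add_zero] at h0
      refine (h0.div_const ((k : ℝ) + 1)).congr' ?_
      filter_upwards [eventually_gt_atTop 0] with n hn
      have : (n : ℝ) ≠ 0 := by positivity
      field_simp
    have h2 := ih.mul h1
    have e : (1 / (k.factorial : ℝ)) * (1 / (k + 1)) = 1 / ((k + 1).factorial : ℝ) := by
      rw [Nat.factorial_succ]; push_cast; field_simp
    rw [e] at h2
    refine h2.congr' ?_
    filter_upwards [eventually_gt_atTop 0] with n hn
    have hn' : (n : ℝ) ≠ 0 := by positivity
    have h3 : ((n : ℝ) + k + 1) * ((n + k).choose k : ℝ) =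
        ((n + (k + 1)).choose (k + 1) : ℝ) * (k + 1) := by
      have := Nat.add_one_mul_choose_eq (n + k) k
      exact_mod_cast this
    have hk : ((k : ℝ) + 1) ≠ 0 := by positivity
    rw [← div_eq_iff hk] at h3
    rw [← h3]
    field_simp
    ring

theorem tendsto_choose_add_div_pow_of_lt {k D : ℕ} (h : k < D) :
    Tendsto (fun n : ℕ => ((n + k).choose k : ℝ) / (n : ℝ) ^ D) atTop (𝓝 0) := by
  have h1 : Tendsto (fun n : ℕ => (((n : ℝ)) ^ (D - k))⁻¹) atTop (𝓝 0) :=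
    ((tendsto_pow_atTop (by omega)).comp tendsto_natCast_atTop_atTop).inv_tendsto_atTop
  have h2 := (tendsto_choose_add_div_pow k).mul h1
  rw [mul_zero] at h2
  refine h2.congr fun n => ?_
  rw [← div_eq_mul_inv, div_div, ← pow_add, Nat.add_sub_cancel' h.le]

theorem tendsto_sum_choose_div_pow (D : ℕ) (c : ℕ → ℝ) :
    Tendsto (fun n : ℕ => (∑ i ∈ range (D + 1), c i * ((n + D - i).choose (D - i) : ℝ)) /
      (n : ℝ) ^ D) atTop (𝓝 (c 0 / D.factorial)) := by
  have h1 : Tendsto (fun n : ℕ => ∑ i ∈ range D,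
      c (i + 1) * (((n + (D - (i + 1))).choose (D - (i + 1)) : ℝ) / (n : ℝ) ^ D)) atTop
      (𝓝 (∑ i ∈ range D, c (i + 1) * 0)) :=
    tendsto_finsetSum _ fun i hi => (tendsto_choose_add_div_pow_of_lt
      (by have := mem_range.1 hi; omega)).const_mul _
  have h2 := h1.add ((tendsto_choose_add_div_pow D).const_mul (c 0))
  simp only [mul_zero, sum_const_zero, zero_add, mul_one_div] at h2
  refine h2.congr fun n => ?_
  rw [sum_range_succ', add_div, sum_div]
  congr 1
  · refine sum_congr rfl fun i hi => ?_
    have := mem_range.1 hi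
    rw [mul_div_assoc, Nat.add_sub_assoc (by omega)]
  · simp [mul_div_assoc]

/-- If `L n` is given for large `n` by a polynomial with Hilbert coefficients `e`, and is bounded
by `r * C(n+d-1,d)` with `r` at most `d! L t / t ^ d` up to a factor close to `1`, then `e 1` is
nonnegative. -/
theorem coeff_one_nonneg_of_bound {d : ℕ} (hd : 0 < d) {L : ℕ → ℕ} {e : ℕ → ℤ} {N : ℕ}
    (hP : ∀ n ≥ N, (L (n + 1) : ℤ) =
      ∑ i ∈ range (d + 1), (-1 : ℤ) ^ i * e i * ((n + d - i).choose (d - i)))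
    (hL : ∀ δ : ℝ, 0 < δ → ∀ n, ∃ r : ℕ, L n ≤ r * (n + d - 1).choose d ∧
      ∀ᶠ t : ℕ in atTop, (r : ℝ) * (t : ℝ) ^ d ≤ (1 + δ) * d.factorial * L t) :
    0 ≤ e 1 := by
  have hlim : Tendsto (fun n : ℕ => (L (n + 1) : ℝ) / (n : ℝ) ^ d) atTop
      (𝓝 ((e 0 : ℝ) / d.factorial)) := by
    have := tendsto_sum_choose_div_pow d (fun i => (-1 : ℝ) ^ i * e i)
    simp only [pow_zero, one_mul] at this
    refine this.congr' ?_
    filter_upwards [eventually_ge_atTop N] with n hn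
    have := congrArg (Int.cast (R := ℝ)) (hP n hn)
    push_cast at this
    rw [this]
  have hbound : ∀ n, (L n : ℤ) ≤ e 0 * (n + d - 1).choose d := by
    intro n
    have hpos : (0 : ℝ) < |(e 0 : ℝ)| + 1 := by positivity
    obtain ⟨r, hr, ht⟩ := hL (1 / (|(e 0 : ℝ)| + 1)) (by positivity) n
    have hle : (r : ℝ) ≤ (1 + 1 / (|(e 0 : ℝ)| + 1)) * e 0 := by
      have h1 := hlim.const_mul ((1 + 1 / (|(e 0 : ℝ)| + 1)) * d.factorial)
      have h2 : (1 + 1 / (|(e 0 : ℝ)| + 1)) * d.factorial * ((e 0 : ℝ) / d.factorial) =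
          (1 + 1 / (|(e 0 : ℝ)| + 1)) * e 0 := by
        have : (d.factorial : ℝ) ≠ 0 := by positivity
        field_simp
      rw [h2] at h1
      refine ge_of_tendsto h1 ?_
      filter_upwards [(tendsto_add_atTop_nat 1).eventually ht, eventually_gt_atTop 0] with t ht h0
      rw [← mul_div_assoc, le_div_iff₀ (by positivity)]
      refine le_trans ?_ ht
      gcongr
      omega
    have hlt : (r : ℝ) < e 0 + 1 := by
      have h3 : 1 / (|(e 0 : ℝ)| + 1) * e 0 < 1 := by
        rw [one_div_mul_eq_div, div_lt_one hpos]
        linarith [le_abs_self (e 0 : ℝ)]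
      linarith [add_mul 1 (1 / (|(e 0 : ℝ)| + 1)) (e 0 : ℝ)]
    have hr0 : (r : ℤ) ≤ e 0 := by
      have : (r : ℤ) < e 0 + 1 := by exact_mod_cast hlt
      omega
    calc (L n : ℤ) ≤ r * (n + d - 1).choose d := by exact_mod_cast hr
      _ ≤ _ := by gcongr
  obtain ⟨D, rfl⟩ : ∃ D, d = D + 1 := ⟨d - 1, by omega⟩
  have hneg : ∀ n ≥ N, ∑ i ∈ range (D + 1),
      ((-1 : ℝ) ^ (i + 1) * e (i + 1)) * ((n + D - i).choose (D - i) : ℝ) ≤ 0 := by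
    intro n hn
    have h1 := hbound (n + 1)
    rw [hP n hn, sum_range_succ'] at h1
    have h2 : n + 1 + (D + 1) - 1 = n + (D + 1) := by omega
    simp only [h2, pow_zero, one_mul, Nat.sub_zero] at h1
    have h3 : ∑ i ∈ range (D + 1), (-1 : ℤ) ^ (i + 1) * e (i + 1) *
        ((n + D - i).choose (D - i) : ℤ) ≤ 0 := by
      refine le_trans (le_of_eq (sum_congr rfl fun i _ => ?_)) (by linarith : _ ≤ (0 : ℤ))
      rw [show n + (D + 1) - (i + 1) = n + D - i by omega,
        show D + 1 - (i + 1) = D - i by omega]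
    exact_mod_cast h3
  have h4 := le_of_tendsto (tendsto_sum_choose_div_pow D
    (fun i => (-1 : ℝ) ^ (i + 1) * e (i + 1))) (b := 0) (by
      filter_upwards [eventually_ge_atTop N] with n hn
      exact div_nonpos_of_nonpos_of_nonneg (hneg n hn) (by positivity))
  have h5 : (0 : ℝ) < D.factorial := by positivity
  rw [div_le_iff₀ h5] at h4
  simp only [zero_add, pow_one, neg_mul, one_mul, zero_mul, neg_nonpos] at h4
  exact_mod_cast h4

end HilbertPolynomialAsymptotics

section NormalHilbertFunction

variable {R : Type*} [CommRing R] [IsNoetherianRing R]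

theorem idealIntegralClosure_pow (I : Ideal R) {n : ℕ} (hn : 0 < n) :
    idealIntegralClosure (I ^ n) = (MulFilt.powFilt I).W n := by
  apply le_antisymm
  · refine Ideal.span_le.2 ?_
    rintro y ⟨m, hm, a, ha, h⟩
    exact MulFilt.mem_W_of_integral I ha h
  · intro f hf
    exact Ideal.subset_span
      (mem_integralOverIdeal_of_forall_pow_mem (MulFilt.W_le_span_integral I hn hf))

theorem moduleLength_quotient (J : Ideal R) :
    moduleLength R (R ⧸ J) = (colength J : WithBot ℕ∞) :=
  (Module.coe_length R (R ⧸ J)).symm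

end NormalHilbertFunction

/-- **Goto–Hong–Mandal, Theorem 1.1** (Vasconcelos' Positivity Conjecture).  Let `(R,m)` be
an analytically unramified unmixed Noetherian local ring of positive dimension.  Then
`ē₁(I) ≥ 0` for every `m`-primary ideal `I`. -/
theorem positivity_conjecture
    {R : Type*} [CommRing R] [IsNoetherianRing R] [IsLocalRing R]
    (d : ℕ) (hd : 0 < d) (hdim : ringKrullDim R = d)
    (hur : IsReduced (AdicCompletion (maximalIdeal R) R))
    (hunmixed : IsUnmixedLocalRing R) :
    ∀ I : Ideal R, I.radical = maximalIdeal R →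
      ∀ ebar : ℕ → ℤ, HasNormalHilbertCoeffs I d ebar → 0 ≤ ebar 1 := by
  intro I hI ebar ⟨N, hN⟩
  obtain ⟨L, hL, hbound⟩ := MulFilt.mainBound_of_unmixed hd hdim hunmixed hI
  refine coeff_one_nonneg_of_bound (L := L) (N := N) hd (fun n hn => ?_) hbound
  obtain ⟨l, h1, h2⟩ := hN n hn
  rw [idealIntegralClosure_pow I n.succ_pos, moduleLength_quotient, hL] at h1
  have : L (n + 1) = l := by exact_mod_cast h1
  rw [this, h2]
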